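/- For every λ ∈ (0,1/2) and every s ∈ (0,1) there exists r ∈ [3/5, 1) such that 𝓔(λ,s,r) ≠ ∅; that is, there exists a G-symmetric self-similar resistance form on AG_λ with renormalization factors r_1 = r_2 = r_3 = r and r_4 = s. -/

import Mathlib

open Filter Topology

noncomputable section

/-- The Euclidean plane. -/
abbrev E2 : Type := EuclideanSpace ℝ (Fin 2)

/-- The point of the Euclidean plane with coordinates `(a, b)`. -/
def e2 (a b : ℝ) : E2 := (WithLp.equiv 2 (Fin 2 → ℝ)).symm ![a, b]

/-- The vertices `p₁ = (1/2, √3/2)`, `p₂ = (0,0)`, `p₃ = (1,0)` of the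
equilateral triangle (indexed by `0, 1, 2`). -/
def pt : Fin 3 → E2 :=
  ![e2 (1 / 2) (Real.sqrt 3 / 2), e2 0 0, e2 1 0]

/-- The map `F_{4,λ}`: the orientation-preserving similarity of the plane
sending `p₁, p₂, p₃` to `(1/4+λ, √3/4)`, `(1/2−λ/2, √3 λ/2)`,
`(3/4−λ/2, √3/4−√3 λ/2)` respectively; in complex coordinates it is
`z ↦ a z + b` with `a = 1/4 + i √3 (1/4 − λ)`, `b = (1/2 − λ/2) + i √3 λ/2`. -/
def F4 (lam : ℝ) (x : E2) : E2 :=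
  e2 ((1 / 4) * x 0 - Real.sqrt 3 * (1 / 4 - lam) * x 1 + (1 / 2 - lam / 2))
     (Real.sqrt 3 * (1 / 4 - lam) * x 0 + (1 / 4) * x 1 + Real.sqrt 3 * lam / 2)

/-- The four maps of the iterated function system of `AG_λ`:
`F_{i,λ}(x) = (x + p_i)/2` for `i = 0,1,2` and `F_{3,λ} = F_{4,λ}`. -/
def Fmap (lam : ℝ) : Fin 4 → E2 → E2 :=
  ![fun x => (2⁻¹ : ℝ) • (x + pt 0),
    fun x => (2⁻¹ : ℝ) • (x + pt 1),
    fun x => (2⁻¹ : ℝ) • (x + pt 2),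
    F4 lam]

/-- Rotation by `2π/3` about the centroid `(1/2, √3/6)` of the triangle;
it generates the symmetry group `G` (of order 3) of rotations acting as `A₃`
on `{p₁, p₂, p₃}`. -/
def rot3 (x : E2) : E2 :=
  e2 (-(1 / 2) * (x 0 - 1 / 2) - (Real.sqrt 3 / 2) * (x 1 - Real.sqrt 3 / 6) + 1 / 2)
     ((Real.sqrt 3 / 2) * (x 0 - 1 / 2) - (1 / 2) * (x 1 - Real.sqrt 3 / 6) + Real.sqrt 3 / 6)

/-- The closed triangle `▲` with vertices `p₁, p₂, p₃`. -/
def Tri : Set E2 := convexHull ℝ {pt 0, pt 1, pt 2}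

/-- `K` is the attractor `AG_λ` of the iterated function system `{F_{i,λ}}`,
i.e. the unique nonempty compact set with `K = ⋃ᵢ F_{i,λ}(K)`. -/
def IsAG (lam : ℝ) (K : Set E2) : Prop :=
  K.Nonempty ∧ IsCompact K ∧ K = ⋃ i : Fin 4, Fmap lam i '' K

/-- A resistance form `(E, F)` on a set `X` in the sense of Kigami.
`dom` models the domain `F ⊆ l(X)` and `en` models the bilinear form `E`
(its values outside `dom × dom` are irrelevant). -/
structure ResistanceForm (X : Type*) where
  dom : Set (X → ℝ)
  en : (X → ℝ) → (X → ℝ) → ℝ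
  dom_const : ∀ a : ℝ, (fun _ => a) ∈ dom
  dom_add : ∀ f g, f ∈ dom → g ∈ dom → f + g ∈ dom
  dom_smul : ∀ (a : ℝ) f, f ∈ dom → a • f ∈ dom
  symm : ∀ f g, en f g = en g f
  add_left : ∀ f g h, f ∈ dom → g ∈ dom → h ∈ dom →
    en (f + g) h = en f h + en g h
  smul_left : ∀ (a : ℝ) f g, f ∈ dom → g ∈ dom → en (a • f) g = a * en f g
  nonneg : ∀ f, f ∈ dom → 0 ≤ en f f
  /-- (RF1): `E(f,f) = 0` iff `f` is constant. -/
  en_eq_zero_iff : ∀ f, f ∈ dom → (en f f = 0 ↔ ∃ a : ℝ, ∀ x, f x = a)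
  /-- (RF2): the quotient of `dom` by constants is complete in the `E`-norm. -/
  complete : ∀ u : ℕ → X → ℝ, (∀ n, u n ∈ dom) →
    (∀ ε > (0:ℝ), ∃ N, ∀ m ≥ N, ∀ n ≥ N, en (u m - u n) (u m - u n) < ε) →
    ∃ v ∈ dom, Tendsto (fun n => en (u n - v) (u n - v)) atTop (𝓝 0)
  /-- (RF3): finite sets admit arbitrary extensions. -/
  exten : ∀ (V : Finset X) (u : X → ℝ), ∃ f ∈ dom, ∀ x ∈ V, f x = u x
  /-- (RF4): the effective resistance between any two points is finite. -/
  resist_fin : ∀ x y : X, ∃ C : ℝ, ∀ f ∈ dom, (f x - f y) ^ 2 ≤ C * en f f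
  /-- (RF5): the Markov property. -/
  markov : ∀ f ∈ dom, (fun x => min (max (f x) 0) 1) ∈ dom ∧
    en (fun x => min (max (f x) 0) 1) (fun x => min (max (f x) 0) 1) ≤ en f f

/-- The resistance form `RF` on `AG_λ = K` is self-similar with renormalization
factors `r₁ = r₂ = r₃ = r` and `r₄ = s`: the maps `F_{i,λ}` restrict to
self-maps `T i` of `K`, composition with them preserves the domain, and
`E(f,f) = r⁻¹ ∑_{i=1}^{3} E(f∘F_{i,λ}) + s⁻¹ E(f∘F_{4,λ})`. -/
def IsSelfSimilarForm (lam s r : ℝ) (K : Set E2) (RF : ResistanceForm ↥K) : Prop :=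
  ∃ T : Fin 4 → ↥K → ↥K,
    (∀ (i : Fin 4) (x : ↥K), (T i x : E2) = Fmap lam i ↑x) ∧
    ∀ f ∈ RF.dom, (∀ i : Fin 4, f ∘ T i ∈ RF.dom) ∧
      RF.en f f = r⁻¹ * (RF.en (f ∘ T 0) (f ∘ T 0) + RF.en (f ∘ T 1) (f ∘ T 1) +
        RF.en (f ∘ T 2) (f ∘ T 2)) + s⁻¹ * RF.en (f ∘ T 3) (f ∘ T 3)

/-- The resistance form `RF` on `K = AG_λ` is `G`-symmetric: the rotation by
`2π/3` about the centroid (which generates `G` and maps `K` onto itself)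
preserves the domain and the energy. -/
def IsGSymmetric (K : Set E2) (RF : ResistanceForm ↥K) : Prop :=
  ∃ σ : ↥K → ↥K, (∀ x : ↥K, (σ x : E2) = rot3 ↑x) ∧
    ∀ f ∈ RF.dom, f ∘ σ ∈ RF.dom ∧ RF.en (f ∘ σ) (f ∘ σ) = RF.en f f

/-- `RF ∈ 𝓔(λ,s,r)`: `RF` is a `G`-symmetric self-similar resistance form on
`K = AG_λ` with renormalization factors `(r, r, r, s)`. -/
def MemE (lam s r : ℝ) (K : Set E2) (RF : ResistanceForm ↥K) : Prop :=
  IsSelfSimilarForm lam s r K RF ∧ IsGSymmetric K RF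

/-- `R` is (on `K × K`) the resistance metric associated with the resistance
form `RF` on `K`: `R(x,y) = sup { (f x − f y)²/E(f,f) : f ∈ F, E(f,f) > 0 }`. -/
def AssocResistOn (K : Set E2) (RF : ResistanceForm ↥K) (R : E2 → E2 → ℝ) : Prop :=
  (∀ x ∈ K, R x x = 0) ∧
  ∀ x, ∀ hx : x ∈ K, ∀ y, ∀ hy : y ∈ K, x ≠ y →
    IsLUB {t : ℝ | ∃ f ∈ RF.dom, 0 < RF.en f f ∧
      t = (f ⟨x, hx⟩ - f ⟨y, hy⟩) ^ 2 / RF.en f f} (R x y)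

/-- The form is normalized: its resistance metric satisfies
`R(p₁,p₂) = R(p₂,p₃) = R(p₃,p₁) = 2/3`. -/
def Normalized (R : E2 → E2 → ℝ) : Prop :=
  R (pt 0) (pt 1) = 2 / 3 ∧ R (pt 1) (pt 2) = 2 / 3 ∧ R (pt 2) (pt 0) = 2 / 3

/-- `x` is a dyadic rational. -/
def IsDyadic (x : ℝ) : Prop := ∃ (k : ℤ) (m : ℕ), x = k / 2 ^ m

end

namespace AG

/-- `x` and `y` lie in a common cell of level `n`. -/
def Near {X : Type*} (T : Fin 3 → X → X) (S : X → X) : ℕ → X → X → Prop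
  | 0, _, _ => True
  | n + 1, x, y => (∃ i x' y', Near T S n x' y' ∧ T i x' = x ∧ T i y' = y) ∨
      ∃ x' y', Near T S n x' y' ∧ S x' = x ∧ S y' = y

/-- The oscillation of `f` on every cell of level `n` is at most `ε`. -/
def OscOn {X : Type*} (T : Fin 3 → X → X) (S : X → X) (n : ℕ) (ε : ℝ) (f : X → ℝ) : Prop :=
  ∀ x y, Near T S n x y → |f x - f y| ≤ ε

/-- The combinatorial structure of the gaskets `AG_λ`: three corner cells, an
inner cell, corners `p`, contact points `q`, a rotation, the edges and the affine functions. -/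
structure Gasket (X : Type*) where
  T : Fin 3 → X → X
  S : X → X
  p : Fin 3 → X
  q : Fin 3 → X
  rot : X → X
  Edge : Fin 3 → Set X
  cover : ∀ x, (∃ i y, T i y = x) ∨ ∃ y, S y = x
  T_inj : ∀ i, Function.Injective (T i)
  S_inj : Function.Injective S
  T_p : ∀ i, T i (p i) = p i
  T_cross : ∀ i j, T i (p j) = T j (p i)
  T_sep : ∀ i j x y, i ≠ j → T i x = T j y → x = p j ∧ y = p i
  S_p : ∀ i, S (p i) = T i (q i)
  S_sep : ∀ i x y, S x = T i y → x = p i ∧ y = q i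
  rot_p : ∀ i, rot (p i) = p (i + 1)
  rot_T : ∀ i x, rot (T i x) = T (i + 1) (rot x)
  rot_S : ∀ x, rot (S x) = S (rot x)
  rot_rot : ∀ x, rot (rot (rot x)) = x
  q_edge : ∀ i, q i ∈ Edge i
  edge_step : ∀ i x, x ∈ Edge i → ∃ l, l ≠ i ∧ ∃ y ∈ Edge i, T l y = x
  q_ne : ∀ i j, q i ≠ p j
  near : ∀ x y, (∀ n, Near T S n x y) → x = y
  aff : (Fin 3 → ℝ) → X → ℝ
  aff_p : ∀ x i, aff x (p i) = x i
  aff_T : ∀ x i, aff x ∘ T i = aff (fun j => (x i + x j) / 2)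
  aff_mem : ∀ x m M, (∀ i, m ≤ x i ∧ x i ≤ M) → ∀ z, m ≤ aff x z ∧ aff x z ≤ M
  aff_osc : ∀ x, ∀ ε > 0, ∃ n, OscOn T S n ε (aff x)

namespace Gasket

variable {X : Type*} (K : Gasket X)

/-- Oscillation at most `ε` on cells of level `n`. -/
def Osc (n : ℕ) (ε : ℝ) (f : X → ℝ) : Prop := OscOn K.T K.S n ε f

/-- Uniform continuity with respect to the cell structure. -/
def CC (f : X → ℝ) : Prop := ∀ ε > 0, ∃ n, K.Osc n ε f

variable {K}

theorem near_succ {T : Fin 3 → X → X} {S : X → X} {n : ℕ} {x y : X} (h : Near T S (n + 1) x y) :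
    Near T S n x y := by
  induction n generalizing x y with
  | zero => trivial
  | succ n ih =>
    rcases h with ⟨i, x', y', h, rfl, rfl⟩ | ⟨x', y', h, rfl, rfl⟩
    · exact Or.inl ⟨i, x', y', ih h, rfl, rfl⟩
    · exact Or.inr ⟨x', y', ih h, rfl, rfl⟩

theorem near_le {T : Fin 3 → X → X} {S : X → X} {n m : ℕ} {x y : X} (h : Near T S m x y)
    (hnm : n ≤ m) : Near T S n x y := by
  induction m, hnm using Nat.le_induction with
  | base => exact h
  | succ m _ ih => exact ih (near_succ h)

theorem near_rot {n : ℕ} {x y : X} (h : Near K.T K.S n x y) :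
    Near K.T K.S n (K.rot x) (K.rot y) := by
  induction n generalizing x y with
  | zero => trivial
  | succ n ih =>
    rcases h with ⟨i, x', y', h, rfl, rfl⟩ | ⟨x', y', h, rfl, rfl⟩
    · exact Or.inl ⟨i + 1, _, _, ih h, (K.rot_T _ _).symm, (K.rot_T _ _).symm⟩
    · exact Or.inr ⟨_, _, ih h, (K.rot_S _).symm, (K.rot_S _).symm⟩

theorem Osc.mono {n m : ℕ} {ε δ : ℝ} {f : X → ℝ} (h : K.Osc n ε f) (hn : n ≤ m) (hε : ε ≤ δ) :
    K.Osc m δ f := fun x y hxy => (h x y (near_le hxy hn)).trans hε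

theorem Osc.T {n : ℕ} {ε : ℝ} {f : X → ℝ} (h : K.Osc (n + 1) ε f) (i : Fin 3) :
    K.Osc n ε (f ∘ K.T i) := fun x y hxy => h _ _ (Or.inl ⟨i, x, y, hxy, rfl, rfl⟩)

theorem Osc.S {n : ℕ} {ε : ℝ} {f : X → ℝ} (h : K.Osc (n + 1) ε f) :
    K.Osc n ε (f ∘ K.S) := fun x y hxy => h _ _ (Or.inr ⟨x, y, hxy, rfl, rfl⟩)

theorem osc_succ {n : ℕ} {ε : ℝ} {f : X → ℝ} (h : ∀ i, K.Osc n ε (f ∘ K.T i))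
    (hS : K.Osc n ε (f ∘ K.S)) : K.Osc (n + 1) ε f := by
  rintro x y (⟨i, x', y', h', rfl, rfl⟩ | ⟨x', y', h', rfl, rfl⟩)
  · exact h i _ _ h'
  · exact hS _ _ h'

theorem Osc.add {n : ℕ} {ε δ : ℝ} {f g : X → ℝ} (hf : K.Osc n ε f) (hg : K.Osc n δ g) :
    K.Osc n (ε + δ) (f + g) := fun x y hxy => by
  have h1 := hf x y hxy
  have h2 := hg x y hxy
  simp only [Pi.add_apply]
  calc |f x + g x - (f y + g y)| = |(f x - f y) + (g x - g y)| := by ring_nf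
    _ ≤ _ := (abs_add_le _ _).trans (add_le_add h1 h2)

theorem Osc.smul {n : ℕ} {ε : ℝ} {f : X → ℝ} (hf : K.Osc n ε f) (c : ℝ) :
    K.Osc n (|c| * ε) (c • f) := fun x y hxy => by
  simp only [Pi.smul_apply, smul_eq_mul, ← mul_sub, abs_mul]
  exact mul_le_mul_of_nonneg_left (hf x y hxy) (abs_nonneg c)

theorem Osc.lip {n : ℕ} {ε : ℝ} {f : X → ℝ} (hf : K.Osc n ε f) {φ : ℝ → ℝ}
    (hφ : ∀ x y, |φ x - φ y| ≤ |x - y|) : K.Osc n ε (φ ∘ f) := fun x y hxy =>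
  (hφ _ _).trans (hf x y hxy)

theorem CC.T {f : X → ℝ} (h : K.CC f) (i : Fin 3) : K.CC (f ∘ K.T i) := fun ε hε => by
  obtain ⟨n, hn⟩ := h ε hε
  exact ⟨n, (hn.mono n.le_succ le_rfl).T i⟩

theorem CC.S {f : X → ℝ} (h : K.CC f) : K.CC (f ∘ K.S) := fun ε hε => by
  obtain ⟨n, hn⟩ := h ε hε
  exact ⟨n, (hn.mono n.le_succ le_rfl).S⟩

theorem CC.rot {f : X → ℝ} (h : K.CC f) : K.CC (f ∘ K.rot) := fun ε hε => by
  obtain ⟨n, hn⟩ := h ε hε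
  exact ⟨n, fun x y hxy => hn _ _ (near_rot hxy)⟩

theorem CC.of_comp {f : X → ℝ} (h : ∀ i, K.CC (f ∘ K.T i)) (hS : K.CC (f ∘ K.S)) : K.CC f :=
  fun ε hε => by
  choose n hn using fun i => h i ε hε
  obtain ⟨m, hm⟩ := hS ε hε
  refine ⟨_, osc_succ (n := max (max (n 0) (n 1)) (max (n 2) m)) (fun i => (hn i).mono ?_ le_rfl)
    (hm.mono ?_ le_rfl)⟩
  · fin_cases i <;> simp
  · simp

theorem CC.add {f g : X → ℝ} (hf : K.CC f) (hg : K.CC g) : K.CC (f + g) := fun ε hε => by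
  obtain ⟨n, hn⟩ := hf (ε / 2) (by positivity)
  obtain ⟨m, hm⟩ := hg (ε / 2) (by positivity)
  exact ⟨max n m, ((hn.mono (le_max_left _ _) le_rfl).add
    (hm.mono (le_max_right _ _) le_rfl)).mono le_rfl (by linarith)⟩

theorem CC.smul {f : X → ℝ} (hf : K.CC f) (c : ℝ) : K.CC (c • f) := fun ε hε => by
  obtain ⟨n, hn⟩ := hf (ε / (|c| + 1)) (by positivity)
  refine ⟨n, (hn.smul c).mono le_rfl ?_⟩
  rw [mul_div_assoc', div_le_iff₀ (by positivity)]
  nlinarith [abs_nonneg c]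

theorem CC.neg {f : X → ℝ} (hf : K.CC f) : K.CC (-f) := by
  simpa using hf.smul (-1)

theorem CC.sub {f g : X → ℝ} (hf : K.CC f) (hg : K.CC g) : K.CC (f - g) := by
  rw [sub_eq_add_neg]
  exact hf.add hg.neg

theorem CC.lip {f : X → ℝ} (hf : K.CC f) {φ : ℝ → ℝ} (hφ : ∀ x y, |φ x - φ y| ≤ |x - y|) :
    K.CC (φ ∘ f) := fun ε hε => (hf ε hε).imp fun _ h => h.lip hφ

theorem CC.const (c : ℝ) : K.CC (fun _ => c) := fun ε hε =>
  ⟨0, fun x y _ => by simpa using hε.le⟩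

theorem CC.aff (x : Fin 3 → ℝ) : K.CC (K.aff x) := K.aff_osc x

variable (K)

open Classical in
/-- The function with prescribed restrictions to the four cells. -/
noncomputable def glue (f : Fin 3 → X → ℝ) (g : X → ℝ) (x : X) : ℝ :=
  if h : ∃ i y, K.T i y = x then f h.choose h.choose_spec.choose
  else if h : ∃ y, K.S y = x then g h.choose else 0

/-- Compatibility of values at the contact points of the four cells. -/
structure Compat (f : Fin 3 → X → ℝ) (g : X → ℝ) : Prop where
  cross : ∀ i j, f i (K.p j) = f j (K.p i)
  inner : ∀ i, g (K.p i) = f i (K.q i)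

variable {K}

theorem glue_T_apply {f : Fin 3 → X → ℝ} {g : X → ℝ} (h : K.Compat f g) (i : Fin 3) (y : X) :
    K.glue f g (K.T i y) = f i y := by
  have hex : ∃ j z, K.T j z = K.T i y := ⟨i, y, rfl⟩
  rw [glue, dif_pos hex]
  have h2 := hex.choose_spec.choose_spec
  generalize hex.choose_spec.choose = z at h2 ⊢
  generalize hex.choose = j at h2 ⊢
  by_cases hij : j = i
  · subst hij; rw [K.T_inj _ h2]
  · obtain ⟨rfl, rfl⟩ := K.T_sep _ _ _ _ hij h2
    exact h.cross _ _

theorem glue_T {f : Fin 3 → X → ℝ} {g : X → ℝ} (h : K.Compat f g) (i : Fin 3) :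
    K.glue f g ∘ K.T i = f i := funext fun y => glue_T_apply h i y

theorem glue_S {f : Fin 3 → X → ℝ} {g : X → ℝ} (h : K.Compat f g) :
    K.glue f g ∘ K.S = g := by
  funext y
  simp only [Function.comp_apply]
  by_cases hex : ∃ j z, K.T j z = K.S y
  · obtain ⟨j, z, hz⟩ := hex
    obtain ⟨rfl, rfl⟩ := K.S_sep _ _ _ hz.symm
    rw [← hz, glue_T_apply h, h.inner]
  · have h2 : ∃ z, K.S z = K.S y := ⟨y, rfl⟩
    rw [glue, dif_neg hex, dif_pos h2, K.S_inj h2.choose_spec]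

theorem glue_CC {f : Fin 3 → X → ℝ} {g : X → ℝ} (h : K.Compat f g) (hf : ∀ i, K.CC (f i))
    (hg : K.CC g) : K.CC (K.glue f g) :=
  CC.of_comp (fun i => by rw [glue_T h]; exact hf i) (by rw [glue_S h]; exact hg)

theorem glue_p {f : Fin 3 → X → ℝ} {g : X → ℝ} (h : K.Compat f g) (i : Fin 3) :
    K.glue f g (K.p i) = f i (K.p i) := by
  rw [← glue_T_apply h, K.T_p]

theorem glue_mem {f : Fin 3 → X → ℝ} {g : X → ℝ} (h : K.Compat f g) {P : ℝ → Prop}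
    (hf : ∀ i x, P (f i x)) (hg : ∀ x, P (g x)) (x : X) : P (K.glue f g x) := by
  rcases K.cover x with ⟨i, y, rfl⟩ | ⟨y, rfl⟩
  · rw [glue_T_apply h]; exact hf i y
  · rw [← Function.comp_apply (f := K.glue f g), glue_S h]; exact hg y

end Gasket
end AG

namespace AG

open scoped ENNReal

/-- Extended-real-valued functionals on functions. -/
abbrev Fnl (X : Type*) := (X → ℝ) → ℝ≥0∞

namespace Gasket

/-- `F f` is bounded by the nonnegative real `a`. -/
def Bd {X : Type*} (F : Fnl X) (f : X → ℝ) (a : ℝ) : Prop := 0 ≤ a ∧ F f ≤ ENNReal.ofReal a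

variable {X : Type*} {K : Gasket X} {F H : Fnl X} {f g : X → ℝ} {a b : ℝ}

theorem Bd.mono (h : Bd F f a) (hab : a ≤ b) : Bd F f b :=
  ⟨h.1.trans hab, h.2.trans (ENNReal.ofReal_le_ofReal hab)⟩

theorem Bd.of_le (h : Bd F f a) (hle : H g ≤ F f) : Bd H g a := ⟨h.1, hle.trans h.2⟩

theorem Bd.ne_top (h : Bd F f a) : F f ≠ ∞ := (h.2.trans_lt ENNReal.ofReal_lt_top).ne

theorem bd_toReal (h : F f ≠ ∞) : Bd F f (F f).toReal :=
  ⟨ENNReal.toReal_nonneg, (ENNReal.ofReal_toReal h).ge⟩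

theorem Bd.toReal_le (h : Bd F f a) : (F f).toReal ≤ a := ENNReal.toReal_le_of_le_ofReal h.1 h.2

theorem Bd.add (h : Bd F f a) (h' : Bd H f b) : Bd (F + H) f (a + b) :=
  ⟨add_nonneg h.1 h'.1, by
    rw [ENNReal.ofReal_add h.1 h'.1]; exact add_le_add h.2 h'.2⟩

theorem Bd.left (h : Bd (F + H) f a) : Bd F f a := h.of_le le_self_add

theorem Bd.right (h : Bd (F + H) f a) : Bd H f a := h.of_le le_add_self

theorem Bd.add_inv (h : Bd (F + H) f a) : ∃ b c, Bd F f b ∧ Bd H f c ∧ b + c ≤ a := by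
  refine ⟨_, _, bd_toReal h.left.ne_top, bd_toReal h.right.ne_top, ?_⟩
  rw [← ENNReal.toReal_add h.left.ne_top h.right.ne_top]
  exact h.toReal_le

/-- A functional with the quantitative properties of a self-adjoint Markovian energy. -/
structure Fm (K : Gasket X) (F : Fnl X) : Prop where
  smul : ∀ (c : ℝ) (f : X → ℝ) (a : ℝ), Bd F f a → Bd F (c • f) (c ^ 2 * a)
  add : ∀ (f g : X → ℝ) (a b ε : ℝ), 0 < ε → Bd F f a → Bd F g b →
    Bd F (f + g) ((1 + ε) * a + (1 + 1 / ε) * b)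
  lip : ∀ (f : X → ℝ) (a : ℝ) (φ : ℝ → ℝ), (∀ x y, |φ x - φ y| ≤ |x - y|) → Bd F f a →
    Bd F (φ ∘ f) a
  rot : ∀ (f : X → ℝ) (a : ℝ), Bd F f a → Bd F (f ∘ K.rot) a

theorem Fm.add_two (hF : K.Fm F) (hf : Bd F f a) (hg : Bd F g b) :
    Bd F (f + g) (2 * a + 2 * b) := by
  have := hF.add f g a b 1 one_pos hf hg
  norm_num at this
  exact this

theorem Fm.neg (hF : K.Fm F) (hf : Bd F f a) : Bd F (-f) a := by
  simpa using hF.smul (-1) f a hf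

theorem Fm.sub_two (hF : K.Fm F) (hf : Bd F f a) (hg : Bd F g b) :
    Bd F (f - g) (2 * a + 2 * b) := by
  rw [sub_eq_add_neg]
  exact hF.add_two hf (hF.neg hg)

theorem Fm.const_add (hF : K.Fm F) (c : ℝ) (hf : Bd F f a) : Bd F (fun x => c + f x) a :=
  hF.lip f a (fun t => c + t) (fun x y => by simp) hf

variable (K)

/-- The renormalization of a functional with conductances `α` on the corner cells and `β` on the
inner cell. -/
noncomputable def Lam (α β : ℝ) (F : Fnl X) : Fnl X := fun f =>
  ENNReal.ofReal α * ∑ i, F (f ∘ K.T i) + ENNReal.ofReal β * F (f ∘ K.S)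

variable {K} {α β : ℝ}

theorem Lam_mono (h : ∀ f, F f ≤ H f) (f : X → ℝ) : K.Lam α β F f ≤ K.Lam α β H f := by
  unfold Lam
  gcongr
  · exact h _
  · exact h _

theorem Bd.lam (hα : 0 ≤ α) (hβ : 0 ≤ β) {A : Fin 3 → ℝ} {B : ℝ}
    (h : ∀ i, Bd F (f ∘ K.T i) (A i)) (hS : Bd F (f ∘ K.S) B) :
    Bd (K.Lam α β F) f (α * (A 0 + A 1 + A 2) + β * B) := by
  have h0 := h 0
  have h1 := h 1
  have h2 := h 2
  have := h0.1
  have := h1.1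
  have := h2.1
  refine ⟨by have := hS.1; positivity, ?_⟩
  rw [ENNReal.ofReal_add (by positivity) (mul_nonneg hβ hS.1), ENNReal.ofReal_mul hα,
    ENNReal.ofReal_mul hβ, ENNReal.ofReal_add (by positivity) (by positivity),
    ENNReal.ofReal_add (by positivity) (by positivity)]
  unfold Lam
  rw [Fin.sum_univ_three]
  gcongr
  exacts [h0.2, h1.2, h2.2, hS.2]

theorem Bd.lam_inv (hα : 0 < α) (hβ : 0 < β) (h : Bd (K.Lam α β F) f a) :
    ∃ A : Fin 3 → ℝ, ∃ B : ℝ, (∀ i, Bd F (f ∘ K.T i) (A i)) ∧ Bd F (f ∘ K.S) B ∧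
      α * (A 0 + A 1 + A 2) + β * B ≤ a := by
  have htop := h.ne_top
  have h1 : ENNReal.ofReal α * ∑ i, F (f ∘ K.T i) ≠ ∞ := fun h => htop (by simp [Lam, h])
  have h2 : ENNReal.ofReal β * F (f ∘ K.S) ≠ ∞ := fun h => htop (by simp [Lam, h])
  have h1' : ∑ i, F (f ∘ K.T i) ≠ ∞ := fun h => h1 (by
    rw [h, ENNReal.mul_top (by simpa using hα)])
  have h2' : F (f ∘ K.S) ≠ ∞ := fun h => h2 (by
    rw [h, ENNReal.mul_top (by simpa using hβ)])
  have h3 : ∀ i, F (f ∘ K.T i) ≠ ∞ := fun i => (ENNReal.sum_ne_top.1 h1') i (Finset.mem_univ i)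
  refine ⟨fun i => (F (f ∘ K.T i)).toReal, (F (f ∘ K.S)).toReal, fun i => bd_toReal (h3 i),
    bd_toReal h2', ?_⟩
  have := h.toReal_le
  rw [Lam, ENNReal.toReal_add h1 h2, ENNReal.toReal_mul, ENNReal.toReal_mul,
    ENNReal.toReal_sum (fun i _ => h3 i), Fin.sum_univ_three, ENNReal.toReal_ofReal hα.le,
    ENNReal.toReal_ofReal hβ.le] at this
  exact this

theorem Bd.lam_T (hα : 0 < α) (hβ : 0 < β) (h : Bd (K.Lam α β F) f a) (i : Fin 3) :
    Bd F (f ∘ K.T i) (a / α) := by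
  obtain ⟨A, B, hA, hB, hle⟩ := h.lam_inv hα hβ
  refine (hA i).mono ?_
  rw [le_div_iff₀ hα]
  have h0 := mul_nonneg hα.le (hA 0).1
  have h1 := mul_nonneg hα.le (hA 1).1
  have h2 := mul_nonneg hα.le (hA 2).1
  have h3 := mul_nonneg hβ.le hB.1
  fin_cases i <;> simp <;> linarith

theorem Bd.lam_S (hα : 0 < α) (hβ : 0 < β) (h : Bd (K.Lam α β F) f a) :
    Bd F (f ∘ K.S) (a / β) := by
  obtain ⟨A, B, hA, hB, hle⟩ := h.lam_inv hα hβ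
  refine hB.mono ?_
  rw [le_div_iff₀ hβ]
  have h0 := mul_nonneg hα.le (hA 0).1
  have h1 := mul_nonneg hα.le (hA 1).1
  have h2 := mul_nonneg hα.le (hA 2).1
  linarith

theorem Fm.lam (hα : 0 < α) (hβ : 0 < β) (hF : K.Fm F) : K.Fm (K.Lam α β F) where
  smul c f a h := by
    obtain ⟨A, B, hA, hB, hle⟩ := h.lam_inv hα hβ
    refine (Bd.lam hα.le hβ.le (f := c • f) (fun i => hF.smul c _ _ (hA i))
      (hF.smul c _ _ hB)).mono ?_
    nlinarith [sq_nonneg c]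
  add f g a b ε hε h h' := by
    obtain ⟨A, B, hA, hB, hle⟩ := h.lam_inv hα hβ
    obtain ⟨A', B', hA', hB', hle'⟩ := h'.lam_inv hα hβ
    refine (Bd.lam hα.le hβ.le (f := f + g) (fun i => hF.add _ _ _ _ ε hε (hA i) (hA' i))
      (hF.add _ _ _ _ ε hε hB hB')).mono ?_
    have : 0 < 1 + 1 / ε := by positivity
    nlinarith
  lip f a φ hφ h := by
    obtain ⟨A, B, hA, hB, hle⟩ := h.lam_inv hα hβ
    exact (Bd.lam hα.le hβ.le (f := φ ∘ f) (fun i => hF.lip _ _ φ hφ (hA i))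
      (hF.lip _ _ φ hφ hB)).mono hle
  rot f a h := by
    obtain ⟨A, B, hA, hB, hle⟩ := h.lam_inv hα hβ
    refine (Bd.lam hα.le hβ.le (f := f ∘ K.rot) (A := fun i => A (i + 1)) (fun i => ?_)
      (B := B) ?_).mono ?_
    · have := hF.rot _ _ (hA (i + 1))
      convert this using 1
      funext x
      simp [K.rot_T]
    · have := hF.rot _ _ hB
      convert this using 1
      funext x
      simp [K.rot_S]
    · refine le_trans (le_of_eq ?_) hle
      simp
      ring_nf
      exact Or.inl trivial

theorem Fm.addF (hF : K.Fm F) (hH : K.Fm H) : K.Fm (F + H) where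
  smul c f a h := by
    obtain ⟨b, d, hb, hd, hle⟩ := h.add_inv
    refine ((hF.smul c f _ hb).add (hH.smul c f _ hd)).mono ?_
    nlinarith [sq_nonneg c]
  add f g a a' ε hε h h' := by
    obtain ⟨b, d, hb, hd, hle⟩ := h.add_inv
    obtain ⟨b', d', hb', hd', hle'⟩ := h'.add_inv
    refine ((hF.add _ _ _ _ ε hε hb hb').add (hH.add _ _ _ _ ε hε hd hd')).mono ?_
    have : 0 < 1 + 1 / ε := by positivity
    nlinarith
  lip f a φ hφ h := by
    obtain ⟨b, d, hb, hd, hle⟩ := h.add_inv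
    exact ((hF.lip _ _ φ hφ hb).add (hH.lip _ _ φ hφ hd)).mono hle
  rot f a h := by
    obtain ⟨b, d, hb, hd, hle⟩ := h.add_inv
    exact ((hF.rot _ _ hb).add (hH.rot _ _ hd)).mono hle

theorem Fm.lam_iterate (hα : 0 < α) (hβ : 0 < β) (hF : K.Fm F) (n : ℕ) :
    K.Fm ((K.Lam α β)^[n] F) := by
  induction n with
  | zero => exact hF
  | succ n ih =>
    rw [Function.iterate_succ_apply']
    exact ih.lam hα hβ

theorem bd_iSup {ι : Sort*} {F : ι → Fnl X} (ha : 0 ≤ a) :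
    Bd (⨆ i, F i) f a ↔ ∀ i, Bd (F i) f a := by
  simp [Bd, ha, iSup_apply]

theorem Bd.of_iSup {ι : Sort*} {F : ι → Fnl X} (h : Bd (⨆ i, F i) f a) (i : ι) :
    Bd (F i) f a := (bd_iSup h.1).1 h i

theorem Fm.iSup {ι : Sort*} {F : ι → Fnl X} (h : ∀ i, K.Fm (F i)) : K.Fm (⨆ i, F i) where
  smul c f a hf := (bd_iSup (mul_nonneg (sq_nonneg c) hf.1)).2 fun i =>
    (h i).smul c f a (hf.of_iSup i)
  add f g a b ε hε hf hg := by
    have h1 := hf.1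
    have h2 := hg.1
    exact (bd_iSup (by positivity)).2 fun i => (h i).add f g a b ε hε (hf.of_iSup i) (hg.of_iSup i)
  lip f a φ hφ hf := (bd_iSup hf.1).2 fun i => (h i).lip f a φ hφ (hf.of_iSup i)
  rot f a hf := (bd_iSup hf.1).2 fun i => (h i).rot f a (hf.of_iSup i)

theorem Lam_add (F H : Fnl X) : K.Lam α β (F + H) = K.Lam α β F + K.Lam α β H := by
  funext f
  simp only [Lam, Pi.add_apply, Finset.sum_add_distrib]
  ring

theorem Lam_iSup {F : ℕ → Fnl X} (hF : Monotone F) :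
    K.Lam α β (⨆ n, F n) = ⨆ n, K.Lam α β (F n) := by
  funext f
  simp only [Lam, iSup_apply, Fin.sum_univ_three]
  have hm : ∀ g, Monotone fun n => F n g := fun g n m h => hF h g
  rw [ENNReal.iSup_add_iSup_of_monotone (hm _) (hm _), ENNReal.iSup_add_iSup_of_monotone
    ((hm _).add (hm _)) (hm _), ENNReal.mul_iSup, ENNReal.mul_iSup,
    ENNReal.iSup_add_iSup_of_monotone]
  · exact fun n m h => by gcongr <;> exact hm _ h
  · exact fun n m h => by gcongr; exact hm _ h

end Gasket
end AG

namespace AG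

open scoped ENNReal

namespace Gasket

variable {X : Type*} (K : Gasket X)

/-- The energy of level `n` along the edge opposite to the corner `i`. -/
def ea (i : Fin 3) : ℕ → (X → ℝ) → ℝ
  | 0, f => (f (K.p (i + 1)) - f (K.p (i + 2))) ^ 2
  | n + 1, f => 2 * (ea i n (f ∘ K.T (i + 1)) + ea i n (f ∘ K.T (i + 2)))

/-- The energy along the edge opposite to the corner `i`. -/
noncomputable def e (i : Fin 3) : Fnl X := ⨆ n, fun f => ENNReal.ofReal (K.ea i n f)

/-- The total energy along the three edges. -/
noncomputable def E0 : Fnl X := fun f => ∑ i, K.e i f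

/-- The squared oscillation. -/
noncomputable def osc2 : Fnl X := ⨆ z : X × X, fun f => ENNReal.ofReal ((f z.1 - f z.2) ^ 2)

/-- One step of the construction of the energies. -/
noncomputable def Bop (α β : ℝ) (F : Fnl X) : Fnl X := K.E0 + K.Lam α β F

/-- The approximating energies with the oscillation at the bottom level. -/
noncomputable def G (α β : ℝ) (n : ℕ) : Fnl X := (K.Bop α β)^[n] (K.E0 + osc2)

/-- The approximating energies. -/
noncomputable def EN (α β : ℝ) (n : ℕ) : Fnl X := (K.Bop α β)^[n] K.E0

/-- The total energy on all edges of all cells. -/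
noncomputable def En (α β : ℝ) : Fnl X := ⨆ n, K.EN α β n

variable {K} {F H : Fnl X} {f g : X → ℝ} {a b : ℝ} {i : Fin 3} {n : ℕ}

theorem T_mid (i : Fin 3) : K.T (i + 2) (K.p (i + 1)) = K.T (i + 1) (K.p (i + 2)) :=
  K.T_cross _ _

theorem ea_nonneg : 0 ≤ K.ea i n f := by
  induction n generalizing f with
  | zero => exact sq_nonneg _
  | succ n ih => have := ih (f := f ∘ K.T (i + 1)); have := ih (f := f ∘ K.T (i + 2)); simp only [ea]; linarith

theorem ea_le_succ : K.ea i n f ≤ K.ea i (n + 1) f := by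
  induction n generalizing f with
  | zero =>
    simp only [ea, Function.comp_apply, K.T_p, T_mid]
    nlinarith [sq_nonneg (f (K.p (i + 1)) + f (K.p (i + 2)) - 2 * f (K.T (i + 1) (K.p (i + 2))))]
  | succ n ih =>
    have h1 := ih (f := f ∘ K.T (i + 1))
    have h2 := ih (f := f ∘ K.T (i + 2))
    rw [ea, ea]
    linarith

theorem ea_mono (f : X → ℝ) : Monotone fun n => K.ea i n f := monotone_nat_of_le_succ fun _ => ea_le_succ

theorem ea_smul (c : ℝ) : K.ea i n (c • f) = c ^ 2 * K.ea i n f := by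
  induction n generalizing f with
  | zero => simp only [ea, Pi.smul_apply, smul_eq_mul]; ring
  | succ n ih =>
    have h1 := ih (f := f ∘ K.T (i + 1))
    have h2 := ih (f := f ∘ K.T (i + 2))
    simp only [ea]
    change 2 * (K.ea i n (c • (f ∘ _)) + K.ea i n (c • (f ∘ _))) = _
    rw [h1, h2]; ring

theorem ea_par : K.ea i n (f + g) + K.ea i n (f - g) = 2 * K.ea i n f + 2 * K.ea i n g := by
  induction n generalizing f g with
  | zero => simp only [ea, Pi.add_apply, Pi.sub_apply]; ring
  | succ n ih =>
    have h1 := ih (f := f ∘ K.T (i + 1)) (g := g ∘ K.T (i + 1))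
    have h2 := ih (f := f ∘ K.T (i + 2)) (g := g ∘ K.T (i + 2))
    simp only [ea]
    change 2 * (K.ea i n (f ∘ _ + g ∘ _) + K.ea i n (f ∘ _ + g ∘ _)) +
      2 * (K.ea i n (f ∘ _ - g ∘ _) + K.ea i n (f ∘ _ - g ∘ _)) = _
    linarith

theorem add_sq_le (u v : ℝ) {ε : ℝ} (hε : 0 < ε) :
    (u + v) ^ 2 ≤ (1 + ε) * u ^ 2 + (1 + 1 / ε) * v ^ 2 := by
  have : (1 + ε) * u ^ 2 + (1 + 1 / ε) * v ^ 2 - (u + v) ^ 2 = (ε * u - v) ^ 2 / ε := by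
    field_simp
    ring
  have : 0 ≤ (ε * u - v) ^ 2 / ε := by positivity
  linarith

theorem ea_add {ε : ℝ} (hε : 0 < ε) :
    K.ea i n (f + g) ≤ (1 + ε) * K.ea i n f + (1 + 1 / ε) * K.ea i n g := by
  induction n generalizing f g with
  | zero =>
    simp only [ea, Pi.add_apply]
    refine le_trans (le_of_eq ?_) (add_sq_le _ _ hε)
    ring
  | succ n ih =>
    have h1 := ih (f := f ∘ K.T (i + 1)) (g := g ∘ K.T (i + 1))
    have h2 := ih (f := f ∘ K.T (i + 2)) (g := g ∘ K.T (i + 2))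
    simp only [ea]
    change 2 * (K.ea i n (f ∘ _ + g ∘ _) + K.ea i n (f ∘ _ + g ∘ _)) ≤ _
    linarith

theorem ea_lip {φ : ℝ → ℝ} (hφ : ∀ x y, |φ x - φ y| ≤ |x - y|) :
    K.ea i n (φ ∘ f) ≤ K.ea i n f := by
  induction n generalizing f with
  | zero => exact sq_le_sq.2 (hφ _ _)
  | succ n ih =>
    have h1 := ih (f := f ∘ K.T (i + 1))
    have h2 := ih (f := f ∘ K.T (i + 2))
    simp only [ea]
    change 2 * (K.ea i n (φ ∘ (f ∘ _)) + K.ea i n (φ ∘ (f ∘ _))) ≤ _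
    linarith

theorem comp_rot_T (f : X → ℝ) (i : Fin 3) : (f ∘ K.rot) ∘ K.T i = (f ∘ K.T (i + 1)) ∘ K.rot := by
  funext x
  simp [K.rot_T]

theorem comp_rot_S (f : X → ℝ) : (f ∘ K.rot) ∘ K.S = (f ∘ K.S) ∘ K.rot := by
  funext x
  simp [K.rot_S]

theorem ea_rot : K.ea i n (f ∘ K.rot) = K.ea (i + 1) n f := by
  induction n generalizing f with
  | zero =>
    simp only [ea, Function.comp_apply, K.rot_p, add_right_comm i 1]
  | succ n ih =>
    simp only [ea, comp_rot_T, ih, add_right_comm i 1]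

theorem bd_e : Bd (K.e i) f a ↔ 0 ≤ a ∧ ∀ n, K.ea i n f ≤ a := by
  constructor
  · intro h
    refine ⟨h.1, fun n => ?_⟩
    have := (h.of_iSup n).2
    rwa [ENNReal.ofReal_le_ofReal_iff h.1] at this
  · rintro ⟨h, h'⟩
    exact (bd_iSup h).2 fun n => ⟨h, ENNReal.ofReal_le_ofReal (h' n)⟩

theorem bd_osc2 : Bd (osc2 : Fnl X) f a ↔ 0 ≤ a ∧ ∀ x y, (f x - f y) ^ 2 ≤ a := by
  constructor
  · intro h
    refine ⟨h.1, fun x y => ?_⟩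
    have := (h.of_iSup (x, y)).2
    rwa [ENNReal.ofReal_le_ofReal_iff h.1] at this
  · rintro ⟨h, h'⟩
    exact (bd_iSup h).2 fun z => ⟨h, ENNReal.ofReal_le_ofReal (h' z.1 z.2)⟩

theorem bd_E0 {A : Fin 3 → ℝ} (h : ∀ i, Bd (K.e i) f (A i)) : Bd K.E0 f (A 0 + A 1 + A 2) := by
  have := ((h 0).add (h 1)).add (h 2)
  exact this.of_le (by simp [E0, Fin.sum_univ_three])

theorem Bd.E0_inv (h : Bd K.E0 f a) :
    ∃ A : Fin 3 → ℝ, (∀ i, Bd (K.e i) f (A i)) ∧ A 0 + A 1 + A 2 ≤ a := by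
  have h' : Bd (K.e 0 + K.e 1 + K.e 2) f a := h.of_le (by simp [E0, Fin.sum_univ_three])
  obtain ⟨b, c, hb, hc, hbc⟩ := h'.add_inv
  obtain ⟨b', c', hb', hc', hbc'⟩ := hb.add_inv
  refine ⟨![b', c', c], fun i => ?_, ?_⟩
  · fin_cases i <;> assumption
  · simp; linarith

theorem Bd.E0_e (h : Bd K.E0 f a) (i : Fin 3) : Bd (K.e i) f a :=
  h.of_le (Finset.single_le_sum (f := fun i => K.e i f) (fun _ _ => zero_le) (Finset.mem_univ i))

theorem Bd.e_smul (h : Bd (K.e i) f a) (c : ℝ) : Bd (K.e i) (c • f) (c ^ 2 * a) := by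
  rw [bd_e] at *
  refine ⟨mul_nonneg (sq_nonneg _) h.1, fun n => ?_⟩
  rw [ea_smul]
  exact mul_le_mul_of_nonneg_left (h.2 n) (sq_nonneg _)

theorem Bd.e_add (h : Bd (K.e i) f a) (h' : Bd (K.e i) g b) {ε : ℝ} (hε : 0 < ε) :
    Bd (K.e i) (f + g) ((1 + ε) * a + (1 + 1 / ε) * b) := by
  rw [bd_e] at *
  have := h.1
  have := h'.1
  refine ⟨by positivity, fun n => (ea_add hε).trans ?_⟩
  have := h.2 n
  have := h'.2 n
  gcongr

theorem Bd.e_lip (h : Bd (K.e i) f a) {φ : ℝ → ℝ} (hφ : ∀ x y, |φ x - φ y| ≤ |x - y|) :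
    Bd (K.e i) (φ ∘ f) a := by
  rw [bd_e] at *
  exact ⟨h.1, fun n => (ea_lip hφ).trans (h.2 n)⟩

theorem Bd.e_rot (h : Bd (K.e (i + 1)) f a) : Bd (K.e i) (f ∘ K.rot) a := by
  rw [bd_e] at *
  exact ⟨h.1, fun n => ea_rot.trans_le (h.2 n)⟩

theorem fm_E0 : K.Fm K.E0 where
  smul c f a h := by
    obtain ⟨A, hA, hle⟩ := h.E0_inv
    refine (bd_E0 fun i => (hA i).e_smul c).mono ?_
    nlinarith [sq_nonneg c]
  add f g a b ε hε h h' := by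
    obtain ⟨A, hA, hle⟩ := h.E0_inv
    obtain ⟨B, hB, hle'⟩ := h'.E0_inv
    refine (bd_E0 fun i => (hA i).e_add (hB i) hε).mono ?_
    have : 0 < 1 + 1 / ε := by positivity
    nlinarith
  lip f a φ hφ h := by
    obtain ⟨A, hA, hle⟩ := h.E0_inv
    exact (bd_E0 fun i => (hA i).e_lip hφ).mono hle
  rot f a h := by
    obtain ⟨A, hA, hle⟩ := h.E0_inv
    refine (bd_E0 (A := fun i => A (i + 1)) fun i => (hA (i + 1)).e_rot).mono ?_
    refine le_trans (le_of_eq ?_) hle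
    simp
    ring_nf

theorem fm_osc2 : K.Fm osc2 where
  smul c f a h := by
    rw [bd_osc2] at *
    refine ⟨mul_nonneg (sq_nonneg _) h.1, fun x y => ?_⟩
    simp only [Pi.smul_apply, smul_eq_mul, ← mul_sub, mul_pow]
    exact mul_le_mul_of_nonneg_left (h.2 x y) (sq_nonneg _)
  add f g a b ε hε h h' := by
    rw [bd_osc2] at *
    have := h.1
    have := h'.1
    refine ⟨by positivity, fun x y => ?_⟩
    have := h.2 x y
    have := h'.2 x y
    calc ((f + g) x - (f + g) y) ^ 2 = ((f x - f y) + (g x - g y)) ^ 2 := by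
          simp only [Pi.add_apply]; ring
      _ ≤ _ := add_sq_le _ _ hε
      _ ≤ _ := by gcongr
  lip f a φ hφ h := by
    rw [bd_osc2] at *
    exact ⟨h.1, fun x y => (sq_le_sq.2 (hφ _ _)).trans (h.2 x y)⟩
  rot f a h := by
    rw [bd_osc2] at *
    exact ⟨h.1, fun x y => h.2 _ _⟩

theorem Fm.bop_iterate {α β : ℝ} (hα : 0 < α) (hβ : 0 < β) (hF : K.Fm F) (n : ℕ) :
    K.Fm ((K.Bop α β)^[n] F) := by
  induction n with
  | zero => exact hF
  | succ n ih =>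
    rw [Function.iterate_succ_apply']
    exact fm_E0.addF (ih.lam hα hβ)

variable {α β : ℝ}

theorem fm_G (hα : 0 < α) (hβ : 0 < β) (n : ℕ) : K.Fm (K.G α β n) :=
  (fm_E0.addF fm_osc2).bop_iterate hα hβ n

theorem fm_EN (hα : 0 < α) (hβ : 0 < β) (n : ℕ) : K.Fm (K.EN α β n) :=
  fm_E0.bop_iterate hα hβ n

theorem fm_En (hα : 0 < α) (hβ : 0 < β) : K.Fm (K.En α β) := Fm.iSup (fm_EN hα hβ)

theorem Bop_mono (h : F ≤ H) : K.Bop α β F ≤ K.Bop α β H :=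
  add_le_add le_rfl (fun f => Lam_mono h f)

theorem Bop_monotone : Monotone (K.Bop α β) := fun _ _ h => Bop_mono h

theorem Lam_monotone : Monotone (K.Lam α β) := fun _ _ h f => Lam_mono h f

theorem G_succ : K.G α β (n + 1) = K.E0 + K.Lam α β (K.G α β n) := by
  rw [G, Function.iterate_succ_apply']; rfl

theorem EN_succ : K.EN α β (n + 1) = K.E0 + K.Lam α β (K.EN α β n) := by
  rw [EN, Function.iterate_succ_apply']; rfl

theorem EN_mono : Monotone (K.EN α β) := by
  refine monotone_nat_of_le_succ fun n => ?_
  induction n with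
  | zero => rw [EN_succ]; exact le_self_add
  | succ n ih =>
    rw [EN_succ, EN_succ]
    exact Bop_mono ih

theorem EN_le_G : K.EN α β n ≤ K.G α β n :=
  Bop_monotone.iterate n le_self_add

theorem En_eq : K.En α β = K.E0 + K.Lam α β (K.En α β) := by
  rw [En, Lam_iSup EN_mono]
  funext f
  simp only [iSup_apply, Pi.add_apply]
  rw [ENNReal.add_iSup, ← Monotone.iSup_nat_add (f := fun n => K.EN α β n f)
    (fun n m h => EN_mono h f) 1]
  simp [EN_succ]

theorem E0_le_En : K.E0 ≤ K.En α β := by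
  rw [En_eq]; exact le_self_add

theorem Lam_le_En : K.Lam α β (K.En α β) ≤ K.En α β := by
  conv_rhs => rw [En_eq]
  exact le_add_self

theorem e_eq (i : Fin 3) (f : X → ℝ) :
    K.e i f = 2 * (K.e i (f ∘ K.T (i + 1)) + K.e i (f ∘ K.T (i + 2))) := by
  simp only [e, iSup_apply]
  have hm : ∀ g, Monotone fun n => ENNReal.ofReal (K.ea i n g) := fun g n m h =>
    ENNReal.ofReal_le_ofReal (ea_mono g h)
  rw [← (hm f).iSup_nat_add 1, ENNReal.iSup_add_iSup_of_monotone (hm _) (hm _), ENNReal.mul_iSup]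
  congr 1
  funext n
  rw [← ENNReal.ofReal_add ea_nonneg ea_nonneg, ea, ENNReal.ofReal_mul zero_le_two]
  simp

theorem E0_le_Lam (hα : 1 ≤ α) : K.E0 ≤ 2 * K.Lam α β K.E0 := by
  intro f
  have h1 : K.E0 f ≤ 2 * ∑ i, K.E0 (f ∘ K.T i) := by
    simp only [E0]
    simp only [Fin.sum_univ_three]
    rw [e_eq 0, e_eq 1, e_eq 2]
    rw [← mul_add, ← mul_add]
    refine mul_le_mul_right ?_ _
    have h : (2 : Fin 3) + 1 = 0 := rfl
    have h' : (2 : Fin 3) + 2 = 1 := rfl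
    have h'' : (1 : Fin 3) + 2 = 0 := rfl
    have h₃ : (1 : Fin 3) + 1 = 2 := rfl
    simp only [zero_add, h, h', h'', h₃]
    calc _ ≤ _ := le_add_right (c := K.e 0 (f ∘ K.T 0) + K.e 1 (f ∘ K.T 1) + K.e 2 (f ∘ K.T 2)) le_rfl
      _ = _ := by ring
  refine h1.trans ?_
  simp only [Pi.mul_apply, Pi.ofNat_apply, Lam]
  gcongr
  refine le_trans ?_ le_self_add
  exact le_mul_of_one_le_left' (by simpa using hα)

theorem Lam_const_mul (c : ℝ≥0∞) : K.Lam α β (fun f => c * F f) = fun f => c * K.Lam α β F f := by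
  funext f
  simp only [Lam, ← Finset.mul_sum]
  ring

theorem Lam_iterate_const_mul (c : ℝ≥0∞) (n : ℕ) :
    (K.Lam α β)^[n] (fun f => c * F f) = fun f => c * (K.Lam α β)^[n] F f := by
  induction n with
  | zero => rfl
  | succ n ih => rw [Function.iterate_succ_apply', ih, Lam_const_mul, Function.iterate_succ_apply']

theorem E0_le_Lam_iterate (hα : 1 ≤ α) (n : ℕ) :
    K.E0 ≤ fun f => 2 ^ n * (K.Lam α β)^[n] K.E0 f := by
  induction n with
  | zero => simp
  | succ n ih =>
    refine (E0_le_Lam (β := β) hα).trans fun f => ?_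
    have := Lam_monotone (K := K) (α := α) (β := β) ih f
    rw [Lam_const_mul] at this
    rw [Function.iterate_succ_apply', pow_succ', mul_assoc]
    exact mul_le_mul_right this _

theorem Bop_iterate_le (hα : 1 ≤ α) (n : ℕ) (F : Fnl X) (f : X → ℝ) :
    (K.Bop α β)^[n] F f ≤ 2 ^ (n + 1) * (K.Lam α β)^[n] K.E0 f + (K.Lam α β)^[n] F f := by
  induction n generalizing f with
  | zero => simp
  | succ n ih =>
    rw [Function.iterate_succ_apply']
    simp only [Bop, Pi.add_apply]
    have h1 := E0_le_Lam_iterate (K := K) (β := β) hα (n + 1) f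
    have h2 : K.Lam α β ((K.Bop α β)^[n] F) f ≤ K.Lam α β _ f := Lam_mono ih f
    have h3 := congrFun (Lam_add (K := K) (α := α) (β := β)
      (fun f => 2 ^ (n + 1) * (K.Lam α β)^[n] K.E0 f) ((K.Lam α β)^[n] F)) f
    rw [Pi.add_def] at h3
    rw [h3] at h2
    dsimp only at h1 h2
    rw [Lam_const_mul] at h2
    simp only [Function.iterate_succ_apply'] at h1 ⊢
    rw [Pi.add_apply] at h2
    calc _ ≤ _ := add_le_add h1 h2
      _ = _ := by ring

/-- The parallelogram inequality. -/
def Pg (F : Fnl X) : Prop := ∀ f g, F (f + g) + F (f - g) ≤ 2 * F f + 2 * F g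

theorem Pg.add (hF : Pg F) (hH : Pg H) : Pg (F + H) := fun f g => by
  calc _ = (F (f + g) + F (f - g)) + (H (f + g) + H (f - g)) := by simp only [Pi.add_apply]; ring
    _ ≤ _ := add_le_add (hF f g) (hH f g)
    _ = _ := by simp only [Pi.add_apply]; ring

theorem Pg.iSup {F : ℕ → Fnl X} (hm : Monotone F) (h : ∀ n, Pg (F n)) : Pg (⨆ n, F n) := by
  intro f g
  have hm' : ∀ g, Monotone fun n => F n g := fun g n m h => hm h g
  simp only [iSup_apply]
  rw [ENNReal.iSup_add_iSup_of_monotone (hm' _) (hm' _)]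
  refine iSup_le fun n => (h n f g).trans ?_
  gcongr
  · exact le_iSup (fun n => F n f) n
  · exact le_iSup (fun n => F n g) n

theorem Pg.comp (hF : Pg F) (c : ℝ≥0∞) (τ : X → X) : Pg (fun f => c * F (f ∘ τ)) := fun f g => by
  calc _ = c * (F (f ∘ τ + g ∘ τ) + F (f ∘ τ - g ∘ τ)) := by rw [mul_add]; rfl
    _ ≤ _ := mul_le_mul_right (hF (f ∘ τ) (g ∘ τ)) c
    _ = _ := by ring

theorem Pg.lam (hF : Pg F) : Pg (K.Lam α β F) := by
  have : K.Lam α β F = (fun f => ENNReal.ofReal α * F (f ∘ K.T 0)) +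
      (fun f => ENNReal.ofReal α * F (f ∘ K.T 1)) + (fun f => ENNReal.ofReal α * F (f ∘ K.T 2)) +
      (fun f => ENNReal.ofReal β * F (f ∘ K.S)) := by
    funext f
    simp only [Lam, Fin.sum_univ_three, mul_add, Pi.add_apply]
  rw [this]
  exact (((hF.comp _ _).add (hF.comp _ _)).add (hF.comp _ _)).add (hF.comp _ _)

theorem pg_e (i : Fin 3) : Pg (K.e i) := by
  refine Pg.iSup (fun n m h f => ENNReal.ofReal_le_ofReal (ea_mono f h)) fun n f g => ?_
  rw [← ENNReal.ofReal_add ea_nonneg ea_nonneg, ea_par,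
    ENNReal.ofReal_add (mul_nonneg zero_le_two ea_nonneg) (mul_nonneg zero_le_two ea_nonneg),
    ENNReal.ofReal_mul zero_le_two, ENNReal.ofReal_mul zero_le_two]
  simp

theorem pg_E0 : Pg K.E0 := by
  have : K.E0 = K.e 0 + K.e 1 + K.e 2 := by
    funext f
    simp [E0, Fin.sum_univ_three]
  rw [this]
  exact ((pg_e 0).add (pg_e 1)).add (pg_e 2)

theorem pg_En : Pg (K.En α β) := by
  refine Pg.iSup EN_mono fun n => ?_
  induction n with
  | zero => exact pg_E0
  | succ n ih => rw [EN_succ]; exact pg_E0.add ih.lam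

end Gasket
end AG

namespace AG

open scoped ENNReal

namespace Gasket

variable {X : Type*} {K : Gasket X} {F H : Fnl X} {f g : X → ℝ} {a b : ℝ} {i : Fin 3} {n : ℕ}
  {α β : ℝ}

theorem eq_or_of_ne {l i : Fin 3} (h : l ≠ i) : l = i + 1 ∨ l = i + 2 := by
  revert h; revert l i; decide

theorem add_one_ne (i : Fin 3) : i + 1 ≠ i := by
  revert i; decide

theorem add_two_ne (i : Fin 3) : i + 2 ≠ i := by
  revert i; decide

theorem eq_cases (l i : Fin 3) : l = i ∨ l = i + 1 ∨ l = i + 2 := by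
  revert l i; decide

/-- The geometric control of a function along an edge. -/
theorem edge_chain (P : ℝ → (X → ℝ) → Prop) {ρ : ℝ} (h0 : 0 ≤ ρ) (h1 : ρ < 1) (i : Fin 3)
    (hc : ∀ A f, P A f → |f (K.p (i + 1)) - f (K.p (i + 2))| ≤ A)
    (hs : ∀ A f, P A f → (∀ x y, |f x - f y| ≤ A) ∨ ∀ l, l ≠ i → P (ρ * A) (f ∘ K.T l))
    {A : ℝ} (hf : K.CC f) (h : P A f) {x : X} (hx : x ∈ K.Edge i) :
    |f x - f (K.p (i + 1))| ≤ A / (1 - ρ) := by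
  have h1' : 0 < 1 - ρ := by linarith
  refine le_of_forall_pos_le_add fun ε hε => ?_
  obtain ⟨n, hn⟩ := hf ε hε
  clear hf
  induction n generalizing f A x with
  | zero =>
    have h2 := hn x (K.p (i + 1)) trivial
    have h3 : 0 ≤ A := (abs_nonneg _).trans (hc A f h)
    have : 0 ≤ A / (1 - ρ) := by positivity
    linarith
  | succ n ih =>
    have hA : 0 ≤ A := (abs_nonneg _).trans (hc A f h)
    rcases hs A f h with h' | h'
    · have h2 := h' x (K.p (i + 1))
      have h3 : A ≤ A / (1 - ρ) := le_div_self hA h1' (by linarith)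
      linarith
    obtain ⟨l, hl, y, hy, rfl⟩ := K.edge_step i x hx
    have h2 := ih (h' l hl) hy (hn.T l)
    have h3 : |f (K.T l (K.p (i + 1))) - f (K.p (i + 1))| ≤ ρ * A := by
      rcases eq_or_of_ne hl with rfl | rfl
      · simpa [K.T_p] using mul_nonneg h0 hA
      · have := hc _ _ (h' (i + 1) (add_one_ne i))
        rw [abs_sub_comm] at this
        simpa only [Function.comp_apply, K.T_p, T_mid] using this
    simp only [Function.comp_apply] at h2
    have h4 : |f (K.T l y) - f (K.p (i + 1))| ≤ _ := abs_sub_le _ (f (K.T l (K.p (i + 1)))) _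
    have h5 : ρ * A / (1 - ρ) + ρ * A ≤ A / (1 - ρ) := by
      rw [div_add' _ _ _ h1'.ne', div_le_div_iff_of_pos_right h1']
      nlinarith [mul_nonneg hA (sq_nonneg (1 - ρ))]
    linarith

/-- The geometric control of the oscillation of a function. -/
theorem chain (P : ℝ → (X → ℝ) → Prop) {ρ : ℝ} (h0 : 0 ≤ ρ) (h1 : ρ < 1)
    (hc : ∀ A f, P A f → ∀ i j, |f (K.p i) - f (K.p j)| ≤ A)
    (hs : ∀ A f, P A f → (∀ x y, |f x - f y| ≤ A) ∨
      ((∀ l, P (ρ * A) (f ∘ K.T l)) ∧ P (ρ * A) (f ∘ K.S)))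
    {A : ℝ} (hf : K.CC f) (h : P A f) (x y : X) : |f x - f y| ≤ 4 / (1 - ρ) ^ 2 * A := by
  have h1' : 0 < 1 - ρ := by linarith
  have key : ∀ x, |f x - f (K.p 0)| ≤ 2 / (1 - ρ) ^ 2 * A := by
    intro x
    refine le_of_forall_pos_le_add fun ε hε => ?_
    obtain ⟨n, hn⟩ := hf ε hε
    induction n generalizing f A x with
    | zero =>
      have h2 := hn x (K.p 0) trivial
      have h3 : 0 ≤ A := (abs_nonneg _).trans (hc A f h 0 0)
      have : 0 ≤ 2 / (1 - ρ) ^ 2 * A := by positivity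
      linarith
    | succ n ih =>
      have hA : 0 ≤ A := (abs_nonneg _).trans (hc A f h 0 0)
      rcases hs A f h with h' | h'
      · have h2 := h' x (K.p 0)
        have h3 : A ≤ 2 / (1 - ρ) ^ 2 * A := by
          refine le_mul_of_one_le_left hA ?_
          rw [le_div_iff₀ (by positivity)]
          nlinarith
        linarith
      have h6 : 2 / (1 - ρ) ^ 2 * (ρ * A) + (ρ * A / (1 - ρ) + ρ * A) ≤ 2 / (1 - ρ) ^ 2 * A := by
        have h7 : ρ * A / (1 - ρ) + ρ * A ≤ 2 * A / (1 - ρ) := by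
          rw [div_add' _ _ _ h1'.ne', div_le_div_iff_of_pos_right h1']
          nlinarith [mul_nonneg hA (mul_nonneg h0 h0), mul_nonneg hA h1'.le]
        have h8 : 2 / (1 - ρ) ^ 2 * A - 2 / (1 - ρ) ^ 2 * (ρ * A) = 2 * A / (1 - ρ) := by
          field_simp
        linarith
      have h9 : 0 ≤ ρ * A / (1 - ρ) := by positivity
      rcases K.cover x with ⟨l, y, rfl⟩ | ⟨y, rfl⟩
      · have h2 := ih (hf.T l) (h'.1 l) y (hn.T l)
        have h3 := hc _ _ (h'.1 0) l 0
        simp only [Function.comp_apply, K.T_p, K.T_cross 0 l] at h2 h3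
        have h4 : |f (K.T l y) - f (K.p 0)| ≤ _ := abs_sub_le _ (f (K.T l (K.p 0))) _
        linarith
      · have h2 := ih hf.S h'.2 y hn.S
        have h3 := hc _ _ (h'.1 0) 1 0
        have h5 := edge_chain P h0 h1 0 (fun A f h => hc A f h _ _)
          (fun A f h => (hs A f h).imp_right fun h l _ => h.1 l) (hf.T 0) (h'.1 0) (K.q_edge 0)
        rw [zero_add] at h5
        simp only [Function.comp_apply, K.T_p, K.S_p] at h2 h3 h5
        have h4 : |f (K.S y) - f (K.p 0)| ≤ _ := abs_sub_le _ (f (K.T 0 (K.q 0))) _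
        have h4' : |f (K.T 0 (K.q 0)) - f (K.p 0)| ≤ _ :=
          abs_sub_le _ (f (K.T 0 (K.p 1))) _
        linarith
  have h2 := key x
  have h3 := key y
  rw [abs_sub_comm] at h3
  have h4 := abs_sub_le (f x) (f (K.p 0)) (f y)
  have : 4 / (1 - ρ) ^ 2 * A = 2 / (1 - ρ) ^ 2 * A + 2 / (1 - ρ) ^ 2 * A := by ring
  linarith

/-- An admissible contraction ratio for the conductances `α` and `β`. -/
structure Ratio (ρ α β : ℝ) : Prop where
  pos : 0 < ρ
  lt : ρ < 1
  left : 1 ≤ α * ρ ^ 2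
  right : 1 ≤ β * ρ ^ 2

theorem Ratio.α_pos {ρ : ℝ} (h : Ratio ρ α β) : 0 < α := by
  have := h.left; have := sq_nonneg ρ; by_contra!; nlinarith

theorem Ratio.β_pos {ρ : ℝ} (h : Ratio ρ α β) : 0 < β := by
  have := h.right; have := sq_nonneg ρ; by_contra!; nlinarith

theorem Ratio.mono {ρ α' : ℝ} (h : Ratio ρ α β) (h' : α ≤ α') : Ratio ρ α' β :=
  ⟨h.pos, h.lt, h.left.trans (mul_le_mul_of_nonneg_right h' (sq_nonneg _)), h.right⟩

theorem exists_ratio (hα : 1 < α) (hβ : 1 < β) : ∃ ρ, Ratio ρ α β := by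
  have hm : 1 < min α β := lt_min hα hβ
  have hm0 : 0 < min α β := by linarith
  refine ⟨√(1 / min α β), by positivity, ?_, ?_, ?_⟩
  · rw [Real.sqrt_lt' one_pos, one_pow, div_lt_one hm0]; exact hm
  · rw [Real.sq_sqrt (by positivity), mul_one_div, le_div_iff₀ hm0, one_mul]; exact min_le_left _ _
  · rw [Real.sq_sqrt (by positivity), mul_one_div, le_div_iff₀ hm0, one_mul]; exact min_le_right _ _

theorem Bd.ratio_T {ρ : ℝ} (hr : Ratio ρ α β) {A : ℝ} (h : Bd (K.Lam α β F) f (A ^ 2)) (i : Fin 3) :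
    Bd F (f ∘ K.T i) ((ρ * A) ^ 2) := by
  refine (h.lam_T hr.α_pos hr.β_pos i).mono ?_
  rw [div_le_iff₀ hr.α_pos]
  nlinarith [hr.left, sq_nonneg A]

theorem Bd.ratio_S {ρ : ℝ} (hr : Ratio ρ α β) {A : ℝ} (h : Bd (K.Lam α β F) f (A ^ 2)) :
    Bd F (f ∘ K.S) ((ρ * A) ^ 2) := by
  refine (h.lam_S hr.α_pos hr.β_pos).mono ?_
  rw [div_le_iff₀ hr.β_pos]
  nlinarith [hr.right, sq_nonneg A]

theorem Bd.corner_succ (h : Bd (K.e i) f a) : (f (K.p (i + 1)) - f (K.p (i + 2))) ^ 2 ≤ a :=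
  (bd_e.1 h).2 0

theorem Bd.corner (h : Bd K.E0 f a) (i j : Fin 3) : (f (K.p i) - f (K.p j)) ^ 2 ≤ a := by
  by_cases hij : i = j
  · subst hij; simpa using h.1
  · have key : ∃ l : Fin 3, (i = l + 1 ∧ j = l + 2) ∨ (i = l + 2 ∧ j = l + 1) := by
      revert hij; revert i j; decide
    obtain ⟨l, ⟨rfl, rfl⟩ | ⟨rfl, rfl⟩⟩ := key
    · exact (h.E0_e l).corner_succ
    · have := (h.E0_e l).corner_succ
      rwa [sub_sq_comm]

/-- Oscillation bound for functionals dominating their renormalization. -/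
theorem osc_of_lam_le {ρ : ℝ} (hr : Ratio ρ α β)
    (hc : ∀ f a, Bd F f a → ∀ i j, (f (K.p i) - f (K.p j)) ^ 2 ≤ a)
    (hs : K.Lam α β F ≤ F) {A : ℝ} (hA : 0 ≤ A)
    (hf : K.CC f) (h : Bd F f (A ^ 2)) (x y : X) : |f x - f y| ≤ 4 / (1 - ρ) ^ 2 * A := by
  refine chain (K := K) (fun A f => 0 ≤ A ∧ Bd F f (A ^ 2)) hr.pos.le hr.lt (fun A f h i j => ?_)
    (fun A f h => Or.inr ?_) hf ⟨hA, h⟩ x y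
  · exact abs_le_of_sq_le_sq (hc _ _ h.2 i j) h.1
  · have h2 : Bd (K.Lam α β F) f (A ^ 2) := h.2.of_le (hs f)
    have h3 := mul_nonneg hr.pos.le h.1
    exact ⟨fun l => ⟨h3, h2.ratio_T hr l⟩, h3, h2.ratio_S hr⟩

theorem E0_le_G : K.E0 ≤ K.G α β n := by
  cases n with
  | zero => exact le_self_add
  | succ n => rw [G_succ]; exact le_self_add

theorem Lam_le_G : K.Lam α β (K.G α β n) ≤ K.G α β (n + 1) := by
  rw [G_succ]; exact le_add_self

theorem osc_of_G {ρ : ℝ} (hr : Ratio ρ α β) {A : ℝ} (hA : 0 ≤ A)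
    (hf : K.CC f) (h : Bd (K.G α β n) f (A ^ 2)) (x y : X) :
    |f x - f y| ≤ 4 / (1 - ρ) ^ 2 * A := by
  refine chain (K := K) (fun A f => 0 ≤ A ∧ ∃ n, Bd (K.G α β n) f (A ^ 2)) hr.pos.le hr.lt
    (fun A f h i j => ?_) (fun A f h => ?_) hf ⟨hA, n, h⟩ x y
  · obtain ⟨h, n, h'⟩ := h
    exact abs_le_of_sq_le_sq ((h'.of_le (E0_le_G f)).corner i j) h
  · obtain ⟨h, n, h'⟩ := h
    cases n with
    | zero =>
      refine Or.inl fun x y => abs_le_of_sq_le_sq ?_ h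
      exact (bd_osc2.1 (Bd.right h')).2 x y
    | succ n =>
      have h2 := h'.of_le (Lam_le_G f)
      have h3 := mul_nonneg hr.pos.le h
      exact Or.inr ⟨fun l => ⟨h3, n, h2.ratio_T hr l⟩, h3, n, h2.ratio_S hr⟩

theorem osc_n_of_G {ρ : ℝ} (hr : Ratio ρ α β) {m : ℕ} (hnm : n ≤ m) {A : ℝ} (hA : 0 ≤ A)
    (hf : K.CC f) (h : Bd (K.G α β m) f (A ^ 2)) : K.Osc n (4 / (1 - ρ) ^ 2 * (ρ ^ n * A)) f := by
  induction n generalizing m f A with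
  | zero => exact fun x y _ => by simpa using osc_of_G hr hA hf h x y
  | succ n ih =>
    obtain ⟨m, rfl⟩ : ∃ k, m = k + 1 := ⟨m - 1, by omega⟩
    have h2 := h.of_le (Lam_le_G f)
    have h3 := mul_nonneg hr.pos.le hA
    have : ρ ^ (n + 1) * A = ρ ^ n * (ρ * A) := by ring
    rw [this]
    exact osc_succ (fun i => ih (by omega) h3 (hf.T i) (h2.ratio_T hr i))
      (ih (by omega) h3 hf.S (h2.ratio_S hr))

variable (K)

/-- The restriction of `f` to the edge opposite to the corner `i` is affine. -/
def LinE (i : Fin 3) (f : X → ℝ) : Prop :=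
  ∀ n, K.ea i n f ≤ (f (K.p (i + 1)) - f (K.p (i + 2))) ^ 2

variable {K}

theorem LinE.eq (h : K.LinE i f) (n : ℕ) :
    K.ea i n f = (f (K.p (i + 1)) - f (K.p (i + 2))) ^ 2 :=
  (h n).antisymm (ea_mono f n.zero_le)

theorem LinE.bd (h : K.LinE i f) : Bd (K.e i) f ((f (K.p (i + 1)) - f (K.p (i + 2))) ^ 2) :=
  bd_e.2 ⟨sq_nonneg _, h⟩

theorem LinE.smul (h : K.LinE i f) (c : ℝ) : K.LinE i (c • f) := fun n => by
  rw [ea_smul, h.eq]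
  simp only [Pi.smul_apply, smul_eq_mul, ← mul_sub, mul_pow, le_refl]

theorem LinE.add (h : K.LinE i f) (h' : K.LinE i g) : K.LinE i (f + g) := fun n => by
  have h1 := ea_par (K := K) (i := i) (n := n) (f := f) (g := g)
  have h2 := ea_par (K := K) (i := i) (n := 0) (f := f) (g := g)
  have h3 := ea_mono (K := K) (i := i) (f - g) n.zero_le
  rw [h.eq, h'.eq] at h1
  simp only [ea, Pi.add_apply, Pi.sub_apply] at h2 h3 ⊢
  linarith

theorem LinE.sub (h : K.LinE i f) (h' : K.LinE i g) : K.LinE i (f - g) := by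
  have := h.add (h'.smul (-1))
  simpa [sub_eq_add_neg] using this

theorem LinE.rot (h : K.LinE (i + 1) f) : K.LinE i (f ∘ K.rot) := fun n => by
  rw [ea_rot, h.eq]
  simp only [Function.comp_apply, K.rot_p, add_right_comm i 1, le_refl]

theorem LinE.mid_and (h : K.LinE i f) :
    f (K.T (i + 1) (K.p (i + 2))) = (f (K.p (i + 1)) + f (K.p (i + 2))) / 2 ∧
    K.LinE i (f ∘ K.T (i + 1)) ∧ K.LinE i (f ∘ K.T (i + 2)) := by
  have h1 : f (K.T (i + 1) (K.p (i + 2))) = (f (K.p (i + 1)) + f (K.p (i + 2))) / 2 := by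
    have := h 1
    simp only [ea, Function.comp_apply, K.T_p, T_mid] at this
    have h2 : (f (K.p (i + 1)) + f (K.p (i + 2)) - 2 * f (K.T (i + 1) (K.p (i + 2)))) ^ 2 ≤ 0 := by
      linarith
    have h3 := pow_eq_zero_iff two_ne_zero |>.1 (h2.antisymm (sq_nonneg _))
    linarith
  refine ⟨h1, fun n => ?_, fun n => ?_⟩
  all_goals
    have h2 := h (n + 1)
    have h3 := ea_mono (K := K) (i := i) (f ∘ K.T (i + 1)) n.zero_le
    have h4 := ea_mono (K := K) (i := i) (f ∘ K.T (i + 2)) n.zero_le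
    simp only [ea, Function.comp_apply, K.T_p, T_mid, h1] at h2 h3 h4 ⊢
    linarith

theorem linE_of (h : f (K.T (i + 1) (K.p (i + 2))) = (f (K.p (i + 1)) + f (K.p (i + 2))) / 2)
    (h1 : K.LinE i (f ∘ K.T (i + 1))) (h2 : K.LinE i (f ∘ K.T (i + 2))) : K.LinE i f := by
  intro n
  refine ea_le_succ.trans ?_
  simp only [ea]
  rw [h1.eq, h2.eq]
  simp only [Function.comp_apply, K.T_p, T_mid, h]
  nlinarith

theorem linE_aff (x : Fin 3 → ℝ) (i : Fin 3) : K.LinE i (K.aff x) := by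
  intro n
  simp only [K.aff_p]
  induction n generalizing x with
  | zero => simp [ea, K.aff_p]
  | succ n ih =>
    simp only [ea, K.aff_T]
    have h1 := ih (fun j => (x (i + 1) + x j) / 2)
    have h2 := ih (fun j => (x (i + 2) + x j) / 2)
    nlinarith

theorem linE_const (c : ℝ) (i : Fin 3) : K.LinE i (fun _ => c) := by
  intro n
  induction n with
  | zero => simp [ea]
  | succ n ih =>
    simp only [ea]
    change 2 * (K.ea i n (fun _ => c) + K.ea i n (fun _ => c)) ≤ _
    simp at ih ⊢
    linarith

/-- Control of a function on an edge by its edge energy. -/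
theorem edge_osc (hf : K.CC f) (h : Bd (K.e i) f (a ^ 2)) (ha : 0 ≤ a) {x : X} (hx : x ∈ K.Edge i) :
    |f x - f (K.p (i + 1))| ≤ 4 * a := by
  have := edge_chain (K := K) (fun A f => 0 ≤ A ∧ Bd (K.e i) f (A ^ 2)) (ρ := 3 / 4) (by norm_num)
    (by norm_num) i (fun A f h => abs_le_of_sq_le_sq h.2.corner_succ h.1)
    (fun A f h => Or.inr fun l hl => ⟨mul_nonneg (by norm_num) h.1, ?_⟩) hf ⟨ha, h⟩ hx
  · refine this.trans (le_of_eq ?_); ring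
  · have h2 := bd_e.1 h.2
    refine bd_e.2 ⟨sq_nonneg _, fun n => ?_⟩
    have h3 := h2.2 (n + 1)
    have h4 := ea_nonneg (K := K) (i := i) (n := n) (f := f ∘ K.T (i + 1))
    have h5 := ea_nonneg (K := K) (i := i) (n := n) (f := f ∘ K.T (i + 2))
    rcases eq_or_of_ne hl with rfl | rfl <;> simp only [ea] at h3 <;> nlinarith [sq_nonneg A]

/-- Functions which are affine along an edge are determined by their values at its ends. -/
theorem LinE.eqOn (hf : K.CC f) (hg : K.CC g) (h : K.LinE i f) (h' : K.LinE i g)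
    (h1 : f (K.p (i + 1)) = g (K.p (i + 1))) (h2 : f (K.p (i + 2)) = g (K.p (i + 2))) :
    Set.EqOn f g (K.Edge i) := by
  intro x hx
  have h3 := (h.sub h').bd
  simp only [Pi.sub_apply, h1, h2, sub_self] at h3
  have h4 := edge_osc (hf.sub hg) h3 le_rfl hx
  simp only [Pi.sub_apply, h1, sub_self, mul_zero, sub_zero] at h4
  have := abs_nonpos_iff.1 h4
  linarith

end Gasket
end AG

namespace AG

open scoped ENNReal

namespace Gasket

variable {X : Type*} {K : Gasket X} {F H : Fnl X} {f g : X → ℝ} {a b : ℝ} {i : Fin 3} {n : ℕ}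
  {α β : ℝ}

/-- The energy of corner values on the triangle. -/
def Dc (x : Fin 3 → ℝ) : ℝ := (x 0 - x 1) ^ 2 + (x 1 - x 2) ^ 2 + (x 2 - x 0) ^ 2

theorem Dc_nonneg (x : Fin 3 → ℝ) : 0 ≤ Dc x := by unfold Dc; positivity

theorem sq_le_Dc (x : Fin 3 → ℝ) (i j : Fin 3) : (x i - x j) ^ 2 ≤ Dc x := by
  unfold Dc
  fin_cases i <;> fin_cases j <;> simp <;>
    nlinarith [sq_nonneg (x 0 - x 1), sq_nonneg (x 1 - x 2), sq_nonneg (x 2 - x 0)]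

theorem exists_range (x : Fin 3 → ℝ) :
    ∃ m M : ℝ, (∀ i, m ≤ x i ∧ x i ≤ M) ∧ (M - m) ^ 2 ≤ Dc x := by
  obtain ⟨i, hi⟩ := Finite.exists_min x
  obtain ⟨j, hj⟩ := Finite.exists_max x
  exact ⟨x i, x j, fun k => ⟨hi k, hj k⟩, sq_le_Dc x j i⟩

theorem sq_le_of_mem {m M u v : ℝ} (hu : m ≤ u ∧ u ≤ M) (hv : m ≤ v ∧ v ≤ M) :
    (u - v) ^ 2 ≤ (M - m) ^ 2 :=
  sq_le_sq' (by linarith) (by linarith)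

theorem Dc_le_of_mem {m M : ℝ} {y : Fin 3 → ℝ} (h : ∀ i, m ≤ y i ∧ y i ≤ M) :
    Dc y ≤ 3 * (M - m) ^ 2 := by
  have h1 := sq_le_of_mem (h 0) (h 1)
  have h2 := sq_le_of_mem (h 1) (h 2)
  have h3 := sq_le_of_mem (h 2) (h 0)
  unfold Dc; linarith

/-- `f` takes values in any interval containing the corner values `x`. -/
def InR (x : Fin 3 → ℝ) (f : X → ℝ) : Prop :=
  ∀ m M, (∀ i, m ≤ x i ∧ x i ≤ M) → ∀ z, m ≤ f z ∧ f z ≤ M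

variable (K) in
/-- All corner values are attained by functions which are affine on the edges in `S`, with edge
energies controlled by `b` and `F`-energy controlled by `A`. -/
def Ty (F : Fnl X) (S : Set (Fin 3)) (A b : ℝ) : Prop :=
  ∀ x : Fin 3 → ℝ, ∃ f, K.CC f ∧ (∀ i, f (K.p i) = x i) ∧ (∀ i ∈ S, K.LinE i f) ∧
    (∀ i, Bd (K.e i) f (b * Dc x)) ∧ Bd F f (A * Dc x) ∧ InR x f

theorem Ty.mono {S S' : Set (Fin 3)} {A A' b b' : ℝ} (h : K.Ty F S A b) (hS : S' ⊆ S)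
    (hA : A ≤ A') (hb : b ≤ b') : K.Ty F S' A' b' := fun x => by
  obtain ⟨f, h1, h2, h3, h4, h5, h6⟩ := h x
  exact ⟨f, h1, h2, fun i hi => h3 i (hS hi),
    fun i => (h4 i).mono (mul_le_mul_of_nonneg_right hb (Dc_nonneg x)),
    h5.mono (mul_le_mul_of_nonneg_right hA (Dc_nonneg x)), h6⟩

theorem Ty.nonneg {S : Set (Fin 3)} {A b : ℝ} (h : K.Ty F S A b) : 0 ≤ A ∧ 0 ≤ b := by
  obtain ⟨f, h1, h2, h3, h4, h5, h6⟩ := h ![1, 0, 0]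
  have h7 := h5.1
  have h8 := (h4 0).1
  simp [Dc] at h7 h8
  constructor <;> linarith

theorem Dc_mid (x : Fin 3 → ℝ) (j : Fin 3) : Dc (fun k => (x j + x k) / 2) = Dc x / 4 := by
  unfold Dc; ring

/-- Functions on the cells are combined into a function on the whole gasket. -/
theorem Ty.step (hα : 0 ≤ α) (hβ : 0 ≤ β) {S : Fin 3 → Set (Fin 3)} {S' : Set (Fin 3)}
    {A : Fin 3 → ℝ} {κ b b' : ℝ} (hT : ∀ j, K.Ty F (S j) (A j) b) (hS : K.Ty F ∅ κ b')
    (hS' : ∀ i ∈ S', i ∈ S (i + 1) ∧ i ∈ S (i + 2)) :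
    K.Ty (K.E0 + K.Lam α β F) S'
      (3 * b + α / 4 * (A 0 + A 1 + A 2) + 3 * β * κ) b := by
  intro x
  choose f h1 h2 h3 h4 h5 h6 using fun j => hT j (fun k => (x j + x k) / 2)
  obtain ⟨g, g1, g2, -, -, g5, g6⟩ := hS (fun i => f i (K.q i))
  have hc : K.Compat f g := ⟨fun i j => by rw [h2, h2, add_comm], fun i => g2 i⟩
  have hmid : ∀ m M, (∀ i, m ≤ x i ∧ x i ≤ M) → ∀ j k, m ≤ (x j + x k) / 2 ∧
      (x j + x k) / 2 ≤ M := fun m M h j k => by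
    have := h j; have := h k; constructor <;> linarith
  have he : ∀ i, Bd (K.e i) (K.glue f g) (b * Dc x) := fun i => by
    rw [bd_e]
    refine ⟨mul_nonneg (hT 0).nonneg.2 (Dc_nonneg x), fun n => ea_le_succ.trans ?_⟩
    have := (bd_e.1 (h4 (i + 1) i)).2 n
    have := (bd_e.1 (h4 (i + 2) i)).2 n
    simp only [Dc_mid] at *
    rw [ea, glue_T hc, glue_T hc]
    linarith
  have hD : Dc (fun i => f i (K.q i)) ≤ 3 * Dc x := by
    obtain ⟨m, M, hm, hM⟩ := exists_range x
    refine (Dc_le_of_mem fun i => h6 i m M (hmid m M hm i) _).trans ?_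
    linarith
  refine ⟨K.glue f g, glue_CC hc h1 g1, fun i => ?_, fun i hi => ?_, he, ?_, ?_⟩
  · rw [glue_p hc, h2]; ring
  · refine linE_of ?_ ?_ ?_
    · rw [glue_T_apply hc, glue_p hc, glue_p hc, h2, h2, h2]; ring
    · rw [glue_T hc]; exact h3 _ _ (hS' i hi).1
    · rw [glue_T hc]; exact h3 _ _ (hS' i hi).2
  · have := (bd_E0 he).add (Bd.lam (f := K.glue f g) hα hβ
      (fun i => by rw [glue_T hc]; exact h5 i) (by rw [glue_S hc]; exact g5))
    refine this.mono ?_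
    simp only [Dc_mid]
    have hκ : 0 ≤ β * κ := mul_nonneg hβ hS.nonneg.1
    have := mul_le_mul_of_nonneg_left hD hκ
    linarith
  · intro m M hm
    refine glue_mem hc (P := fun t => m ≤ t ∧ t ≤ M) (fun i => h6 i m M (hmid m M hm i)) ?_
    exact g6 m M fun i => h6 i m M (hmid m M hm i) _

/-- The basic constant of the linear induction. -/
noncomputable def A1 (β b κ : ℝ) : ℝ := 6 * (3 * b + κ / 2 + 3 * β * κ)

variable (K) in
/-- The induction hypothesis: existence of functions which are affine on one, two or three edges. -/
def Hn (α β b κ : ℝ) (n : ℕ) : Prop :=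
  K.Ty (K.G α β n) Set.univ (3 * A1 β b κ) b ∧ (∀ i, K.Ty (K.G α β n) {i} (A1 β b κ) b) ∧
    ∀ j, K.Ty (K.G α β n) {k | k ≠ j} (2 * A1 β b κ) b

theorem ty_G_zero : K.Ty (K.G α β 0) Set.univ 2 1 := by
  intro x
  have he : ∀ i, Bd (K.e i) (K.aff x) ((x (i + 1) - x (i + 2)) ^ 2) := fun i => by
    have := (linE_aff (K := K) x i).bd
    simpa only [K.aff_p] using this
  refine ⟨K.aff x, CC.aff x, K.aff_p x, fun i _ => linE_aff x i, fun i => (he i).mono ?_, ?_,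
    K.aff_mem x⟩
  · rw [one_mul]; exact sq_le_Dc _ _ _
  · have h1 := bd_E0 he
    obtain ⟨m, M, hm, hM⟩ := exists_range x
    have h2 : Bd osc2 (K.aff x) (Dc x) := bd_osc2.2 ⟨Dc_nonneg x, fun z w =>
      (sq_le_of_mem (K.aff_mem x m M hm z) (K.aff_mem x m M hm w)).trans hM⟩
    refine (h1.add h2).mono (le_of_eq ?_)
    have h : (2 : Fin 3) + 1 = 0 := rfl
    have h' : (2 : Fin 3) + 2 = 1 := rfl
    have h'' : (1 : Fin 3) + 2 = 0 := rfl
    have h₃ : (1 : Fin 3) + 1 = 2 := rfl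
    simp only [zero_add, h, h', h'', h₃, Dc]
    ring

theorem lin_ind (hα : 0 ≤ α) (hα' : α ≤ 5 / 3) (hβ : 0 ≤ β) {b κ : ℝ} (hb : 1 ≤ b) (hκ : 0 ≤ κ)
    (h : ∀ n, (∀ m ≤ n, K.Hn α β b κ m) → K.Ty (K.G α β n) ∅ κ b) (n : ℕ) : K.Hn α β b κ n := by
  have hβκ := mul_nonneg hβ hκ
  have hA : A1 β b κ = 6 * (3 * b + κ / 2 + 3 * β * κ) := rfl
  induction n using Nat.strong_induction_on with
  | _ n ih =>
  cases n with
  | zero =>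
    refine ⟨ty_G_zero.mono (Set.subset_univ _) ?_ hb, fun i =>
      ty_G_zero.mono (Set.subset_univ _) ?_ hb, fun i =>
      ty_G_zero.mono (Set.subset_univ _) ?_ hb⟩ <;> linarith
  | succ n =>
    obtain ⟨h1, h2, h3⟩ := ih n n.lt_succ_self
    have hS := h n fun m hm => ih m (Nat.lt_succ_of_le hm)
    rw [Hn, G_succ]
    refine ⟨?_, fun i => ?_, fun j => ?_⟩
    · refine (Ty.step hα hβ h3 hS (S' := Set.univ) fun i _ => ?_).mono subset_rfl ?_ le_rfl
      · exact ⟨(add_one_ne i).symm, (add_two_ne i).symm⟩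
      · nlinarith
    · refine (Ty.step hα hβ (S := fun j => if j = i then ∅ else {i})
        (A := fun j => if j = i then κ else A1 β b κ) (fun j => ?_) hS (S' := {i}) ?_).mono
        subset_rfl ?_ le_rfl
      · split_ifs
        exacts [hS, h2 i]
      · rintro k rfl
        exact ⟨by simp, by simp⟩
      · have : (if (0 : Fin 3) = i then κ else A1 β b κ) + (if (1 : Fin 3) = i then κ else A1 β b κ) +
            (if (2 : Fin 3) = i then κ else A1 β b κ) = κ + 2 * A1 β b κ := by
          fin_cases i <;> simp <;> ring
        rw [this]
        nlinarith
    · refine (Ty.step hα hβ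
        (S := fun l => if l = j then {k | k ≠ j} else if l = j + 1 then {j + 2} else {j + 1})
        (A := fun l => if l = j then 2 * A1 β b κ else A1 β b κ) (fun l => ?_) hS
        (S' := {k | k ≠ j}) ?_).mono subset_rfl ?_ le_rfl
      · split_ifs
        exacts [h3 j, h2 _, h2 _]
      · intro k hk
        rcases eq_or_of_ne hk with rfl | rfl <;> fin_cases j <;> simp
      · have : (if (0 : Fin 3) = j then 2 * A1 β b κ else A1 β b κ) +
            (if (1 : Fin 3) = j then 2 * A1 β b κ else A1 β b κ) +
            (if (2 : Fin 3) = j then 2 * A1 β b κ else A1 β b κ) = 4 * A1 β b κ := by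
          fin_cases j <;> simp <;> ring
        rw [this]
        nlinarith

end Gasket
end AG

namespace AG

open scoped ENNReal

namespace Gasket

variable {X : Type*} {K : Gasket X} {F H : Fnl X} {f g : X → ℝ} {a b : ℝ} {i : Fin 3} {n : ℕ}
  {α β : ℝ}

/-- Truncation to an interval. -/
def clamp (m M t : ℝ) : ℝ := max m (min M t)

theorem clamp_lip (m M : ℝ) (x y : ℝ) : |clamp m M x - clamp m M y| ≤ |x - y| :=
  (abs_max_sub_max_le_max _ _ _ _).trans (by
    rw [sub_self, abs_zero]
    refine max_le (abs_nonneg _) ((abs_min_sub_min_le_max _ _ _ _).trans ?_)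
    rw [sub_self, abs_zero]
    exact max_le (abs_nonneg _) le_rfl)

theorem clamp_mem {m M : ℝ} (h : m ≤ M) (t : ℝ) : m ≤ clamp m M t ∧ clamp m M t ≤ M :=
  ⟨le_max_left _ _, max_le h (min_le_left _ _)⟩

theorem clamp_eq {m M t : ℝ} (h : m ≤ t ∧ t ≤ M) : clamp m M t = t := by
  rw [clamp, min_eq_right h.2, max_eq_right h.1]

theorem rot_symm_p (K : Gasket X) : K.rot (K.p 2) = K.p 0 ∧ K.rot (K.rot (K.p 1)) = K.p 0 ∧
    K.rot (K.p 0) = K.p 1 ∧ K.rot (K.p 1) = K.p 2 := by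
  simp only [K.rot_p]
  exact ⟨rfl, rfl, rfl, rfl⟩

/-- A function with corner values `(1, 0, 0)` yields functions for all corner values. -/
theorem ty_of_potential (hF : K.Fm F) {ψ : X → ℝ} (hψ : K.CC ψ) (h0 : ψ (K.p 0) = 1)
    (h1 : ψ (K.p 1) = 0) (h2 : ψ (K.p 2) = 0) (hW : Bd F ψ a) (hb : ∀ i, Bd (K.e i) ψ b) :
    K.Ty F ∅ (2 * a) (2 * b) := by
  intro x
  obtain ⟨r1, -, r3, r4⟩ := rot_symm_p K
  set f1 : X → ℝ := (x 1 - x 0) • (ψ ∘ K.rot ∘ K.rot) with hf1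
  set f2 : X → ℝ := (x 2 - x 0) • (ψ ∘ K.rot) with hf2
  set φ : ℝ → ℝ := fun t => clamp (⨅ i, x i) (⨆ i, x i) (x 0 + t) with hφ
  have hlip : ∀ s t, |φ s - φ t| ≤ |s - t| := fun s t => (clamp_lip _ _ _ _).trans (by simp)
  have hmem : ∀ i, (⨅ i, x i) ≤ x i ∧ x i ≤ ⨆ i, x i := fun i =>
    ⟨ciInf_le (Set.finite_range x).bddBelow i, le_ciSup (Set.finite_range x).bddAbove i⟩
  have hD : 2 * ((x 1 - x 0) ^ 2 * a) + 2 * ((x 2 - x 0) ^ 2 * a) ≤ 2 * a * Dc x := by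
    have := hW.1
    have h := mul_nonneg this (sq_nonneg (x 1 - x 2))
    simp only [Dc]
    nlinarith
  have hDb : 2 * ((x 1 - x 0) ^ 2 * b) + 2 * ((x 2 - x 0) ^ 2 * b) ≤ 2 * b * Dc x := by
    have := (hb 0).1
    have h := mul_nonneg this (sq_nonneg (x 1 - x 2))
    simp only [Dc]
    nlinarith
  refine ⟨φ ∘ (f1 + f2), ?_, fun i => ?_, by simp, fun i => ?_, ?_, ?_⟩
  · exact ((hψ.rot.rot.smul _).add (hψ.rot.smul _)).lip hlip
  · have : φ (x i - x 0) = x i := by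
      simp only [hφ, add_sub_cancel]
      exact clamp_eq (hmem i)
    rw [← this]
    simp only [Function.comp_apply, Pi.add_apply, hf1, hf2, Pi.smul_apply, smul_eq_mul]
    congr 1
    fin_cases i <;> simp [r1, r3, r4, h0, h1, h2]
  · have e1 : Bd (K.e i) f1 ((x 1 - x 0) ^ 2 * b) := by
      rw [hf1, ← Function.comp_assoc]
      exact (hb (i + 1 + 1)).e_rot.e_rot.e_smul _
    have e2 : Bd (K.e i) f2 ((x 2 - x 0) ^ 2 * b) := (hb (i + 1)).e_rot.e_smul _
    refine ((e1.e_add e2 one_pos).e_lip hlip).mono (le_trans (le_of_eq ?_) hDb)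
    ring
  · have e1 : Bd F f1 ((x 1 - x 0) ^ 2 * a) := by
      rw [hf1, ← Function.comp_assoc]
      exact hF.smul _ _ _ (hF.rot _ _ (hF.rot _ _ hW))
    have e2 : Bd F f2 ((x 2 - x 0) ^ 2 * a) := hF.smul _ _ _ (hF.rot _ _ hW)
    exact (hF.lip _ _ φ hlip (hF.add_two e1 e2)).mono hD
  · intro m M hm z
    have := clamp_mem ((hmem 0).1.trans (hmem 0).2) (x 0 + (f1 + f2) z)
    exact ⟨(le_ciInf fun i => (hm i).1).trans this.1, this.2.trans (ciSup_le fun i => (hm i).2)⟩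

theorem tower (hα : 1 ≤ α) (hα' : α ≤ 5 / 3) (hβ' : 0 < β) {L b : ℝ} (hL : 0 ≤ L) (J n : ℕ)
    (hT : ∀ m < n, K.Ty (K.G α β m) Set.univ L b ∧ K.Ty (K.G α β m) ∅ L b) :
    ∃ h, K.CC h ∧ (h (K.p 0) = J ∧ h (K.p 1) = 0 ∧ h (K.p 2) = 0) ∧ Bd (K.e 0) h 0 ∧
      (∀ i, Bd (K.e i) h (4 ^ J)) ∧
      Bd (K.G α β n) h (α ^ J * (J * ((8 + 3 * β) * L) + 4 * 4 ^ J)) := by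
  have hα0 : 0 ≤ α := by linarith
  have hβ := hβ'.le
  induction J generalizing n with
  | zero =>
    have e0 : ∀ i, Bd (K.e i) (fun _ : X => (0 : ℝ)) 0 := fun i => by
      have := (linE_const (K := K) 0 i).bd
      simpa using this
    refine ⟨fun _ => 0, CC.const 0, by simp, e0 0, fun i => (e0 i).mono (by norm_num), ?_⟩
    have hG0 : ∀ m, Bd (K.G α β m) (fun _ : X => (0 : ℝ)) 0 := fun m => by
      induction m with
      | zero =>
        have h1 : Bd (osc2 : Fnl X) (fun _ : X => (0 : ℝ)) 0 := bd_osc2.2 ⟨le_rfl, by simp⟩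
        have := (bd_E0 e0).add h1
        simp only [add_zero] at this
        exact this
      | succ m ih =>
        rw [G_succ]
        have := (bd_E0 e0).add (Bd.lam (K := K) (F := K.G α β m) hα0 hβ (A := fun _ => 0)
          (fun i => ih) ih)
        simpa using this
    exact (hG0 n).mono (by norm_num)
  | succ J ih =>
    cases n with
    | zero =>
      set x : Fin 3 → ℝ := ![(J + 1 : ℕ), 0, 0] with hx
      have hJ : ((J + 1 : ℕ) : ℝ) ^ 2 ≤ 4 ^ (J + 1) := by
        have h2 : ((J + 1 : ℕ) : ℝ) ≤ 2 ^ (J + 1) := by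
          exact_mod_cast (Nat.lt_two_pow_self (n := J + 1)).le
        calc ((J + 1 : ℕ) : ℝ) ^ 2 ≤ (2 ^ (J + 1)) ^ 2 := by gcongr
          _ = 4 ^ (J + 1) := by rw [← pow_mul, mul_comm, pow_mul]; norm_num
      have hlin := fun i => (linE_aff (K := K) x i).bd
      simp only [K.aff_p] at hlin
      have he : ∀ i, Bd (K.e i) (K.aff x) (4 ^ (J + 1)) := fun i => (hlin i).mono <| by
        fin_cases i
        · simp [hx]
        · refine le_trans (le_of_eq ?_) hJ
          change (x 2 - x 0) ^ 2 = _
          simp only [hx, Matrix.cons_val_zero, Matrix.cons_val]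
          ring
        · refine le_trans (le_of_eq ?_) hJ
          change (x 0 - x 1) ^ 2 = _
          simp [hx]
      refine ⟨K.aff x, CC.aff x, ?_, ?_, he, ?_⟩
      · simp [K.aff_p, hx]
      · simpa [hx] using hlin 0
      · have h2 : Bd osc2 (K.aff x) (4 ^ (J + 1)) := bd_osc2.2 ⟨by positivity, fun z w => by
          have hm : ∀ i, 0 ≤ x i ∧ x i ≤ ((J + 1 : ℕ) : ℝ) := fun i => by
            fin_cases i <;> simp [hx] <;> positivity
          have := sq_le_of_mem (K.aff_mem x _ _ hm z) (K.aff_mem x _ _ hm w)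
          rw [sub_zero] at this
          exact this.trans hJ⟩
        refine ((bd_E0 he).add h2).mono ?_
        have h3 : (1 : ℝ) ≤ α ^ (J + 1) := one_le_pow₀ hα
        have h4 : 0 ≤ ((J + 1 : ℕ) : ℝ) * ((8 + 3 * β) * L) := by positivity
        have h5 : (0 : ℝ) ≤ 4 ^ (J + 1) := by positivity
        nlinarith
    | succ n =>
      obtain ⟨h, hc, ⟨hp0, hp1, hp2⟩, he0, he, hG⟩ := ih n fun m hm => hT m (by omega)
      obtain ⟨φ, f1, f2, f3, f4, f5, f6⟩ := (hT n n.lt_succ_self).1 ![1, 0, 0]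
      have fI : ∀ z, 0 ≤ φ z ∧ φ z ≤ 1 := f6 0 1 fun i => by fin_cases i <;> simp
      obtain ⟨g, g1, g2, -, -, g5, g6⟩ := (hT n n.lt_succ_self).2 ![1, φ (K.q 1), φ (K.q 2)]
      have p0 := f2 0
      have p1 := f2 1
      have p2 := f2 2
      simp only [Matrix.cons_val_zero, Matrix.cons_val_one, Matrix.cons_val] at p0 p1 p2
      have hq : h (K.q 0) = 0 := by
        have := edge_osc hc (a := 0) (by simpa using he0) le_rfl (K.q_edge 0)
        simp only [zero_add, mul_zero, hp1, sub_zero] at this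
        exact abs_eq_zero.1 (le_antisymm this (abs_nonneg _))
      set fs : Fin 3 → X → ℝ := ![fun z => 1 + h z, φ, φ] with hfs
      have hcomp : K.Compat fs g := by
        constructor
        · intro i j
          fin_cases i <;> fin_cases j <;> simp [hfs, hp1, hp2, p0, p1, p2]
        · intro i
          rw [g2]
          fin_cases i <;> simp [hfs, hq]
      have hlip : ∀ x y : ℝ, |(fun t => 1 + t) x - (fun t => 1 + t) y| ≤ |x - y| := by simp
      have eφ : ∀ i, Bd (K.e i) φ ((φ (K.p (i + 1)) - φ (K.p (i + 2))) ^ 2) := fun i =>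
        (f3 i trivial).bd
      have hcc : ∀ i, K.CC (fs i) := fun i => by
        fin_cases i
        exacts [hc.lip hlip, f1, f1]
      have hglue : ∀ i, Bd (K.e i) (K.glue fs g) (4 ^ (J + 1)) ∧
          (i = 0 → Bd (K.e i) (K.glue fs g) 0) := fun i => by
        have key : ∀ u v w : ℝ, 2 * (u + v) ≤ w → 0 ≤ u → 0 ≤ v → Bd (K.e i) (fs (i + 1)) u →
            Bd (K.e i) (fs (i + 2)) v → Bd (K.e i) (K.glue fs g) w := by
          intro u v w hw hu hv b1 b2
          refine bd_e.2 ⟨by linarith, fun n => ea_le_succ.trans ?_⟩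
          rw [ea, glue_T hcomp, glue_T hcomp]
          have := (bd_e.1 b1).2 n
          have := (bd_e.1 b2).2 n
          linarith
        have h1 : Bd (K.e i) (fun z => 1 + h z) (4 ^ J) := (he i).e_lip hlip
        have hJ : (1 : ℝ) ≤ 4 ^ J := one_le_pow₀ (by norm_num)
        have hw : 2 * ((4 : ℝ) ^ J + 1) ≤ 4 ^ (J + 1) := by rw [pow_succ]; linarith
        have hw' : 2 * (1 + (4 : ℝ) ^ J) ≤ 4 ^ (J + 1) := by linarith
        have e1 := eφ i
        fin_cases i
        · have h0 : Bd (K.e 0) φ 0 := by simpa [p1, p2] using e1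
          have := key 0 0 0 (by norm_num) le_rfl le_rfl h0 h0
          exact ⟨this.mono (by positivity), fun _ => this⟩
        · refine ⟨key 1 (4 ^ J) _ hw' zero_le_one (by positivity) (e1.mono ?_) h1, by simp⟩
          simp only [Fin.mk_one, show (1 : Fin 3) + 1 = 2 from rfl, show (1 : Fin 3) + 2 = 0 from rfl,
            p0, p2]
          norm_num
        · refine ⟨key (4 ^ J) 1 _ hw (by positivity) zero_le_one h1 (e1.mono ?_), by simp⟩
          simp only [Fin.reduceFinMk, show (2 : Fin 3) + 1 = 0 from rfl,
            show (2 : Fin 3) + 2 = 1 from rfl, p0, p1]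
          norm_num
      refine ⟨K.glue fs g, glue_CC hcomp hcc g1, ⟨?_, ?_, ?_⟩, (hglue 0).2 rfl,
        fun i => (hglue i).1, ?_⟩
      · rw [glue_p hcomp]; simp [hfs, hp0, add_comm]
      · rw [glue_p hcomp]; simp [hfs, p1]
      · rw [glue_p hcomp]; simp [hfs, p2]
      · rw [G_succ]
        have hD1 : Dc ![1, 0, 0] = 2 := by simp [Dc]; norm_num
        have hD2 : Dc ![1, φ (K.q 1), φ (K.q 2)] ≤ 3 := by
          refine (Dc_le_of_mem (m := 0) (M := 1) fun i => ?_).trans (by norm_num)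
          fin_cases i
          · simp
          · exact fI _
          · exact fI _
        rw [hD1] at f5
        have hE : Bd K.E0 (K.glue fs g) (0 + 4 ^ (J + 1) + 4 ^ (J + 1)) :=
          bd_E0 (A := ![0, 4 ^ (J + 1), 4 ^ (J + 1)]) fun i => by
            fin_cases i
            exacts [(hglue 0).2 rfl, (hglue 1).1, (hglue 2).1]
        have hA : ∀ i, Bd (K.G α β n) (K.glue fs g ∘ K.T i)
            (![α ^ J * (J * ((8 + 3 * β) * L) + 4 * 4 ^ J), L * 2, L * 2] i) := fun i => by
          rw [glue_T hcomp]
          fin_cases i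
          exacts [(fm_G (by linarith) hβ' n).lip _ _ _ hlip hG, f5, f5]
        refine (hE.add (Bd.lam hα0 hβ hA (by rw [glue_S hcomp]; exact g5))).mono ?_
        simp only [Matrix.cons_val_zero, Matrix.cons_val_one, Matrix.cons_val]
        have h3 : (1 : ℝ) ≤ α ^ (J + 1) := one_le_pow₀ hα
        have h4 : β * (L * Dc ![1, φ (K.q 1), φ (K.q 2)]) ≤ β * (L * 3) := by gcongr
        have h5 : α * L ≤ 5 / 3 * L := by gcongr
        have h6 : 0 ≤ β * L := by positivity
        have h7 : (0 : ℝ) ≤ 4 ^ J := by positivity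
        have h8 : 0 ≤ (α ^ (J + 1) - 1) * ((8 + 3 * β) * L + 8 * 4 ^ J) :=
          mul_nonneg (by linarith) (by positivity)
        have h9 : 0 ≤ α ^ (J + 1) * 4 ^ J := by positivity
        push_cast
        rw [pow_succ, pow_succ] at *
        nlinarith

/-- For some `α > 1`, the linear induction applies at all levels. -/
theorem exists_start (hβ : 0 < β) : ∃ α b κ : ℝ, 1 < α ∧ α ≤ 5 / 3 ∧ 1 ≤ b ∧ 0 ≤ κ ∧
    ∀ (K : Gasket X) (n : ℕ), K.Hn α β b κ n := by
  obtain ⟨J, hJ⟩ := exists_nat_ge (8 * (8 + 3 * β) * (9 + 54 * β))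
  have hJ0 : (0 : ℝ) < J := lt_of_lt_of_le (by positivity) hJ
  have hJ1 : (1 : ℝ) ≤ J := by exact_mod_cast Nat.one_le_iff_ne_zero.2 (by rintro rfl; simp at hJ0)
  have hJn : J ≠ 0 := by rintro rfl; simp at hJ0
  set α : ℝ := min (2 ^ ((J : ℝ)⁻¹)) (5 / 3) with hαd
  have hα1 : 1 < α := lt_min (Real.one_lt_rpow (by norm_num) (by positivity)) (by norm_num)
  have hα2 : α ≤ 5 / 3 := min_le_right _ _
  have hαJ : α ^ J ≤ 2 := by
    calc α ^ J ≤ ((2 : ℝ) ^ ((J : ℝ)⁻¹)) ^ J := by gcongr; exact min_le_left _ _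
      _ = 2 := Real.rpow_inv_natCast_pow (by norm_num) hJn
  set b : ℝ := 2 * 4 ^ J with hb
  set c : ℝ := 8 + 3 * β with hc
  set κ : ℝ := 2 * (4 * c * (54 * b) + 16 * 4 ^ J) with hκ
  have h4J : (1 : ℝ) ≤ 4 ^ J := one_le_pow₀ (by norm_num)
  have hb1 : 1 ≤ b := by linarith
  have hκ0 : 0 ≤ κ := by positivity
  refine ⟨α, b, κ, hα1, hα2, hb1, hκ0, fun K => lin_ind (by linarith) hα2 hβ.le hb1 hκ0
    fun n ih => ?_⟩
  have hL : 3 * A1 β b κ = 54 * b + (9 + 54 * β) * κ := by unfold A1; ring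
  have hL0 : 0 ≤ 3 * A1 β b κ := by rw [hL]; positivity
  obtain ⟨h, hcc, ⟨hp0, hp1, hp2⟩, -, he, hG⟩ := tower (K := K) hα1.le hα2 hβ hL0 J n
    fun m hm => ⟨(ih m hm.le).1, (ih m hm.le).1.mono (Set.empty_subset _) le_rfl le_rfl⟩
  have hFm := fm_G (K := K) (α := α) (by linarith) hβ n
  refine (ty_of_potential hFm (hcc.smul (J : ℝ)⁻¹) ?_ ?_ ?_ (hFm.smul _ _ _ hG)
    fun i => (he i).e_smul _).mono subset_rfl ?_ ?_
  · simp [hp0, hJ0.ne']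
  · simp [hp1]
  · simp [hp2]
  · rw [← hc]
    calc 2 * (((J : ℝ)⁻¹) ^ 2 * (α ^ J * (J * (c * (3 * A1 β b κ)) + 4 * 4 ^ J)))
        ≤ 2 * (((J : ℝ)⁻¹) ^ 2 * (2 * (J * (c * (3 * A1 β b κ)) + 4 * 4 ^ J))) := by gcongr
      _ = (J : ℝ)⁻¹ * (4 * c * (54 * b)) + (4 * c * (9 + 54 * β) / J) * κ +
          ((J : ℝ)⁻¹) ^ 2 * (16 * 4 ^ J) := by rw [hL]; field_simp; ring
      _ ≤ 1 * (4 * c * (54 * b)) + (1 / 2) * κ + 1 * (16 * 4 ^ J) := by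
          have h1 : (J : ℝ)⁻¹ ≤ 1 := inv_le_one_of_one_le₀ hJ1
          have h2 : ((J : ℝ)⁻¹) ^ 2 ≤ 1 := pow_le_one₀ (by positivity) h1
          have h3 : 4 * c * (9 + 54 * β) / J ≤ 1 / 2 := by
            rw [div_le_div_iff₀ hJ0 (by norm_num)]; linarith
          gcongr
      _ = κ := by rw [hκ]; ring
  · have h1 : (J : ℝ)⁻¹ ≤ 1 := inv_le_one_of_one_le₀ hJ1
    have h2 : ((J : ℝ)⁻¹) ^ 2 ≤ 1 := pow_le_one₀ (by positivity) h1
    rw [hb]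
    nlinarith

end Gasket
end AG

namespace AG

open scoped ENNReal

namespace Gasket

variable {X : Type*} {K : Gasket X} {F H : Fnl X} {f g : X → ℝ} {a b : ℝ} {i : Fin 3} {n : ℕ}
  {α β : ℝ}

theorem continuous_comp (τ : X → X) : Continuous fun f : X → ℝ => f ∘ τ :=
  continuous_pi fun x => continuous_apply (τ x)

theorem continuous_ea : Continuous (K.ea i n) := by
  induction n with
  | zero =>
    change Continuous fun f : X → ℝ => (f (K.p (i + 1)) - f (K.p (i + 2))) ^ 2
    fun_prop
  | succ n ih =>
    change Continuous fun f : X → ℝ => 2 * (K.ea i n (f ∘ K.T (i + 1)) + K.ea i n (f ∘ K.T (i + 2)))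
    exact continuous_const.mul ((ih.comp (continuous_comp _)).add (ih.comp (continuous_comp _)))

theorem lsc_e : LowerSemicontinuous (K.e i) := by
  unfold e
  have : (⨆ n, fun f => ENNReal.ofReal (K.ea i n f)) =
      fun f => ⨆ n, ENNReal.ofReal (K.ea i n f) := by ext; simp
  rw [this]
  exact lowerSemicontinuous_iSup fun n =>
    (ENNReal.continuous_ofReal.comp continuous_ea).lowerSemicontinuous

theorem lsc_E0 : LowerSemicontinuous K.E0 := lowerSemicontinuous_sum fun _ _ => lsc_e

theorem lsc_const_mul (h : LowerSemicontinuous F) (c : ℝ) :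
    LowerSemicontinuous fun f => ENNReal.ofReal c * F f :=
  (ENNReal.continuous_const_mul ENNReal.ofReal_ne_top).comp_lowerSemicontinuous h
    fun _ _ h => mul_le_mul_right h _

theorem lsc_lam (h : LowerSemicontinuous F) : LowerSemicontinuous (K.Lam α β F) :=
  (lsc_const_mul (F := fun f => ∑ i, F (f ∘ K.T i)) (lowerSemicontinuous_sum fun _ _ =>
    LowerSemicontinuous.comp h (continuous_comp _)) α).add
    (lsc_const_mul (F := fun f => F (f ∘ K.S)) (LowerSemicontinuous.comp h (continuous_comp _)) β)

theorem lsc_EN : LowerSemicontinuous (K.EN α β n) := by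
  induction n with
  | zero => exact lsc_E0
  | succ n ih => rw [EN_succ]; exact lsc_E0.add (lsc_lam ih)

/-- Sublevel sets are closed under pointwise limits. -/
theorem Bd.lim {ι : Type*} {L : Filter ι} [L.NeBot] (h : LowerSemicontinuous F) {u : ι → X → ℝ}
    (hu : Tendsto u L (𝓝 f)) (ha : ∀ᶠ j in L, Bd F (u j) a) : Bd F f a :=
  ⟨ha.exists.choose_spec.1,
    (h.isClosed_preimage _).mem_of_tendsto hu (ha.mono fun _ h => h.2)⟩

theorem exists_ulim {ι : Type*} (U : Ultrafilter ι) (u : ι → X → ℝ) (C : ℝ)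
    (h : ∀ᶠ k in U, ∀ x, |u k x| ≤ C) : ∃ f, Tendsto u U (𝓝 f) := by
  have hc : IsCompact (Set.univ.pi fun _ : X => Set.Icc (-C) C) :=
    isCompact_univ_pi fun _ => isCompact_Icc
  obtain ⟨f, -, hf⟩ := hc.ultrafilter_le_nhds (U.map u) (by
    rw [le_principal_iff]
    exact h.mono fun k hk x _ => abs_le.1 (hk x))
  exact ⟨f, hf⟩

theorem CC.lim {ι : Type*} {L : Filter ι} [L.NeBot] {u : ι → X → ℝ} (hu : Tendsto u L (𝓝 f))
    (h : ∀ ε > 0, ∃ n, ∀ᶠ k in L, K.Osc n ε (u k)) : K.CC f := fun ε hε => by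
  obtain ⟨n, hn⟩ := h ε hε
  rw [tendsto_pi_nhds] at hu
  exact ⟨n, fun x y hxy => le_of_tendsto ((hu x).sub (hu y)).abs (hn.mono fun k hk => hk x y hxy)⟩

theorem exists_pow_lt {ρ : ℝ} (h0 : 0 < ρ) (h1 : ρ < 1) (C : ℝ) {ε : ℝ} (hε : 0 < ε) :
    ∃ n, C * ρ ^ n ≤ ε := by
  have := (tendsto_pow_atTop_nhds_zero_of_lt_one h0.le h1).const_mul C
  rw [mul_zero] at this
  exact ((this.eventually_lt_const hε).exists).imp fun _ h => h.le

/-- Functions of bounded energy at all levels have a limit of bounded energy. -/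
theorem compactness {ρ : ℝ} (hr : Ratio ρ α β) (x : Fin 3 → ℝ) (E : Set (Fin 3))
    (h : ∀ n, ∃ m ≥ n, ∃ f, K.CC f ∧ (∀ i, f (K.p i) = x i) ∧ (∀ i ∈ E, K.LinE i f) ∧
      (∀ i, Bd (K.e i) f b) ∧ Bd (K.G α β m) f a ∧ InR x f) :
    ∃ f, K.CC f ∧ (∀ i, f (K.p i) = x i) ∧ (∀ i ∈ E, K.LinE i f) ∧ (∀ i, Bd (K.e i) f b) ∧
      Bd (K.En α β) f a ∧ InR x f := by
  choose m hm u hcc hp hlin he hG hI using h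
  obtain ⟨lo, hi, hlh, -⟩ := exists_range x
  have ha : 0 ≤ a := (hG 0).1
  obtain ⟨f, hf⟩ := exists_ulim (hyperfilter ℕ) u (|lo| + |hi|) (Eventually.of_forall fun k z => by
    have := hI k lo hi hlh z
    rw [abs_le]
    have h1 := neg_abs_le lo
    have h2 := le_abs_self hi
    have h3 := abs_nonneg lo
    have h4 := abs_nonneg hi
    constructor <;> linarith)
  have hf' := tendsto_pi_nhds.1 hf
  have hev : ∀ n : ℕ, ∀ᶠ k in (hyperfilter ℕ : Filter ℕ), n ≤ k := fun n =>
    (Nat.hyperfilter_le_atTop) (eventually_ge_atTop n)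
  have hpf : ∀ i, f (K.p i) = x i := fun i =>
    tendsto_nhds_unique (hf' (K.p i)) (by simp only [hp]; exact tendsto_const_nhds)
  refine ⟨f, CC.lim hf fun ε hε => ?_, hpf, fun i hi n => ?_, fun i => ?_, ?_, ?_⟩
  · obtain ⟨n, hn⟩ := exists_pow_lt hr.pos hr.lt (4 / (1 - ρ) ^ 2 * √a) hε
    refine ⟨n, (hev n).mono fun k hk => ?_⟩
    refine (osc_n_of_G hr (hk.trans (hm k)) (Real.sqrt_nonneg a) (hcc k) ?_).mono le_rfl ?_
    · rw [Real.sq_sqrt ha]; exact hG k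
    · linarith
  · refine le_of_tendsto_of_tendsto ((continuous_ea.tendsto f).comp hf)
      (((hf' _).sub (hf' _)).pow 2) (Eventually.of_forall fun k => hlin k i hi n)
  · exact Bd.lim lsc_e hf (Eventually.of_forall fun k => he k i)
  · refine (bd_iSup ha).2 fun n => Bd.lim lsc_EN hf ((hev n).mono fun k hk => ?_)
    exact (hG k).of_le ((EN_mono (hk.trans (hm k)) _).trans (EN_le_G _))
  · intro lo hi hx z
    exact ⟨ge_of_tendsto (hf' z) (Eventually.of_forall fun k => (hI k lo hi hx z).1),
      le_of_tendsto (hf' z) (Eventually.of_forall fun k => (hI k lo hi hx z).2)⟩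

theorem ty_En_of_G {ρ : ℝ} (hr : Ratio ρ α β) {E : Set (Fin 3)}
    (h : ∀ n, ∃ m ≥ n, K.Ty (K.G α β m) E a b) : K.Ty (K.En α β) E a b := fun x =>
  compactness hr x E fun n => (h n).imp fun _ hm => ⟨hm.1, hm.2 x⟩

end Gasket
end AG

namespace AG

open scoped ENNReal

namespace Gasket

variable {X : Type*} {K : Gasket X} {F H : Fnl X} {f g : X → ℝ} {a b : ℝ} {i : Fin 3} {n : ℕ}
  {α β : ℝ}

variable (K) in
/-- Energies of the uniformly continuous functions with prescribed difference of corner values. -/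
def GoodSet (α β : ℝ) : Set ℝ :=
  {a | ∃ f, K.CC f ∧ f (K.p 0) - f (K.p 1) = 1 ∧ Bd (K.En α β) f a}

variable (K) in
/-- The conductance between two corners. -/
noncomputable def mv (α β : ℝ) : ℝ := sInf (K.GoodSet α β)

theorem Bd.En_corner (h : Bd (K.En α β) f a) (i j : Fin 3) : (f (K.p i) - f (K.p j)) ^ 2 ≤ a :=
  (h.of_le (E0_le_En f)).corner i j

theorem one_le_of_mem (h : a ∈ K.GoodSet α β) : 1 ≤ a := by
  obtain ⟨f, -, h1, h2⟩ := h
  have := h2.En_corner 0 1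
  rw [h1] at this
  linarith

theorem bddBelow_GoodSet : BddBelow (K.GoodSet α β) := ⟨1, fun _ h => one_le_of_mem h⟩

theorem one_le_mv (h : (K.GoodSet α β).Nonempty) : 1 ≤ K.mv α β :=
  le_csInf h fun _ => one_le_of_mem

theorem mv_mul_le (hα : 0 < α) (hβ : 0 < β) (hf : K.CC f) (h : Bd (K.En α β) f a) (i j : Fin 3) :
    K.mv α β * (f (K.p i) - f (K.p j)) ^ 2 ≤ a := by
  have hFm := fm_En (K := K) hα hβ
  have key : ∀ f a, K.CC f → Bd (K.En α β) f a → K.mv α β * (f (K.p 0) - f (K.p 1)) ^ 2 ≤ a := by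
    intro f a hf h
    by_cases h0 : f (K.p 0) - f (K.p 1) = 0
    · rw [h0]; simpa using h.1
    · have hmem : ((f (K.p 0) - f (K.p 1))⁻¹) ^ 2 * a ∈ K.GoodSet α β := by
        refine ⟨(f (K.p 0) - f (K.p 1))⁻¹ • f, hf.smul _, ?_, hFm.smul _ _ _ h⟩
        simp only [Pi.smul_apply, smul_eq_mul, ← mul_sub]
        exact inv_mul_cancel₀ h0
      have := csInf_le bddBelow_GoodSet hmem
      have h2 : 0 < (f (K.p 0) - f (K.p 1)) ^ 2 := by positivity
      rw [inv_pow, ← div_eq_inv_mul, le_div_iff₀ h2] at this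
      exact this
  have h01 := key f a hf h
  have h12 := key _ a hf.rot (hFm.rot _ _ h)
  have h20 := key _ a hf.rot.rot (hFm.rot _ _ (hFm.rot _ _ h))
  obtain ⟨-, -, r3, r4⟩ := rot_symm_p K
  have r2 : K.rot (K.p 2) = K.p 0 := (rot_symm_p K).1
  simp only [Function.comp_apply, r2, r3, r4] at h12 h20
  have ha := h.1
  fin_cases i <;> fin_cases j <;> simp <;> first
    | assumption
    | (rw [sub_sq_comm]; assumption)

theorem Lam_le_mul {c : ℝ≥0∞} (h : ∀ f, K.CC f → F f ≤ c * H f) (hf : K.CC f) :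
    K.Lam α β F f ≤ c * K.Lam α β H f := by
  rw [← congrFun (Lam_const_mul c) f]
  unfold Lam
  gcongr
  · exact h _ (hf.T _)
  · exact h _ hf.S

theorem G_le_En {ρ : ℝ} (hr : Ratio ρ α β) (n : ℕ) (hf : K.CC f) :
    K.G α β n f ≤ ENNReal.ofReal (1 + (4 / (1 - ρ) ^ 2) ^ 2) * K.En α β f := by
  set C := 4 / (1 - ρ) ^ 2
  induction n generalizing f with
  | zero =>
    by_cases htop : K.En α β f = ∞
    · rw [htop, ENNReal.mul_top (by simp; positivity)]; exact le_top
    have hb := bd_toReal htop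
    rw [← Real.sq_sqrt hb.1] at hb
    set A := √(K.En α β f).toReal
    have ho : Bd (osc2 : Fnl X) f (C ^ 2 * A ^ 2) := bd_osc2.2 ⟨by positivity, fun x y => by
      have := osc_of_lam_le hr (fun f a h => h.En_corner) Lam_le_En (Real.sqrt_nonneg _) hf hb x y
      rw [← mul_pow]
      exact sq_le_sq.2 (this.trans (le_abs_self _))⟩
    have h0 : Bd K.E0 f (A ^ 2) := hb.of_le (E0_le_En f)
    have := (h0.add ho).2
    refine this.trans ?_
    rw [← ENNReal.ofReal_toReal htop, ← ENNReal.ofReal_mul (by positivity),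
      ← Real.sq_sqrt (ENNReal.toReal_nonneg (a := K.En α β f))]
    exact ENNReal.ofReal_le_ofReal (by linarith)
  | succ n ih =>
    rw [G_succ, En_eq]
    simp only [Pi.add_apply, mul_add]
    refine add_le_add ?_ (Lam_le_mul (fun f hf => ih hf) hf)
    refine le_mul_of_one_le_left zero_le ?_
    rw [ENNReal.one_le_ofReal]
    have : 0 ≤ C ^ 2 := sq_nonneg C
    linarith

theorem Bd.G_of_En {ρ : ℝ} (hr : Ratio ρ α β) (n : ℕ) (hf : K.CC f) (h : Bd (K.En α β) f a) :
    Bd (K.G α β n) f ((1 + (4 / (1 - ρ) ^ 2) ^ 2) * a) := by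
  refine ⟨mul_nonneg (by positivity) h.1, (G_le_En hr n hf).trans ?_⟩
  rw [ENNReal.ofReal_mul (by positivity)]
  gcongr
  exact h.2

/-- A constant depending only on the contraction ratio and on `β`. -/
noncomputable def cTy (ρ β : ℝ) : ℝ := 54 * 16 + (9 + 54 * β) * (16 * (1 + (4 / (1 - ρ) ^ 2) ^ 2))

theorem exists_potential (hα : 0 < α) (hβ : 0 < β) (h : (K.GoodSet α β).Nonempty) :
    ∃ ψ, K.CC ψ ∧ ψ (K.p 0) = 1 ∧ ψ (K.p 1) = 0 ∧ ψ (K.p 2) = 0 ∧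
      Bd (K.En α β) ψ (8 * K.mv α β) := by
  have hm := one_le_mv h
  have hFm := fm_En (K := K) hα hβ
  obtain ⟨a, ⟨f, hf, h1, h2⟩, ha⟩ := exists_lt_of_csInf_lt h
    (show sInf (K.GoodSet α β) < 2 * K.mv α β by change K.mv α β < _; linarith)
  replace h2 := h2.mono ha.le
  obtain ⟨-, -, r3, r4⟩ := rot_symm_p K
  have r2 : K.rot (K.p 2) = K.p 0 := (rot_symm_p K).1
  have hlip : ∀ c x y : ℝ, |max (x + c) 0 - max (y + c) 0| ≤ |x - y| := fun c x y =>
    (abs_max_sub_max_le_abs _ _ _).trans (by simp)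
  by_cases hc : f (K.p 2) - f (K.p 1) ≤ 1 / 2
  · set φ : ℝ → ℝ := fun t => max (t + (-f (K.p 1) - 1 / 2)) 0 with hφ
    refine ⟨(2 : ℝ) • (φ ∘ f), (hf.lip (hlip _)).smul _, ?_, ?_, ?_, ?_⟩
    · simp only [Pi.smul_apply, Function.comp_apply, hφ, smul_eq_mul]
      rw [max_eq_left (by linarith)]; linarith
    · simp only [Pi.smul_apply, Function.comp_apply, hφ, smul_eq_mul]
      rw [max_eq_right (by linarith)]; simp
    · simp only [Pi.smul_apply, Function.comp_apply, hφ, smul_eq_mul]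
      rw [max_eq_right (by linarith)]; simp
    · exact (hFm.smul 2 _ _ (hFm.lip _ _ φ (hlip _) h2)).mono (by linarith)
  · set φ : ℝ → ℝ := fun t => max (t + (f (K.p 0) - 1 / 2)) 0 with hφ
    refine ⟨(2 : ℝ) • (φ ∘ (-f ∘ K.rot)), (hf.rot.neg.lip (hlip _)).smul _, ?_, ?_, ?_, ?_⟩
    · simp only [Pi.smul_apply, Function.comp_apply, Pi.neg_apply, hφ, smul_eq_mul, r3]
      rw [max_eq_left (by linarith)]; linarith
    · simp only [Pi.smul_apply, Function.comp_apply, Pi.neg_apply, hφ, smul_eq_mul, r4]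
      rw [max_eq_right (by linarith)]; simp
    · simp only [Pi.smul_apply, Function.comp_apply, Pi.neg_apply, hφ, smul_eq_mul, r2]
      rw [max_eq_right (by linarith)]; simp
    · exact (hFm.smul 2 _ _ (hFm.lip _ _ φ (hlip _) (hFm.neg (hFm.rot _ _ h2)))).mono
        (by linarith)

/-- Functions which are affine on all edges, with energy controlled by the conductance. -/
theorem ty_of_good {ρ : ℝ} (hr : Ratio ρ α β) (hα : α ≤ 5 / 3) (h : (K.GoodSet α β).Nonempty) :
    K.Ty (K.En α β) Set.univ (cTy ρ β * K.mv α β) (16 * K.mv α β) := by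
  have hm := one_le_mv h
  obtain ⟨ψ, hψ, h0, h1, h2, h3⟩ := exists_potential hr.α_pos hr.β_pos h
  set C := (1 + (4 / (1 - ρ) ^ 2) ^ 2) with hC
  have hC0 : 0 ≤ C := by positivity
  refine ty_En_of_G hr fun n => ⟨n, le_rfl, ?_⟩
  have hH := lin_ind (K := K) hr.α_pos.le hα hr.β_pos.le (b := 16 * K.mv α β)
    (κ := 16 * C * K.mv α β) (by linarith) (by positivity) (fun n _ => ?_) n
  · convert hH.1 using 1
    unfold A1 cTy
    ring
  · refine (ty_of_potential (fm_G hr.α_pos hr.β_pos n) hψ h0 h1 h2 (h3.G_of_En hr n hψ)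
      fun i => (h3.of_le (E0_le_En ψ)).E0_e i).mono subset_rfl ?_ ?_
    · rw [← hC]; linarith
    · linarith

theorem good_of_Hn {ρ κ : ℝ} (hr : Ratio ρ α β) (h : ∀ n, K.Hn α β b κ n) :
    (K.GoodSet α β).Nonempty := by
  obtain ⟨f, h1, h2, -, -, h3, -⟩ := ty_En_of_G hr (fun n => ⟨n, le_rfl, (h n).1⟩) ![1, 0, 0]
  exact ⟨_, f, h1, by rw [h2, h2]; simp, h3⟩

theorem not_good (hβ : 0 < β) : ¬ (K.GoodSet (5 / 3) β).Nonempty := by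
  rintro ⟨a, f, -, h1, h2⟩
  have hα : (0 : ℝ) < 5 / 3 := by norm_num
  have key : ∀ n f a, Bd (K.EN (5 / 3) β n) f a → (n + 1) * Dc (fun i => f (K.p i)) ≤ a := by
    intro n
    have hE : ∀ f a, Bd K.E0 f a → Dc (fun i => f (K.p i)) ≤ a := fun f a h => by
      obtain ⟨A, hA, hs⟩ := h.E0_inv
      have h0 := (hA 0).corner_succ
      have h1 := (hA 1).corner_succ
      have h2 := (hA 2).corner_succ
      simp only [zero_add, show (1 : Fin 3) + 1 = 2 from rfl, show (1 : Fin 3) + 2 = 0 from rfl,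
        show (2 : Fin 3) + 1 = 0 from rfl, show (2 : Fin 3) + 2 = 1 from rfl] at h0 h1 h2
      unfold Dc
      linarith
    induction n with
    | zero =>
      intro f a h
      have := hE f a h
      simpa using this
    | succ n ih =>
      intro f a h
      rw [EN_succ] at h
      obtain ⟨b, c, hb, hc, hbc⟩ := h.add_inv
      obtain ⟨A, B, hA, hB, hAB⟩ := hc.lam_inv hα hβ
      have hb' := hE f b hb
      have h0 := ih _ _ (hA 0)
      have h1 := ih _ _ (hA 1)
      have h2 := ih _ _ (hA 2)
      have hB0 := mul_nonneg hβ.le hB.1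
      have hD : 3 / 5 * Dc (fun i => f (K.p i)) ≤ Dc (fun i => (f ∘ K.T 0) (K.p i)) +
          Dc (fun i => (f ∘ K.T 1) (K.p i)) + Dc (fun i => (f ∘ K.T 2) (K.p i)) := by
        simp only [Dc, Function.comp_apply, K.T_p]
        rw [K.T_cross 1 0, K.T_cross 2 0, K.T_cross 2 1]
        generalize f (K.p 0) = x
        generalize f (K.p 1) = y
        generalize f (K.p 2) = z
        generalize f (K.T 0 (K.p 1)) = w
        generalize f (K.T 0 (K.p 2)) = v
        generalize f (K.T 1 (K.p 2)) = u
        nlinarith [sq_nonneg (5 * u - (x + 2 * y + 2 * z)), sq_nonneg (5 * v - (2 * x + y + 2 * z)),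
          sq_nonneg (5 * w - (2 * x + 2 * y + z)),
          sq_nonneg (5 * u - (x + 2 * y + 2 * z) - (5 * v - (2 * x + y + 2 * z))),
          sq_nonneg (5 * u - (x + 2 * y + 2 * z) - (5 * w - (2 * x + 2 * y + z))),
          sq_nonneg (5 * v - (2 * x + y + 2 * z) - (5 * w - (2 * x + 2 * y + z)))]
      have hn : (0 : ℝ) ≤ n + 1 := by positivity
      have := mul_le_mul_of_nonneg_left hD hn
      push_cast
      linarith
  obtain ⟨n, hn⟩ := exists_nat_ge a
  have h3 := key n f a (h2.of_iSup n)
  have h4 := sq_le_Dc (fun i => f (K.p i)) 0 1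
  simp only [h1] at h4
  have hn : (0 : ℝ) ≤ n + 1 := by positivity
  have := mul_le_mul_of_nonneg_left h4 hn
  linarith

theorem Lam_mono_left {α' : ℝ} (h : α' ≤ α) : K.Lam α' β F ≤ K.Lam α β F := fun f => by
  unfold Lam
  gcongr

theorem En_mono_left {α' : ℝ} (h : α' ≤ α) : K.En α' β ≤ K.En α β := by
  refine iSup_mono fun n => ?_
  induction n with
  | zero => exact le_rfl
  | succ n ih =>
    rw [EN_succ, EN_succ]
    exact add_le_add le_rfl ((Lam_monotone ih).trans (Lam_mono_left h))

theorem good_anti {α' : ℝ} (h : α' ≤ α) (hg : (K.GoodSet α β).Nonempty) :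
    (K.GoodSet α' β).Nonempty := by
  obtain ⟨a, f, h1, h2, h3⟩ := hg
  exact ⟨a, f, h1, h2, h3.of_le (En_mono_left h f)⟩

end Gasket
end AG

namespace AG

open scoped ENNReal

namespace Gasket

variable {X : Type*} {K : Gasket X} {F H : Fnl X} {f g : X → ℝ} {a b : ℝ} {i : Fin 3} {n : ℕ}
  {α β : ℝ}

variable (K) in
/-- `f` is affine on all edges of all cells of level `n`. -/
def Lin : ℕ → (X → ℝ) → Prop
  | 0, f => ∀ i, K.LinE i f
  | n + 1, f => (∀ i, Lin n (f ∘ K.T i)) ∧ Lin n (f ∘ K.S)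

variable (K) in
/-- The properties of a functional used to make functions affine on the edges of small cells. -/
structure Straight (Q : Fnl X) (α β c0 c1 c2 : ℝ) : Prop where
  fm : K.Fm Q
  le0 : 1 ≤ c0
  le1 : 0 ≤ c1
  straight : ∀ f a, K.CC f → Bd Q f a → ∃ g, K.CC g ∧ (∀ i, g (K.p i) = f (K.p i)) ∧
    (∀ i, K.LinE i g) ∧ Bd Q g (c0 * a)
  edge : ∀ f a, K.CC f → Bd Q f a → ∀ i, ∀ x ∈ K.Edge i, (f x - f (K.p (i + 1))) ^ 2 ≤ c1 * a
  potential : ∀ i, ∃ ψ, K.CC ψ ∧ (∀ j, ψ (K.p j) = if j = i then 1 else 0) ∧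
    ∀ n, Bd ((K.Lam α β)^[n] Q) ψ c2

/-- The constant of the straightening lemma. -/
noncomputable def cX (ρ β c0 c1 c2 : ℝ) (n : ℕ) : ℝ :=
  c0 * Real.exp ((1 + 8 * c2 * (2 * c1 * (c0 + 1)) * β) * ∑ l ∈ Finset.range n, ρ ^ l)

theorem cX_le {ρ c0 c1 c2 : ℝ} (h0 : 0 < ρ) (h1 : ρ < 1) (hβ : 0 ≤ β) (hc0 : 1 ≤ c0) (hc1 : 0 ≤ c1)
    (hc2 : 0 ≤ c2) (n : ℕ) : cX ρ β c0 c1 c2 n ≤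
      c0 * Real.exp ((1 + 8 * c2 * (2 * c1 * (c0 + 1)) * β) * (1 - ρ)⁻¹) := by
  unfold cX
  gcongr
  exact ((summable_geometric_of_lt_one h0.le h1).sum_le_tsum _ fun _ _ => by positivity).trans
    (tsum_geometric_of_lt_one h0.le h1).le

theorem straighten {ρ c0 c1 c2 : ℝ} (hr : Ratio ρ α β) (hα : 1 ≤ α) (hQ : K.Straight F α β c0 c1 c2)
    (n : ℕ) : ∀ f V, K.CC f → Bd ((K.Lam α β)^[n] F) f V → ∃ g, K.CC g ∧
      (∀ i, g (K.p i) = f (K.p i)) ∧ K.Lin n g ∧ Bd ((K.Lam α β)^[n] F) g (cX ρ β c0 c1 c2 n * V) ∧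
      (∀ i, ∀ x ∈ K.Edge i, (g x - f x) ^ 2 ≤ 2 * c1 * (c0 + 1) * (ρ ^ n) ^ 2 * V) ∧
      ∀ i, K.LinE i f → K.LinE i g := by
  have hc0 := hQ.le0
  have hc1 := hQ.le1
  have hρ0 := hr.pos
  have hβ := hr.β_pos
  have hα0 := hr.α_pos
  have hc2 : 0 ≤ c2 := by
    obtain ⟨ψ, -, -, h⟩ := hQ.potential 0
    exact (h 0).1
  induction n with
  | zero =>
    intro f V hf hV
    obtain ⟨g, h1, h2, h3, h4⟩ := hQ.straight f V hf hV
    refine ⟨g, h1, h2, h3, by simpa [cX] using h4, fun i x hx => ?_, fun i _ => h3 i⟩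
    have e1 := hQ.edge f V hf hV i x hx
    have e2 := hQ.edge g _ h1 h4 i x hx
    rw [h2] at e2
    nlinarith [sq_nonneg ((g x - f (K.p (i + 1))) + (f x - f (K.p (i + 1))))]
  | succ n ih =>
    intro f V hf hV
    rw [Function.iterate_succ_apply'] at hV ⊢
    set c3 := 2 * c1 * (c0 + 1) with hc3
    have hc30 : 0 ≤ c3 := by positivity
    obtain ⟨A, B, hA, hB, hAB⟩ := hV.lam_inv hα0 hβ
    have hFm := hQ.fm.lam_iterate hα0 hβ n
    choose u u1 u2 u3 u4 u5 u6 using fun i => ih _ _ (hf.T i) (hA i)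
    choose ψ w1 w2 w3 using hQ.potential
    set δ : Fin 3 → ℝ := fun i => u i (K.q i) - f (K.T i (K.q i)) with hδ
    have hδ2 : ∀ i, δ i ^ 2 ≤ c3 * (ρ ^ n) ^ 2 * A i := fun i => u5 i i _ (K.q_edge i)
    set v : X → ℝ := δ 0 • ψ 0 + δ 1 • ψ 1 + δ 2 • ψ 2 with hv
    have hvc : K.CC v := (((w1 0).smul _).add ((w1 1).smul _)).add ((w1 2).smul _)
    have hvb : Bd ((K.Lam α β)^[n] F) v (4 * c2 * (c3 * (ρ ^ n) ^ 2 * (A 0 + A 1 + A 2))) := by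
      refine (hFm.add_two (hFm.add_two (hFm.smul _ _ _ (w3 0 n)) (hFm.smul _ _ _ (w3 1 n)))
        (hFm.smul _ _ _ (w3 2 n))).mono ?_
      have h0 := mul_le_mul_of_nonneg_right (hδ2 0) hc2
      have h1 := mul_le_mul_of_nonneg_right (hδ2 1) hc2
      have h2 := mul_le_mul_of_nonneg_right (hδ2 2) hc2
      have h3 : 0 ≤ δ 2 ^ 2 * c2 := by positivity
      linarith
    obtain ⟨z, z1, z2, z3, z4, z5, z6⟩ := ih (f ∘ K.S + v) _ (hf.S.add hvc)
      (hFm.add _ _ _ _ (ρ ^ n) (by positivity) hB hvb)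
    have hcomp : K.Compat u z := by
      refine ⟨fun i j => ?_, fun i => ?_⟩
      · rw [u2, u2, Function.comp_apply, Function.comp_apply, K.T_cross]
      · rw [z2]
        simp only [hv, Pi.add_apply, Function.comp_apply, Pi.smul_apply, smul_eq_mul, w2, K.S_p]
        fin_cases i <;> simp [hδ]
    refine ⟨K.glue u z, glue_CC hcomp u1 z1, fun i => ?_, ?_, ?_, fun i x hx => ?_, fun i hi => ?_⟩
    · rw [glue_p hcomp, u2, Function.comp_apply, K.T_p]
    · exact ⟨fun i => by rw [glue_T hcomp]; exact u3 i, by rw [glue_S hcomp]; exact z3⟩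
    · refine (Bd.lam hα0.le hβ.le (fun i => by rw [glue_T hcomp]; exact u4 i)
        (by rw [glue_S hcomp]; exact z4)).mono ?_
      set C := cX ρ β c0 c1 c2 n with hC
      have hC0 : 0 ≤ C := by rw [hC, cX]; positivity
      have hs : 0 ≤ A 0 + A 1 + A 2 := add_nonneg (add_nonneg (hA 0).1 (hA 1).1) (hA 2).1
      have hB0 := hB.1
      have hρn : 0 < ρ ^ n := by positivity
      have hρ1 : ρ ^ n ≤ 1 := pow_le_one₀ hρ0.le hr.lt.le
      have hV0 := hV.1
      have hsV : A 0 + A 1 + A 2 ≤ V := by nlinarith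
      have hcX : C * (1 + (1 + 8 * c2 * c3 * β) * ρ ^ n) ≤ cX ρ β c0 c1 c2 (n + 1) := by
        have h := Real.add_one_le_exp ((1 + 8 * c2 * c3 * β) * ρ ^ n)
        calc C * (1 + (1 + 8 * c2 * c3 * β) * ρ ^ n)
            ≤ C * Real.exp ((1 + 8 * c2 * c3 * β) * ρ ^ n) := by gcongr; linarith
          _ = cX ρ β c0 c1 c2 (n + 1) := by
            rw [hC, cX, cX, Finset.sum_range_succ, mul_add _ (Finset.sum _ _), Real.exp_add]
            ring
      have h1 : (1 + 1 / ρ ^ n) * (4 * c2 * (c3 * (ρ ^ n) ^ 2 * (A 0 + A 1 + A 2))) ≤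
          8 * c2 * c3 * ρ ^ n * V := by
        have : (1 + 1 / ρ ^ n) * (4 * c2 * (c3 * (ρ ^ n) ^ 2 * (A 0 + A 1 + A 2))) =
            (1 + ρ ^ n) * (4 * c2 * c3 * ρ ^ n * (A 0 + A 1 + A 2)) := by field_simp; ring
        rw [this]
        calc (1 + ρ ^ n) * (4 * c2 * c3 * ρ ^ n * (A 0 + A 1 + A 2))
            ≤ (1 + 1) * (4 * c2 * c3 * ρ ^ n * V) := by gcongr
          _ = _ := by ring
      calc α * (C * A 0 + C * A 1 + C * A 2) + β * (C * ((1 + ρ ^ n) * B + (1 + 1 / ρ ^ n) *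
            (4 * c2 * (c3 * (ρ ^ n) ^ 2 * (A 0 + A 1 + A 2)))))
          ≤ α * (C * A 0 + C * A 1 + C * A 2) + β * (C * ((1 + ρ ^ n) * B +
            8 * c2 * c3 * ρ ^ n * V)) := by gcongr
        _ = C * ((α * (A 0 + A 1 + A 2) + β * B) + ρ ^ n * (β * B) +
            8 * c2 * c3 * β * ρ ^ n * V) := by ring
        _ ≤ C * (V + ρ ^ n * V + 8 * c2 * c3 * β * ρ ^ n * V) := by
            have : β * B ≤ V := by nlinarith
            gcongr
        _ = C * (1 + (1 + 8 * c2 * c3 * β) * ρ ^ n) * V := by ring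
        _ ≤ _ := by gcongr
    · obtain ⟨l, -, y, hy, rfl⟩ := K.edge_step i x hx
      rw [glue_T_apply hcomp]
      have h1 := u5 l i y hy
      have h2 : A l ≤ ρ ^ 2 * V := by
        have h3 : α * A l ≤ V := by
          have h0 := mul_nonneg hα0.le (hA 0).1
          have h1 := mul_nonneg hα0.le (hA 1).1
          have h2 := mul_nonneg hα0.le (hA 2).1
          have := mul_nonneg hβ.le hB.1
          fin_cases l <;> simp <;> linarith
        have h4 := hr.left
        have h5 := (hA l).1
        have : A l ≤ ρ ^ 2 * (α * A l) := by nlinarith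
        exact this.trans (by gcongr)
      refine h1.trans ?_
      calc c3 * (ρ ^ n) ^ 2 * A l ≤ c3 * (ρ ^ n) ^ 2 * (ρ ^ 2 * V) := by gcongr
        _ = _ := by ring
    · obtain ⟨h1, h2, h3⟩ := hi.mid_and
      refine linE_of ?_ ?_ ?_
      · rw [glue_T_apply hcomp, glue_p hcomp, glue_p hcomp, u2, u2, u2]
        simpa only [Function.comp_apply, K.T_p] using h1
      · rw [glue_T hcomp]; exact u6 _ i h2
      · rw [glue_T hcomp]; exact u6 _ i h3

end Gasket
end AG

namespace AG

open scoped ENNReal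

namespace Gasket

variable {X : Type*} {K : Gasket X} {F H : Fnl X} {f g : X → ℝ} {a b : ℝ} {i : Fin 3} {n : ℕ}
  {α β : ℝ}

theorem Lin.smul (h : K.Lin n f) (c : ℝ) : K.Lin n (c • f) := by
  induction n generalizing f with
  | zero => exact fun i => (h i).smul c
  | succ n ih => exact ⟨fun i => ih (h.1 i), ih h.2⟩

theorem Lin.add (h : K.Lin n f) (h' : K.Lin n g) : K.Lin n (f + g) := by
  induction n generalizing f g with
  | zero => exact fun i => (h i).add (h' i)
  | succ n ih => exact ⟨fun i => ih (h.1 i) (h'.1 i), ih h.2 h'.2⟩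

theorem lin_const (c : ℝ) (n : ℕ) : K.Lin n (fun _ => c) := by
  induction n with
  | zero => exact fun i => linE_const c i
  | succ n ih => exact ⟨fun i => ih, ih⟩

theorem Lin.rot (h : K.Lin n f) : K.Lin n (f ∘ K.rot) := by
  induction n generalizing f with
  | zero => exact fun i => (h (i + 1)).rot
  | succ n ih =>
    refine ⟨fun i => ?_, ?_⟩
    · rw [comp_rot_T]; exact ih (h.1 _)
    · rw [comp_rot_S]; exact ih h.2

theorem bd_E0_of_linE (h : ∀ i, K.LinE i f) : Bd K.E0 f (Dc (fun i => f (K.p i))) := by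
  refine (bd_E0 fun i => (h i).bd).mono (le_of_eq ?_)
  simp only [Dc]
  have : (2 : Fin 3) + 2 = 1 := rfl
  have h2 : (2 : Fin 3) + 1 = 0 := rfl
  have h3 : (1 : Fin 3) + 2 = 0 := rfl
  have h4 : (1 : Fin 3) + 1 = 2 := rfl
  simp only [this, h2, h3, h4, zero_add]
  ring

theorem Bd.Dc_le (h : Bd K.E0 f a) : Dc (fun i => f (K.p i)) ≤ a := by
  obtain ⟨A, hA, hs⟩ := h.E0_inv
  have h0 := (hA 0).corner_succ
  have h1 := (hA 1).corner_succ
  have h2 := (hA 2).corner_succ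
  have : (2 : Fin 3) + 2 = 1 := rfl
  have h2' : (2 : Fin 3) + 1 = 0 := rfl
  have h3 : (1 : Fin 3) + 2 = 0 := rfl
  have h4 : (1 : Fin 3) + 1 = 2 := rfl
  simp only [this, h2', h3, h4, zero_add] at h0 h1 h2
  simp only [Dc]
  nlinarith

theorem Lam_iterate_le_En (n : ℕ) : (K.Lam α β)^[n] (K.En α β) ≤ K.En α β := by
  induction n with
  | zero => exact le_rfl
  | succ n ih =>
    rw [Function.iterate_succ_apply']
    exact (Lam_monotone ih).trans Lam_le_En

theorem Lam_iterate_E0_le_En (n : ℕ) : (K.Lam α β)^[n] K.E0 ≤ K.En α β :=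
  (Lam_monotone.iterate n E0_le_En).trans (Lam_iterate_le_En n)

theorem sum_Lam_iterate_le (N : ℕ) :
    ∑ n ∈ Finset.range N, (K.Lam α β)^[n] K.E0 + (K.Lam α β)^[N] (K.En α β) ≤ K.En α β := by
  induction N with
  | zero => simp
  | succ N ih =>
    refine le_trans (le_of_eq ?_) ih
    rw [Finset.sum_range_succ, add_assoc]
    congr 1
    conv_rhs => rw [En_eq]
    clear ih
    induction N with
    | zero => rfl
    | succ N ih =>
      rw [Function.iterate_succ_apply', Function.iterate_succ_apply', ← Lam_add, ih,
        ← Function.iterate_succ_apply' (K.Lam α β)]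

theorem exists_Lam_iterate_le (h : Bd (K.En α β) f a) {N : ℕ} (hN : 0 < N) :
    ∃ n < N, Bd ((K.Lam α β)^[n] K.E0) f (a / N) := by
  have h1 : ∑ n ∈ Finset.range N, (K.Lam α β)^[n] K.E0 f ≤
      ∑ n ∈ Finset.range N, ENNReal.ofReal (a / N) := by
    have h2 := sum_Lam_iterate_le (K := K) (α := α) (β := β) N f
    have h3 := (le_self_add.trans h2).trans h.2
    rw [Finset.sum_apply] at h3
    refine h3.trans (le_of_eq ?_)
    rw [Finset.sum_const, Finset.card_range, nsmul_eq_mul, ← ENNReal.ofReal_natCast,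
      ← ENNReal.ofReal_mul (by positivity)]
    congr 1
    field_simp
  by_contra! hcon
  refine h1.not_gt (ENNReal.sum_lt_sum_of_nonempty (Finset.nonempty_range_iff.2 hN.ne')
    fun n hn => ?_)
  by_contra! h2
  exact hcon n (Finset.mem_range.1 hn) ⟨div_nonneg h.1 (by positivity), h2⟩

theorem potential_rot (hF : K.Fm F) {ψ : X → ℝ} (hψ : K.CC ψ) (h0 : ψ (K.p 0) = 1)
    (h1 : ψ (K.p 1) = 0) (h2 : ψ (K.p 2) = 0) (hW : Bd F ψ a) (i : Fin 3) :
    ∃ ψ, K.CC ψ ∧ (∀ j, ψ (K.p j) = if j = i then 1 else 0) ∧ Bd F ψ a := by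
  obtain ⟨r0, r1, r2, r3⟩ := rot_symm_p K
  fin_cases i
  · exact ⟨ψ, hψ, fun j => by fin_cases j <;> simp [h0, h1, h2], hW⟩
  · refine ⟨ψ ∘ K.rot ∘ K.rot, hψ.rot.rot, fun j => ?_, hF.rot _ _ (hF.rot _ _ hW)⟩
    fin_cases j <;> simp [h0, h1, h2, r0, r2, r3]
  · refine ⟨ψ ∘ K.rot, hψ.rot, fun j => ?_, hF.rot _ _ hW⟩
    fin_cases j <;> simp [h0, h1, h2, r0, r2, r3]

theorem straight_E0 (hα : 0 < α) (hβ : 0 < β) (h : (K.GoodSet α β).Nonempty) :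
    K.Straight K.E0 α β 1 16 (8 * K.mv α β) where
  fm := fm_E0
  le0 := le_rfl
  le1 := by norm_num
  straight f a hf ha := by
    refine ⟨K.aff fun i => f (K.p i), CC.aff _, fun i => K.aff_p _ i, fun i => linE_aff _ i, ?_⟩
    refine (bd_E0_of_linE fun i => linE_aff _ i).mono ?_
    simp only [K.aff_p, one_mul]
    exact ha.Dc_le
  edge f a hf ha i x hx := by
    have h1 : Bd (K.e i) f (√a ^ 2) := by rw [Real.sq_sqrt ha.1]; exact ha.E0_e i
    have h2 := edge_osc hf h1 (Real.sqrt_nonneg _) hx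
    have h3 := sq_le_sq' (abs_le.1 h2).1 (abs_le.1 h2).2
    rwa [mul_pow, Real.sq_sqrt ha.1, show (4 : ℝ) ^ 2 = 16 by norm_num] at h3
  potential i := by
    obtain ⟨ψ, h1, h2, h3, h4, h5⟩ := exists_potential hα hβ h
    obtain ⟨φ, e1, e2, e3⟩ := potential_rot (fm_En hα hβ) h1 h2 h3 h4 h5 i
    exact ⟨φ, e1, e2, fun n => e3.of_le (Lam_iterate_E0_le_En n φ)⟩

theorem Bd.Lam_iterate_left {α' : ℝ} (hα : 0 < α) (h' : α ≤ α')
    (h : Bd ((K.Lam α β)^[n] F) f a) : Bd ((K.Lam α' β)^[n] F) f ((α' / α) ^ n * a) := by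
  have hc : 1 ≤ α' / α := (one_le_div hα).2 h'
  have key : ∀ H : Fnl X, K.Lam α' β H ≤ fun f => ENNReal.ofReal (α' / α) * K.Lam α β H f := by
    intro H f
    simp only [Lam, mul_add, ← mul_assoc]
    rw [← ENNReal.ofReal_mul (by positivity), div_mul_cancel₀ _ hα.ne']
    gcongr
    exact le_mul_of_one_le_left zero_le (ENNReal.one_le_ofReal.2 hc)
  have main : ∀ n : ℕ, (K.Lam α' β)^[n] F ≤
      fun f => ENNReal.ofReal ((α' / α) ^ n) * (K.Lam α β)^[n] F f := by
    intro n
    induction n with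
    | zero => intro f; simp
    | succ n ih =>
      rw [Function.iterate_succ_apply', Function.iterate_succ_apply']
      refine (Lam_monotone ih).trans ?_
      rw [Lam_const_mul]
      intro f
      refine (mul_le_mul_right (key _ f) _).trans (le_of_eq ?_)
      simp only [← mul_assoc]
      rw [← ENNReal.ofReal_mul (by positivity), ← pow_succ]
  refine ⟨mul_nonneg (by positivity) h.1, (main n f).trans ?_⟩
  rw [ENNReal.ofReal_mul (by positivity)]
  exact mul_le_mul_right h.2 _

theorem replace (hα : 0 < α) (hβ : 0 < β) {A : ℝ}
    (hQ : ∀ y : Fin 3 → ℝ, ∃ g, K.CC g ∧ (∀ i, g (K.p i) = y i) ∧ (∀ i, K.LinE i g) ∧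
      Bd F g (A * Dc y)) (hA : 0 ≤ A) (n : ℕ) :
    ∀ f V, K.CC f → K.Lin n f → Bd ((K.Lam α β)^[n] K.E0) f V → ∃ g, K.CC g ∧
      (∀ i, g (K.p i) = f (K.p i)) ∧ (∀ i, Set.EqOn g f (K.Edge i)) ∧
      (∀ i, K.LinE i f → K.LinE i g) ∧ Bd ((K.Lam α β)^[n] K.E0) g V ∧
      Bd ((K.Lam α β)^[n] F) g (A * V) := by
  induction n with
  | zero =>
    intro f V hf hl hV
    obtain ⟨g, h1, h2, h3, h4⟩ := hQ fun i => f (K.p i)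
    refine ⟨g, h1, h2, fun i => (h3 i).eqOn h1 hf (hl i) (h2 _) (h2 _), fun i _ => h3 i, ?_, ?_⟩
    · refine (bd_E0_of_linE h3).mono ?_
      simp only [h2]
      exact hV.Dc_le
    · exact h4.mono (mul_le_mul_of_nonneg_left hV.Dc_le hA)
  | succ n ih =>
    intro f V hf hl hV
    rw [Function.iterate_succ_apply'] at hV ⊢
    rw [Function.iterate_succ_apply']
    obtain ⟨B, C, hB, hC, hBC⟩ := hV.lam_inv hα hβ
    choose u u1 u2 u3 u4 u5 u6 using fun i => ih _ _ (hf.T i) (hl.1 i) (hB i)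
    obtain ⟨z, z1, z2, z3, z4, z5, z6⟩ := ih _ _ hf.S hl.2 hC
    have hcomp : K.Compat u z := by
      refine ⟨fun i j => ?_, fun i => ?_⟩
      · rw [u2, u2, Function.comp_apply, Function.comp_apply, K.T_cross]
      · rw [z2, u3 i i (K.q_edge i), Function.comp_apply, Function.comp_apply, K.S_p]
    refine ⟨K.glue u z, glue_CC hcomp u1 z1, fun i => ?_, fun i x hx => ?_, fun i hi => ?_, ?_, ?_⟩
    · rw [glue_p hcomp, u2, Function.comp_apply, K.T_p]
    · obtain ⟨l, -, y, hy, rfl⟩ := K.edge_step i x hx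
      rw [glue_T_apply hcomp]
      exact u3 l i hy
    · obtain ⟨h1, h2, h3⟩ := hi.mid_and
      refine linE_of ?_ ?_ ?_
      · rw [glue_T_apply hcomp, glue_p hcomp, glue_p hcomp, u2, u2, u2]
        simpa only [Function.comp_apply, K.T_p] using h1
      · rw [glue_T hcomp]; exact u4 _ i h2
      · rw [glue_T hcomp]; exact u4 _ i h3
    · exact (Bd.lam hα.le hβ.le (fun i => by rw [glue_T hcomp]; exact u5 i)
        (by rw [glue_S hcomp]; exact z5)).mono hBC
    · refine (Bd.lam hα.le hβ.le (fun i => by rw [glue_T hcomp]; exact u6 i)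
        (by rw [glue_S hcomp]; exact z6)).mono ?_
      nlinarith

end Gasket
end AG

namespace AG

open scoped ENNReal

namespace Gasket

variable {X : Type*} {K : Gasket X} {F H : Fnl X} {f g : X → ℝ} {a b : ℝ} {i : Fin 3} {n : ℕ}
  {α β : ℝ}

theorem family_of_potential (hF : K.Fm F) {ψ : X → ℝ} (hψ : K.CC ψ) (h0 : ψ (K.p 0) = 1)
    (h1 : ψ (K.p 1) = 0) (h2 : ψ (K.p 2) = 0) (hl : ∀ i, K.LinE i ψ) (hn : K.Lin n ψ)
    (hW : Bd F ψ a) (x : Fin 3 → ℝ) : ∃ f, K.CC f ∧ (∀ i, f (K.p i) = x i) ∧ (∀ i, K.LinE i f) ∧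
      K.Lin n f ∧ Bd F f (2 * a * Dc x) := by
  obtain ⟨r0, r1, r2, r3⟩ := rot_symm_p K
  have d1 := sq_le_Dc x 1 0
  have d2 := sq_le_Dc x 2 0
  refine ⟨fun z => x 0 + ((x 1 - x 0) • (ψ ∘ K.rot ∘ K.rot) + (x 2 - x 0) • (ψ ∘ K.rot)) z,
    (CC.const (x 0)).add ((hψ.rot.rot.smul _).add (hψ.rot.smul _)), fun i => ?_, fun i => ?_, ?_, ?_⟩
  · fin_cases i <;> simp [h0, h1, h2, r0, r2, r3]
  · exact (linE_const (x 0) i).add ((((hl (i + 1 + 1)).rot (i := i + 1)).rot.smul _).add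
      ((hl (i + 1)).rot.smul _))
  · exact (lin_const (x 0) n).add ((hn.rot.rot.smul _).add (hn.rot.smul _))
  · refine (hF.const_add _ (hF.add_two (hF.smul _ _ _ (hF.rot _ _ (hF.rot _ _ hW)))
      (hF.smul _ _ _ (hF.rot _ _ hW)))).mono ?_
    have := hW.1
    have d3 : (x 1 - x 0) ^ 2 + (x 2 - x 0) ^ 2 ≤ Dc x := by
      simp only [Dc]; nlinarith [sq_nonneg (x 1 - x 2)]
    nlinarith

/-- The improved family from one level to the next. -/
theorem good_of_family {α' η ρ : ℝ} (hr : Ratio ρ α β) (hα : 1 ≤ α) (hαα : α ≤ α')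
    {ψ : X → ℝ} (hψ : K.CC ψ) (h0 : ψ (K.p 0) = 1)
    (h1 : ψ (K.p 1) = 0) (h2 : ψ (K.p 2) = 0) (hl : ∀ i, K.LinE i ψ) (hn : K.Lin n ψ)
    (hη : Bd ((K.Lam α β)^[n] K.E0) ψ η) (hη1 : 8 * η ≤ 1) (h' : (α' / α) ^ n ≤ 2) :
    (K.GoodSet α' β).Nonempty := by
  have hα0 := hr.α_pos
  have hβ := hr.β_pos
  have hα' : 0 < α' := hα0.trans_le hαα
  have hn0 : n ≠ 0 := by
    rintro rfl
    have := hη.Dc_le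
    simp only [Dc, h0, h1, h2] at this
    linarith
  set A : ℝ := 2 ^ (n + 2) + 2 with hA
  have key : ∀ l x, ∃ g, K.CC g ∧ (∀ i, g (K.p i) = x i) ∧ (∀ i, K.LinE i g) ∧
      Bd (K.G α' β (n * l)) g (A * Dc x) := by
    intro l
    induction l with
    | zero =>
      intro x
      obtain ⟨g, e1, e2, e3, -, e4, -⟩ := ty_G_zero (K := K) (α := α') (β := β) x
      refine ⟨g, e1, e2, fun i => e3 i trivial, e4.mono ?_⟩
      have := Dc_nonneg x
      have : (2 : ℝ) ≤ A := by rw [hA]; linarith [show (0 : ℝ) < 2 ^ (n + 2) by positivity]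
      gcongr
    | succ l ih =>
      intro x
      have hD := Dc_nonneg x
      obtain ⟨f, f1, f2, f3, f4, f5⟩ := family_of_potential (fm_E0.lam_iterate hα0 hβ n) hψ h0 h1 h2
        hl hn hη x
      have f6 : Bd ((K.Lam α' β)^[n] K.E0) f (Dc x / 2) := by
        refine (f5.Lam_iterate_left hα0 hαα).mono ?_
        have h3 : 0 ≤ 2 * η * Dc x := f5.1
        nlinarith
      obtain ⟨g, g1, g2, g3, g4, g5, g6⟩ := replace hα' hβ ih (by positivity) n f _ f1 f4 f6
      refine ⟨g, g1, fun i => (g2 i).trans (f2 i), fun i => g4 i (f3 i), ?_⟩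
      have e1 : K.G α' β (n * (l + 1)) = (K.Bop α' β)^[n] (K.G α' β (n * l)) := by
        rw [G, G, mul_add, mul_one, add_comm, Function.iterate_add_apply]
      rw [e1]
      have e2 := Bop_iterate_le (K := K) (β := β) (hα.trans hαα) n (K.G α' β (n * l)) g
      refine ⟨by positivity, e2.trans ?_⟩
      have e3 : (2 : ℝ≥0∞) ^ (n + 1) = ENNReal.ofReal (2 ^ (n + 1)) := by
        rw [ENNReal.ofReal_pow (by norm_num), ENNReal.ofReal_ofNat]
      calc _ ≤ ENNReal.ofReal (2 ^ (n + 1)) * ENNReal.ofReal (Dc x / 2) +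
            ENNReal.ofReal (A * (Dc x / 2)) := by
            rw [e3]; gcongr
            · exact g5.2
            · exact g6.2
        _ = ENNReal.ofReal (2 ^ (n + 1) * (Dc x / 2) + A * (Dc x / 2)) := by
            rw [ENNReal.ofReal_add (by positivity) (by positivity),
              ENNReal.ofReal_mul (p := 2 ^ (n + 1)) (by positivity)]
        _ ≤ _ := by
            refine ENNReal.ofReal_le_ofReal ?_
            have : A = 2 * 2 ^ (n + 1) + 2 := by rw [hA]; ring
            have h3 : 0 ≤ 2 ^ (n + 1) * Dc x := by positivity
            rw [this]
            linarith
  have hr' := hr.mono hαα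
  have hty : K.Ty (K.En α' β) ∅ (2 * (A * 2)) (2 * (A * 2)) := by
    refine ty_En_of_G hr' fun m => ⟨n * m, Nat.le_mul_of_pos_left m (Nat.pos_of_ne_zero hn0), ?_⟩
    obtain ⟨g, g1, g2, g3, g4⟩ := key m (fun i => if i = 0 then 1 else 0)
    have hb : Bd (K.G α' β (n * m)) g (A * 2) := by
      simpa [Dc, show (1 : ℝ) + 1 = 2 by norm_num] using g4
    exact ty_of_potential (fm_G hα' hβ _) g1 (by simp [g2]) (by simp [g2]) (by simp [g2]) hb
      fun i => (hb.of_le (E0_le_G g)).E0_e i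
  obtain ⟨f, f1, f2, -, -, f3, -⟩ := hty (fun i => if i = 0 then 1 else 0)
  exact ⟨_, f, f1, by simp [f2], f3⟩

theorem openness {ρ α₀ k : ℝ} (hr : Ratio ρ α₀ β) (hα₀ : 1 ≤ α₀) (hk : 0 ≤ k) :
    ∃ δ > 0, ∀ α, α₀ ≤ α → α ≤ 5 / 3 → (K.GoodSet α β).Nonempty → K.mv α β ≤ k →
      (K.GoodSet (α * (1 + δ)) β).Nonempty := by
  have hβ := hr.β_pos
  have h1ρ : 0 < 1 - ρ := by linarith [hr.lt]
  set C : ℝ := 1 * Real.exp ((1 + 8 * (8 * k) * (2 * 16 * (1 + 1)) * β) * (1 - ρ)⁻¹) with hC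
  set L : ℝ := cTy ρ β * k with hL
  have hcT : 0 ≤ cTy ρ β := by unfold cTy; positivity
  obtain ⟨N, hN⟩ := exists_nat_gt (8 * (C * (L * 2)))
  have hN0 : (0 : ℝ) < N := lt_of_le_of_lt (by positivity) hN
  have hN1 : (1 : ℝ) ≤ N := by exact_mod_cast hN0
  refine ⟨1 / (2 * N), by positivity, fun α hα hα' hg hm => ?_⟩
  have hr' := hr.mono hα
  have hα0 := hr'.α_pos
  obtain ⟨f, f1, f2, f3, -, f4, -⟩ := ty_of_good hr' hα' hg (fun i => if i = 0 then 1 else 0)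
  have hb : Bd (K.En α β) f (L * 2) := by
    refine f4.mono ?_
    have hD : Dc (fun i : Fin 3 => if i = 0 then (1 : ℝ) else 0) = 2 := by
      simp [Dc, show (1 : ℝ) + 1 = 2 by norm_num]
    rw [hL, hD]
    gcongr
  obtain ⟨n, hn, hb'⟩ := exists_Lam_iterate_le hb (N := N) (by exact_mod_cast hN0)
  have hα1 : 1 ≤ α := hα₀.trans hα
  obtain ⟨g, g1, g2, g3, g4, -, g5⟩ := straighten hr' hα1 (straight_E0 hα0 hβ hg) n f _ f1 hb'
  have hm0 : 0 ≤ K.mv α β := by linarith [one_le_mv hg]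
  refine good_of_family hr' hα1 (α' := α * (1 + 1 / (2 * N))) ?_ g1 (by simp [g2, f2])
    (by simp [g2, f2]) (by simp [g2, f2]) (fun i => g5 i (f3 i trivial)) g3 g4 ?_ ?_
  · exact le_mul_of_one_le_right hα0.le (by linarith [show 0 < 1 / (2 * (N : ℝ)) by positivity])
  · have h1 : cX ρ β 1 16 (8 * K.mv α β) n ≤ C := by
      refine (cX_le hr.pos hr.lt hβ.le le_rfl (by norm_num) (by positivity) n).trans ?_
      rw [hC]
      gcongr
    calc 8 * (cX ρ β 1 16 (8 * K.mv α β) n * (L * 2 / N)) ≤ 8 * (C * (L * 2 / N)) := by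
          have := hb'.1
          gcongr
      _ = 8 * (C * (L * 2)) / N := by ring
      _ ≤ 1 := by rw [div_le_one hN0]; exact hN.le
  · rw [mul_div_cancel_left₀ _ hα0.ne']
    calc (1 + 1 / (2 * (N : ℝ))) ^ n ≤ (1 + 1 / (2 * (N : ℝ))) ^ N := by
          refine pow_le_pow_right₀ ?_ hn.le
          linarith [show 0 < 1 / (2 * (N : ℝ)) by positivity]
      _ ≤ Real.exp (1 / (2 * N)) ^ N := by
          gcongr
          linarith [Real.add_one_le_exp (1 / (2 * (N : ℝ)))]
      _ = Real.exp (1 / 2) := by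
          rw [← Real.exp_nat_mul]; congr 1; field_simp
      _ ≤ 2 := by
          have h1 := Real.exp_one_lt_d9
          have h2 : Real.exp (1 / 2) ^ 2 = Real.exp 1 := by
            rw [← Real.exp_nat_mul]; congr 1; norm_num
          nlinarith [Real.exp_pos (1 / 2 : ℝ)]

theorem exists_large (K : Gasket X) (hβ : 1 < β) : ∃ α₀ ρ : ℝ, 1 < α₀ ∧ α₀ ≤ 5 / 3 ∧ Ratio ρ α₀ β ∧
    ∀ k : ℕ, ∃ α, α₀ ≤ α ∧ α ≤ 5 / 3 ∧ (K.GoodSet α β).Nonempty ∧ k < K.mv α β := by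
  obtain ⟨α₀, b, κ, h1, h2, -, -, h3⟩ := exists_start (zero_lt_one.trans hβ)
  obtain ⟨ρ, hr⟩ := exists_ratio h1 hβ
  refine ⟨α₀, ρ, h1, h2, hr, fun k => ?_⟩
  by_contra! hcon
  obtain ⟨δ, hδ, hop⟩ := openness (K := K) hr h1.le (k := k) (by positivity)
  have key : ∀ j : ℕ, ∃ α, min (α₀ * (1 + δ) ^ j) (5 / 3) ≤ α ∧ α₀ ≤ α ∧
      (K.GoodSet α β).Nonempty := by
    intro j
    induction j with
    | zero => exact ⟨α₀, by simp, le_rfl, good_of_Hn hr (h3 K)⟩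
    | succ j ih =>
      obtain ⟨α, e1, e2, e3⟩ := ih
      rcases le_or_gt α (5 / 3) with h | h
      · refine ⟨α * (1 + δ), ?_, ?_, hop α e2 h e3 (hcon α e2 h e3)⟩
        · rcases min_le_iff.1 e1 with h4 | h4
          · refine (min_le_left _ _).trans ?_
            rw [pow_succ, ← mul_assoc]
            gcongr
          · refine (min_le_right _ _).trans (h4.trans (le_mul_of_one_le_right ?_ ?_)) <;> linarith
        · exact e2.trans (le_mul_of_one_le_right (by linarith) (by linarith))
      · exact ⟨α, (min_le_right _ _).trans h.le, e2, e3⟩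
  obtain ⟨j, hj⟩ := pow_unbounded_of_one_lt (5 / 3) (show 1 < 1 + δ by linarith)
  obtain ⟨α, e1, e2, e3⟩ := key j
  refine not_good (K := K) (zero_lt_one.trans hβ) (good_anti ?_ e3)
  refine (le_min ?_ le_rfl).trans e1
  nlinarith [pow_pos (show 0 < 1 + δ by linarith) j]

end Gasket
end AG

namespace AG

open scoped ENNReal

namespace Gasket

variable {X : Type*} {K : Gasket X} {F H : Fnl X} {f g : X → ℝ} {a b : ℝ} {i : Fin 3} {n : ℕ}
  {α β : ℝ}

variable (K) in
open Classical in
/-- The normalized energy on functions with small oscillation on small cells. -/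
noncomputable def Eh (α β : ℝ) : Fnl X := fun f =>
  if K.CC f then ENNReal.ofReal (1 / K.mv α β) * K.En α β f else ∞

theorem bd_Eh (hg : (K.GoodSet α β).Nonempty) :
    Bd (K.Eh α β) f a ↔ K.CC f ∧ Bd (K.En α β) f (K.mv α β * a) := by
  have hm : 0 < K.mv α β := zero_lt_one.trans_le (one_le_mv hg)
  constructor
  · rintro ⟨h0, h⟩
    by_cases hf : K.CC f
    · refine ⟨hf, by positivity, ?_⟩
      simp only [Eh, if_pos hf] at h
      calc K.En α β f = ENNReal.ofReal (K.mv α β) * (ENNReal.ofReal (1 / K.mv α β) * K.En α β f) := by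
            rw [← mul_assoc, ← ENNReal.ofReal_mul hm.le, mul_one_div_cancel hm.ne']; simp
        _ ≤ _ := by rw [ENNReal.ofReal_mul hm.le]; gcongr
    · simp [Eh, if_neg hf] at h
  · rintro ⟨hf, h0, h⟩
    refine ⟨nonneg_of_mul_nonneg_right h0 hm, ?_⟩
    simp only [Eh, if_pos hf]
    calc ENNReal.ofReal (1 / K.mv α β) * K.En α β f
        ≤ ENNReal.ofReal (1 / K.mv α β) * ENNReal.ofReal (K.mv α β * a) := by gcongr
      _ = _ := by
        rw [← ENNReal.ofReal_mul (by positivity)]; congr 1; field_simp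

theorem Bd.Eh_CC (h : Bd (K.Eh α β) f a) : K.CC f := by
  by_contra hf
  have := h.2
  simp [Eh, if_neg hf] at this

theorem fm_Eh (hα : 0 < α) (hβ : 0 < β) (hg : (K.GoodSet α β).Nonempty) : K.Fm (K.Eh α β) where
  smul c f a h := by
    rw [bd_Eh hg] at h ⊢
    exact ⟨h.1.smul c, ((fm_En hα hβ).smul _ _ _ h.2).mono (le_of_eq (by ring))⟩
  add f g a b ε hε h h' := by
    rw [bd_Eh hg] at h h' ⊢
    exact ⟨h.1.add h'.1, ((fm_En hα hβ).add _ _ _ _ _ hε h.2 h'.2).mono (le_of_eq (by ring))⟩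
  lip f a φ hφ h := by
    rw [bd_Eh hg] at h ⊢
    exact ⟨h.1.lip hφ, (fm_En hα hβ).lip _ _ _ hφ h.2⟩
  rot f a h := by
    rw [bd_Eh hg] at h ⊢
    exact ⟨h.1.rot, (fm_En hα hβ).rot _ _ h.2⟩

theorem Lam_le_Eh : K.Lam α β (K.Eh α β) ≤ K.Eh α β := by
  intro f
  by_cases hf : K.CC f
  · have e : K.Lam α β (K.Eh α β) f =
        K.Lam α β (fun f => ENNReal.ofReal (1 / K.mv α β) * K.En α β f) f := by
      simp only [Lam, Eh, if_pos (hf.T _), if_pos hf.S]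
    rw [e, Lam_const_mul]
    simp only [Eh, if_pos hf]
    exact mul_le_mul_right (Lam_le_En f) _
  · simp [Eh, if_neg hf]

theorem Lam_iterate_Eh_anti : Antitone fun n => (K.Lam α β)^[n] (K.Eh α β) := by
  refine antitone_nat_of_succ_le fun n => ?_
  rw [Function.iterate_succ_apply]
  exact Lam_monotone.iterate n Lam_le_Eh

theorem Bd.lam_iterate_Eh_CC (hα : 0 < α) (hβ : 0 < β)
    (h : Bd ((K.Lam α β)^[n] (K.Eh α β)) f a) : K.CC f := by
  induction n generalizing f a with
  | zero => exact h.Eh_CC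
  | succ n ih =>
    rw [Function.iterate_succ_apply'] at h
    exact CC.of_comp (fun i => ih (h.lam_T hα hβ i)) (ih (h.lam_S hα hβ))

theorem Bd.Eh_corner (hα : 0 < α) (hβ : 0 < β) (hg : (K.GoodSet α β).Nonempty)
    (h : Bd (K.Eh α β) f a) (i j : Fin 3) : (f (K.p i) - f (K.p j)) ^ 2 ≤ a := by
  rw [bd_Eh hg] at h
  exact le_of_mul_le_mul_left (mv_mul_le hα hβ h.1 h.2 i j) (zero_lt_one.trans_le (one_le_mv hg))

theorem En_le_Eh (hg : (K.GoodSet α β).Nonempty) :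
    K.En α β ≤ fun f => ENNReal.ofReal (K.mv α β) * K.Eh α β f := by
  intro f
  have hm : 0 < K.mv α β := zero_lt_one.trans_le (one_le_mv hg)
  by_cases hf : K.CC f
  · simp only [Eh, if_pos hf]
    rw [← mul_assoc, ← ENNReal.ofReal_mul hm.le, mul_one_div_cancel hm.ne']; simp
  · simp [Eh, if_neg hf, ENNReal.mul_top, hm]

theorem straight_Eh {ρ : ℝ} (hr : Ratio ρ α β) (hα : α ≤ 5 / 3) (hg : (K.GoodSet α β).Nonempty) :
    K.Straight (K.Eh α β) α β (1 + 3 * cTy ρ β) ((4 / (1 - ρ) ^ 2) ^ 2) 8 := by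
  have hα0 := hr.α_pos
  have hβ := hr.β_pos
  have hc : 0 ≤ cTy ρ β := by unfold cTy; positivity
  have hm : 0 < K.mv α β := zero_lt_one.trans_le (one_le_mv hg)
  refine ⟨fm_Eh hα0 hβ hg, by linarith, by positivity, fun f a hf h => ?_, fun f a hf h i x hx => ?_,
    fun i => ?_⟩
  · obtain ⟨g, g1, g2, g3, -, g4, -⟩ := ty_of_good hr hα hg fun i => f (K.p i)
    refine ⟨g, g1, g2, fun i => g3 i trivial, (bd_Eh hg).2 ⟨g1, g4.mono ?_⟩⟩
    have h1 : Dc (fun i => f (K.p i)) ≤ 3 * a := by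
      simp only [Dc]
      linarith [h.Eh_corner hα0 hβ hg 0 1, h.Eh_corner hα0 hβ hg 1 2, h.Eh_corner hα0 hβ hg 2 0]
    have := h.1
    calc cTy ρ β * K.mv α β * Dc (fun i => f (K.p i)) ≤ cTy ρ β * K.mv α β * (3 * a) := by gcongr
      _ ≤ _ := by nlinarith [mul_nonneg hm.le this]
  · have h1 : Bd (K.Eh α β) f (√a ^ 2) := by rwa [Real.sq_sqrt h.1]
    have h2 := osc_of_lam_le hr (fun f a h i j => h.Eh_corner hα0 hβ hg i j) Lam_le_Eh
      (Real.sqrt_nonneg _) hf h1 x (K.p (i + 1))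
    have h3 := sq_le_sq' (abs_le.1 h2).1 (abs_le.1 h2).2
    rwa [mul_pow, Real.sq_sqrt h.1] at h3
  · obtain ⟨ψ, h1, h2, h3, h4, h5⟩ := exists_potential hα0 hβ hg
    have h6 : Bd (K.Eh α β) ψ 8 := (bd_Eh hg).2 ⟨h1, by rwa [mul_comm]⟩
    obtain ⟨φ, e1, e2, e3⟩ := potential_rot (fm_Eh hα0 hβ hg) h1 h2 h3 h4 h6 i
    exact ⟨φ, e1, e2, fun n => e3.of_le (Lam_iterate_Eh_anti (Nat.zero_le n) φ)⟩

theorem Lin.E0_le (hα : 0 < α) (hβ : 0 < β) (hg : (K.GoodSet α β).Nonempty) (hf : K.Lin n f)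
    (h : Bd ((K.Lam α β)^[n] (K.Eh α β)) f a) : Bd ((K.Lam α β)^[n] K.E0) f (3 * a) := by
  induction n generalizing f a with
  | zero =>
    refine (bd_E0_of_linE hf).mono ?_
    have h : Bd (K.Eh α β) f a := h
    simp only [Dc]
    linarith [h.Eh_corner hα hβ hg 0 1, h.Eh_corner hα hβ hg 1 2, h.Eh_corner hα hβ hg 2 0]
  | succ n ih =>
    rw [Function.iterate_succ_apply'] at h ⊢
    obtain ⟨A, B, hA, hB, hAB⟩ := h.lam_inv hα hβ
    exact (Bd.lam hα.le hβ.le (fun i => ih (hf.1 i) (hA i)) (ih hf.2 hB)).mono (by nlinarith)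

/-- The constant in the uniform lower bound for the iterated energies. -/
noncomputable def cLow (ρ β : ℝ) : ℝ :=
  (1 + 3 * cTy ρ β) * Real.exp ((1 + 8 * 8 * (2 * (4 / (1 - ρ) ^ 2) ^ 2 *
    ((1 + 3 * cTy ρ β) + 1)) * β) * (1 - ρ)⁻¹)

theorem Bd.lam_iterate_Eh_corner {ρ : ℝ} (hr : Ratio ρ α β) (hα1 : 1 ≤ α) (hα : α ≤ 5 / 3)
    (hg : (K.GoodSet α β).Nonempty) (h : Bd ((K.Lam α β)^[n] (K.Eh α β)) f a) (i j : Fin 3) :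
    (f (K.p i) - f (K.p j)) ^ 2 ≤ cLow ρ β * (1 + 3 * 2 ^ (n + 1) / K.mv α β) * a := by
  have hα0 := hr.α_pos
  have hβ := hr.β_pos
  have hm : 0 < K.mv α β := zero_lt_one.trans_le (one_le_mv hg)
  have hc : 0 ≤ cTy ρ β := by unfold cTy; positivity
  obtain ⟨g, g1, g2, g3, g4, -, -⟩ := straighten hr hα1 (straight_Eh hr hα hg) n f a
    (h.lam_iterate_Eh_CC hα0 hβ) h
  have g5 := g4.mono (mul_le_mul_of_nonneg_right (cX_le hr.pos hr.lt hβ.le (by linarith)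
    (by positivity) (by norm_num) n) h.1)
  change Bd _ g (cLow ρ β * a) at g5
  set W := cLow ρ β * a with hW
  have g6 := g3.E0_le hα0 hβ hg g5
  have hW0 := g5.1
  have e1 : (K.Bop α β)^[n] (K.En α β) = K.En α β := by
    clear g3 g4 g5 g6 h
    induction n with
    | zero => rfl
    | succ n ih =>
      rw [Function.iterate_succ_apply', ih]
      exact En_eq.symm
  have e2 := Bop_iterate_le (K := K) (β := β) hα1 n (K.En α β) g
  rw [e1] at e2
  have e3 : (K.Lam α β)^[n] (K.En α β) g ≤
      ENNReal.ofReal (K.mv α β) * (K.Lam α β)^[n] (K.Eh α β) g := by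
    have := (Lam_monotone (K := K) (α := α) (β := β)).iterate n (En_le_Eh hg) g
    rwa [Lam_iterate_const_mul] at this
  have e4 : (2 : ℝ≥0∞) ^ (n + 1) = ENNReal.ofReal (2 ^ (n + 1)) := by
    rw [ENNReal.ofReal_pow (by norm_num), ENNReal.ofReal_ofNat]
  have e5 : Bd (K.En α β) g (2 ^ (n + 1) * (3 * W) + K.mv α β * W) := by
    refine ⟨by positivity, e2.trans ?_⟩
    rw [ENNReal.ofReal_add (by positivity) (by positivity),
      ENNReal.ofReal_mul (p := 2 ^ (n + 1)) (by positivity), ENNReal.ofReal_mul (p := K.mv α β) hm.le,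
      ← e4]
    gcongr
    · exact g6.2
    · exact e3.trans (mul_le_mul_right g5.2 _)
  have e6 := mv_mul_le hα0 hβ g1 e5 i j
  rw [g2, g2] at e6
  refine le_of_mul_le_mul_left (e6.trans (le_of_eq ?_)) hm
  rw [hW]
  field_simp
  ring

end Gasket
end AG

namespace AG

open scoped ENNReal

variable {X : Type*} {ι : Type*}

/-- The approximate recovery property of a family of functionals along an ultrafilter. -/
def GamP (U : Ultrafilter ι) (G : ι → Fnl X) (f : X → ℝ) (a : ℝ) : Prop :=
  ∀ P : Finset X, ∀ ε > 0, ∀ δ > 0, ∀ᶠ k in (U : Filter ι),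
    ∃ g : X → ℝ, (∀ x ∈ P, |g x - f x| ≤ ε) ∧ Gasket.Bd (G k) g (a + δ)

/-- The Gamma-limit of a family of functionals along an ultrafilter. -/
noncomputable def Gam (U : Ultrafilter ι) (G : ι → Fnl X) : Fnl X := fun f =>
  ⨅ a : {a : ℝ // 0 ≤ a ∧ GamP U G f a}, ENNReal.ofReal a

namespace Gasket

variable {U : Ultrafilter ι} {G G' : ι → Fnl X} {f g : X → ℝ} {a b : ℝ}

theorem bd_gam : Bd (Gam U G) f a ↔ 0 ≤ a ∧ GamP U G f a := by
  constructor
  · rintro ⟨h0, h⟩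
    refine ⟨h0, fun P ε hε δ hδ => ?_⟩
    have h1 : Gam U G f < ENNReal.ofReal (a + δ / 2) :=
      h.trans_lt ((ENNReal.ofReal_lt_ofReal_iff (by linarith)).2 (by linarith))
    obtain ⟨⟨b, hb, hb'⟩, hlt⟩ := iInf_lt_iff.1 h1
    have hlt' := (ENNReal.ofReal_lt_ofReal_iff (by linarith)).1 hlt
    filter_upwards [hb' P ε hε (δ / 2) (by linarith)] with k ⟨g, hg, hgb⟩
    exact ⟨g, hg, hgb.mono (by simp only at hlt'; linarith)⟩
  · rintro ⟨h0, h⟩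
    exact ⟨h0, iInf_le_of_le ⟨a, h0, h⟩ le_rfl⟩

open Classical in
/-- An ultrafilter on the finite subsets and precisions, finer than the order filter. -/
noncomputable def ultraP (X : Type*) : Ultrafilter (Finset X × ℕ) := Ultrafilter.of atTop

/-- The ultrafilter used to pass to diagonal nets. -/
noncomputable def netU (X : Type*) (U : Ultrafilter ι) : Ultrafilter ((Finset X × ℕ) × ι) :=
  Ultrafilter.bind (ultraP X) fun p => U.map (Prod.mk p)

theorem eventually_netU {p : (Finset X × ℕ) × ι → Prop} :
    (∀ᶠ j in (netU X U : Filter ((Finset X × ℕ) × ι)), p j) ↔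
      ∀ᶠ q in (ultraP X : Filter (Finset X × ℕ)), ∀ᶠ k in (U : Filter ι), p (q, k) := Iff.rfl

theorem eventually_netU_snd {p : ι → Prop} (h : ∀ᶠ k in (U : Filter ι), p k) :
    ∀ᶠ j in (netU X U : Filter ((Finset X × ℕ) × ι)), p j.2 :=
  eventually_netU.2 (Eventually.of_forall fun _ => h)

theorem eventually_netU_fst (P : Finset X) {ε : ℝ} (hε : 0 < ε) :
    ∀ᶠ j in (netU X U : Filter ((Finset X × ℕ) × ι)), P ⊆ j.1.1 ∧ 1 / ((j.1.2 : ℝ) + 1) ≤ ε := by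
  refine eventually_netU.2 ?_
  have h : ∀ᶠ q in (ultraP X : Filter (Finset X × ℕ)), P ⊆ q.1 ∧ 1 / ((q.2 : ℝ) + 1) ≤ ε := by
    classical
    refine Ultrafilter.of_le _ ?_
    obtain ⟨n, hn⟩ := exists_nat_one_div_lt hε
    filter_upwards [eventually_ge_atTop (P, n)] with q hq
    refine ⟨hq.1, le_trans ?_ hn.le⟩
    have : (n : ℝ) ≤ q.2 := by exact_mod_cast hq.2
    gcongr
  filter_upwards [h] with q hq
  exact Eventually.of_forall fun _ => hq

theorem Bd.gam_net (h : Bd (Gam U G) f a) : ∃ u : (Finset X × ℕ) × ι → X → ℝ,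
    Tendsto u (netU X U) (𝓝 f) ∧ ∀ δ > 0, ∀ᶠ j in (netU X U : Filter ((Finset X × ℕ) × ι)), Bd (G j.2) (u j) (a + δ) := by
  have h1 := (bd_gam.1 h).2
  have h2 : ∀ j : (Finset X × ℕ) × ι, ∃ v : X → ℝ, (∃ g : X → ℝ, (∀ x ∈ j.1.1, |g x - f x| ≤
      1 / ((j.1.2 : ℝ) + 1)) ∧ Bd (G j.2) g (a + 1 / ((j.1.2 : ℝ) + 1))) →
      (∀ x ∈ j.1.1, |v x - f x| ≤ 1 / ((j.1.2 : ℝ) + 1)) ∧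
        Bd (G j.2) v (a + 1 / ((j.1.2 : ℝ) + 1)) := by
    intro j
    by_cases h : ∃ g : X → ℝ, (∀ x ∈ j.1.1, |g x - f x| ≤
      1 / ((j.1.2 : ℝ) + 1)) ∧ Bd (G j.2) g (a + 1 / ((j.1.2 : ℝ) + 1))
    · exact h.imp fun g hg _ => hg
    · exact ⟨f, fun h' => absurd h' h⟩
  choose u hu using h2
  have h3 : ∀ᶠ j in (netU X U : Filter ((Finset X × ℕ) × ι)), (∀ x ∈ j.1.1, |u j x - f x| ≤ 1 / ((j.1.2 : ℝ) + 1)) ∧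
        Bd (G j.2) (u j) (a + 1 / ((j.1.2 : ℝ) + 1)) := by
    refine eventually_netU.2 (Eventually.of_forall fun q => ?_)
    filter_upwards [h1 q.1 (1 / ((q.2 : ℝ) + 1)) (by positivity) (1 / ((q.2 : ℝ) + 1))
      (by positivity)] with k hk
    exact hu (q, k) hk
  refine ⟨u, tendsto_pi_nhds.2 fun x => Metric.tendsto_nhds.2 fun ε hε => ?_, fun δ hδ => ?_⟩
  · filter_upwards [h3, eventually_netU_fst {x} (half_pos hε)] with j hj hj'
    rw [Real.dist_eq]
    linarith [hj.1 x (by simpa using hj'.1)]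
  · filter_upwards [h3, eventually_netU_fst ∅ hδ] with j hj hj'
    exact hj.2.mono (by linarith)

theorem bd_gam_of_net {u : (Finset X × ℕ) × ι → X → ℝ} (hu : Tendsto u (netU X U) (𝓝 f))
    (ha : 0 ≤ a) (h : ∀ δ > 0, ∀ᶠ j in (netU X U : Filter ((Finset X × ℕ) × ι)), Bd (G j.2) (u j) (a + δ)) :
    Bd (Gam U G) f a := by
  refine bd_gam.2 ⟨ha, fun P ε hε δ hδ => ?_⟩
  have h1 : ∀ᶠ j in (netU X U : Filter ((Finset X × ℕ) × ι)), ∀ x ∈ P, |u j x - f x| ≤ ε := by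
    rw [eventually_all_finset]
    intro x _
    filter_upwards [Metric.tendsto_nhds.1 (tendsto_pi_nhds.1 hu x) ε hε] with j hj
    rw [Real.dist_eq] at hj
    exact hj.le
  obtain ⟨q, hq⟩ := (eventually_netU.1 (h1.and (h δ hδ))).exists
  filter_upwards [hq] with k hk
  exact ⟨_, hk⟩

theorem exists_ulim_real {κ : Type*} (V : Ultrafilter κ) (A : κ → ℝ) {m M : ℝ}
    (h : ∀ᶠ j in (V : Filter κ), m ≤ A j ∧ A j ≤ M) :
    ∃ L, m ≤ L ∧ L ≤ M ∧ Tendsto A V (𝓝 L) := by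
  obtain ⟨L, hL, hL'⟩ := isCompact_Icc.ultrafilter_le_nhds' (V.map A) h
  exact ⟨L, hL.1, hL.2, hL'⟩

theorem bd_gam_lim {u : (Finset X × ℕ) × ι → X → ℝ} (hu : Tendsto u (netU X U) (𝓝 f))
    {A : (Finset X × ℕ) × ι → ℝ} {L : ℝ} (hA : Tendsto A (netU X U) (𝓝 L))
    (h : ∀ᶠ j in (netU X U : Filter ((Finset X × ℕ) × ι)), Bd (G j.2) (u j) (A j)) : Bd (Gam U G) f L := by
  refine bd_gam_of_net hu (ge_of_tendsto hA (h.mono fun j hj => hj.1)) fun δ hδ => ?_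
  filter_upwards [h, hA.eventually (ge_mem_nhds (show L < L + δ by linarith))] with j hj hj'
  exact hj.mono hj'

theorem Bd.gam_mono (h : Bd (Gam U G) f a) (hG : ∀ᶠ k in (U : Filter ι), G' k ≤ G k) :
    Bd (Gam U G') f a := by
  obtain ⟨h0, h1⟩ := bd_gam.1 h
  refine bd_gam.2 ⟨h0, fun P ε hε δ hδ => ?_⟩
  filter_upwards [h1 P ε hε δ hδ, hG] with k ⟨g, hg, hb⟩ hk
  exact ⟨g, hg, hb.of_le (hk g)⟩

theorem Bd.gam_sq_le (h : Bd (Gam U G) f a) {c : ℝ} (x y : X) (hc : 0 ≤ c)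
    (hG : ∀ᶠ k in (U : Filter ι), ∀ g b, Bd (G k) g b → (g x - g y) ^ 2 ≤ c * b) :
    (f x - f y) ^ 2 ≤ c * a := by
  obtain ⟨u, hu, hb⟩ := h.gam_net
  have h1 : Tendsto (fun j => (u j x - u j y) ^ 2) (netU X U) (𝓝 ((f x - f y) ^ 2)) :=
    ((tendsto_pi_nhds.1 hu x).sub (tendsto_pi_nhds.1 hu y)).pow 2
  have h2 : ∀ δ > 0, (f x - f y) ^ 2 ≤ c * (a + δ) := fun δ hδ => by
    refine le_of_tendsto h1 ?_
    filter_upwards [hb δ hδ, eventually_netU_snd hG] with j hj hj'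
    exact hj' _ _ hj
  refine le_of_forall_pos_le_add fun ε hε => (h2 (ε / (c + 1)) (by positivity)).trans ?_
  rw [mul_add]
  gcongr
  rw [mul_div_assoc', div_le_iff₀ (by linarith)]
  nlinarith

/-- Stability of bounds under pointwise limits. -/
theorem Bd.gam_lim {κ : Type*} {L : Filter κ} [L.NeBot] {u : κ → X → ℝ} (hu : Tendsto u L (𝓝 f))
    (h : ∀ᶠ j in L, Bd (Gam U G) (u j) a) : Bd (Gam U G) f a := by
  refine bd_gam.2 ⟨(h.exists.choose_spec).1, fun P ε hε δ hδ => ?_⟩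
  have h1 : ∀ᶠ j in L, ∀ x ∈ P, |u j x - f x| ≤ ε / 2 := by
    rw [eventually_all_finset]
    intro x _
    filter_upwards [Metric.tendsto_nhds.1 (tendsto_pi_nhds.1 hu x) _ (half_pos hε)] with j hj
    rw [Real.dist_eq] at hj
    exact hj.le
  obtain ⟨j, hj, hj'⟩ := (h1.and h).exists
  filter_upwards [(bd_gam.1 hj').2 P (ε / 2) (half_pos hε) δ hδ] with k ⟨g, hg, hb⟩
  refine ⟨g, fun x hx => ?_, hb⟩
  have := abs_sub_le (g x) (u j x) (f x)
  linarith [hg x hx, hj x hx]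

variable {K : Gasket X}

theorem fm_gam (hG : ∀ᶠ k in (U : Filter ι), K.Fm (G k)) : K.Fm (Gam U G) where
  smul c f a h := by
    obtain ⟨u, hu, hb⟩ := h.gam_net
    refine bd_gam_of_net (u := fun j => c • u j) (hu.const_smul c) (mul_nonneg (sq_nonneg c) h.1)
      fun δ hδ => ?_
    filter_upwards [hb (δ / (c ^ 2 + 1)) (by positivity), eventually_netU_snd hG] with j hj hF
    refine (hF.smul c _ _ hj).mono ?_
    rw [mul_add]
    gcongr
    rw [mul_div_assoc', div_le_iff₀ (by positivity)]
    nlinarith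
  add f g a b ε hε h h' := by
    obtain ⟨u, hu, hb⟩ := h.gam_net
    obtain ⟨v, hv, hb'⟩ := h'.gam_net
    have ha := h.1
    have hb0 := h'.1
    refine bd_gam_of_net (u := fun j => u j + v j) (hu.add hv) (by positivity) fun δ hδ => ?_
    set M := (1 + ε) + (1 + 1 / ε) with hM
    have hM0 : 0 < M := by positivity
    filter_upwards [hb (δ / M) (by positivity), hb' (δ / M) (by positivity),
      eventually_netU_snd hG] with j hj hj' hF
    refine (hF.add _ _ _ _ ε hε hj hj').mono (le_of_eq ?_)
    have : M * (δ / M) = δ := by field_simp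
    rw [hM, add_mul, ← hM] at this
    linarith
  lip f a φ hφ h := by
    obtain ⟨u, hu, hb⟩ := h.gam_net
    have hc : Continuous φ := by
      refine (LipschitzWith.of_dist_le_mul (K := 1) fun x y => ?_).continuous
      simpa [Real.dist_eq] using hφ x y
    refine bd_gam_of_net (u := fun j => φ ∘ u j) (tendsto_pi_nhds.2 fun x =>
      (hc.tendsto _).comp (tendsto_pi_nhds.1 hu x)) h.1 fun δ hδ => ?_
    filter_upwards [hb δ hδ, eventually_netU_snd hG] with j hj hF
    exact hF.lip _ _ _ hφ hj
  rot f a h := by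
    obtain ⟨u, hu, hb⟩ := h.gam_net
    refine bd_gam_of_net (u := fun j => u j ∘ K.rot) (tendsto_pi_nhds.2 fun x =>
      tendsto_pi_nhds.1 hu _) h.1 fun δ hδ => ?_
    filter_upwards [hb δ hδ, eventually_netU_snd hG] with j hj hF
    exact hF.rot _ _ hj

/-- The parallelogram inequality in terms of bounds. -/
def PgB (F : Fnl X) : Prop := ∀ f g a b, Bd F f a → Bd F g b →
  ∃ a' b', Bd F (f + g) a' ∧ Bd F (f - g) b' ∧ a' + b' ≤ 2 * a + 2 * b

theorem Pg.pgB {F : Fnl X} (h : Pg F) : PgB F := by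
  intro f g a b ha hb
  have ha0 := ha.1
  have hb0 := hb.1
  have h2 : F (f + g) + F (f - g) ≤ ENNReal.ofReal (2 * a + 2 * b) := by
    refine (h f g).trans ?_
    rw [ENNReal.ofReal_add (by positivity) (by positivity), ENNReal.ofReal_mul zero_le_two,
      ENNReal.ofReal_mul zero_le_two, ENNReal.ofReal_ofNat]
    gcongr
    · exact ha.2
    · exact hb.2
  have e1 : F (f + g) ≠ ∞ := ne_top_of_le_ne_top ENNReal.ofReal_ne_top (le_self_add.trans h2)
  have e2 : F (f - g) ≠ ∞ := ne_top_of_le_ne_top ENNReal.ofReal_ne_top (le_add_self.trans h2)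
  refine ⟨_, _, bd_toReal e1, bd_toReal e2, ?_⟩
  rw [← ENNReal.toReal_add e1 e2]
  exact ENNReal.toReal_le_of_le_ofReal (by positivity) h2

theorem pgB_gam (hG : ∀ᶠ k in (U : Filter ι), PgB (G k)) : PgB (Gam U G) := by
  intro f g a b ha hb
  obtain ⟨u, hu, hub⟩ := ha.gam_net
  obtain ⟨v, hv, hvb⟩ := hb.gam_net
  have h1 : ∀ j : (Finset X × ℕ) × ι, ∃ A B : ℝ, ∀ a b, PgB (G j.2) → Bd (G j.2) (u j) a →
      Bd (G j.2) (v j) b → Bd (G j.2) (u j + v j) A ∧ Bd (G j.2) (u j - v j) B ∧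
        A + B ≤ 2 * a + 2 * b := by
    intro j
    refine ⟨(G j.2 (u j + v j)).toReal, (G j.2 (u j - v j)).toReal, fun a b h h1 h2 => ?_⟩
    obtain ⟨a', b', e1, e2, e3⟩ := h _ _ _ _ h1 h2
    exact ⟨bd_toReal e1.ne_top, bd_toReal e2.ne_top,
      (add_le_add e1.toReal_le e2.toReal_le).trans e3⟩
  choose A B hAB using h1
  have h2 : ∀ δ > 0, ∀ᶠ j in (netU X U : Filter ((Finset X × ℕ) × ι)), Bd (G j.2) (u j + v j) (A j) ∧
      Bd (G j.2) (u j - v j) (B j) ∧ A j + B j ≤ 2 * (a + δ) + 2 * (b + δ) := fun δ hδ => by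
    filter_upwards [hub δ hδ, hvb δ hδ, eventually_netU_snd hG] with j e1 e2 e3
    exact hAB j _ _ e3 e1 e2
  obtain ⟨L, -, -, hL⟩ := exists_ulim_real (netU X U) A (m := 0) (M := 2 * (a + 1) + 2 * (b + 1)) (by
    filter_upwards [h2 1 one_pos] with j hj
    exact ⟨hj.1.1, by linarith [hj.2.1.1, hj.2.2]⟩)
  obtain ⟨M, -, -, hM⟩ := exists_ulim_real (netU X U) B (m := 0) (M := 2 * (a + 1) + 2 * (b + 1)) (by
    filter_upwards [h2 1 one_pos] with j hj
    exact ⟨hj.2.1.1, by linarith [hj.1.1, hj.2.2]⟩)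
  refine ⟨L, M, bd_gam_lim (hu.add hv) hL ((h2 1 one_pos).mono fun j hj => hj.1),
    bd_gam_lim (hu.sub hv) hM ((h2 1 one_pos).mono fun j hj => hj.2.1), ?_⟩
  refine le_of_forall_pos_le_add fun ε hε => le_of_tendsto (hL.add hM) ?_
  filter_upwards [h2 (ε / 4) (by positivity)] with j hj
  linarith [hj.2.2]

end Gasket
end AG

namespace AG

open scoped ENNReal

namespace Gasket

variable {X ι : Type*} {K : Gasket X} {U : Ultrafilter ι} {G : ι → Fnl X} {F : Fnl X}
  {f g : X → ℝ} {a c : ℝ} {α : ι → ℝ} {αs β : ℝ}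

theorem Bd.gam_lam (h : Bd (Gam U fun k => K.Lam (α k) β (G k)) f a)
    (hα : Tendsto α U (𝓝 αs)) (hαs : 0 < αs) (hβ : 0 < β) :
    Bd (K.Lam αs β (Gam U G)) f a := by
  obtain ⟨u, hu, hb⟩ := h.gam_net
  have h1 : ∀ j : (Finset X × ℕ) × ι, ∃ A : Fin 3 → ℝ, ∃ B : ℝ, ∀ b, 0 < α j.2 →
      Bd (K.Lam (α j.2) β (G j.2)) (u j) b → (∀ i, Bd (G j.2) (u j ∘ K.T i) (A i)) ∧
        Bd (G j.2) (u j ∘ K.S) B ∧ α j.2 * (A 0 + A 1 + A 2) + β * B ≤ b := by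
    intro j
    refine ⟨fun i => (G j.2 (u j ∘ K.T i)).toReal, (G j.2 (u j ∘ K.S)).toReal,
      fun b h0 hb => ?_⟩
    obtain ⟨A, B, hA, hB, hAB⟩ := hb.lam_inv h0 hβ
    refine ⟨fun i => bd_toReal (hA i).ne_top, bd_toReal hB.ne_top, le_trans ?_ hAB⟩
    have := (hA 0).toReal_le
    have := (hA 1).toReal_le
    have := (hA 2).toReal_le
    have := hB.toReal_le
    gcongr
  choose A B hAB using h1
  have hα' : ∀ᶠ j in (netU X U : Filter ((Finset X × ℕ) × ι)), αs / 2 < α j.2 :=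
    eventually_netU_snd (hα.eventually (lt_mem_nhds (by linarith)))
  have h2 : ∀ δ > 0, ∀ᶠ j in (netU X U : Filter ((Finset X × ℕ) × ι)), αs / 2 < α j.2 ∧
      (∀ i, Bd (G j.2) (u j ∘ K.T i) (A j i)) ∧ Bd (G j.2) (u j ∘ K.S) (B j) ∧
      α j.2 * (A j 0 + A j 1 + A j 2) + β * B j ≤ a + δ := fun δ hδ => by
    filter_upwards [hb δ hδ, hα'] with j hj h0
    exact ⟨h0, hAB j _ (by linarith) hj⟩
  have h3 : ∀ᶠ j in (netU X U : Filter ((Finset X × ℕ) × ι)),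
      (∀ i, 0 ≤ A j i ∧ A j i ≤ (a + 1) / (αs / 2)) ∧ 0 ≤ B j ∧ B j ≤ (a + 1) / β := by
    filter_upwards [h2 1 one_pos] with j ⟨h0, hA, hB, hj⟩
    have e0 := (hA 0).1
    have e1 := (hA 1).1
    have e2 := (hA 2).1
    have e3 := hB.1
    have e4 : αs / 2 * (A j 0 + A j 1 + A j 2) ≤ α j.2 * (A j 0 + A j 1 + A j 2) := by gcongr
    have e5 : 0 ≤ αs / 2 * (A j 0 + A j 1 + A j 2) := by positivity
    have e6 : 0 ≤ β * B j := by positivity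
    refine ⟨fun i => ⟨(hA i).1, ?_⟩, e3, ?_⟩
    · rw [le_div_iff₀ (by positivity)]
      have e7 : A j i ≤ A j 0 + A j 1 + A j 2 := by fin_cases i <;> simp <;> linarith
      have e8 : αs / 2 * A j i ≤ αs / 2 * (A j 0 + A j 1 + A j 2) := by gcongr
      linarith
    · rw [le_div_iff₀ hβ]
      linarith
  have h4 : ∀ i, ∃ L, Tendsto (fun j => A j i) (netU X U) (𝓝 L) := fun i =>
    (exists_ulim_real (netU X U) (fun j => A j i) (h3.mono fun j hj => hj.1 i)).imp
      fun L hL => hL.2.2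
  choose L hL using h4
  obtain ⟨M, -, -, hM⟩ := exists_ulim_real (netU X U) B (h3.mono fun j hj => hj.2)
  have h5 : ∀ i, Bd (Gam U G) (f ∘ K.T i) (L i) := fun i =>
    bd_gam_lim (tendsto_pi_nhds.2 fun x => tendsto_pi_nhds.1 hu (K.T i x)) (hL i)
      ((h2 1 one_pos).mono fun j hj => hj.2.1 i)
  have h6 : Bd (Gam U G) (f ∘ K.S) M :=
    bd_gam_lim (tendsto_pi_nhds.2 fun x => tendsto_pi_nhds.1 hu (K.S x)) hM
      ((h2 1 one_pos).mono fun j hj => hj.2.2.1)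
  refine (Bd.lam hαs.le hβ.le h5 h6).mono (le_of_forall_pos_le_add fun δ hδ => ?_)
  have hα2 : Tendsto (fun j : (Finset X × ℕ) × ι => α j.2) (netU X U) (𝓝 αs) := fun s hs =>
    eventually_netU_snd (hα.eventually hs)
  exact le_of_tendsto ((hα2.mul (((hL 0).add (hL 1)).add (hL 2))).add (hM.const_mul β))
    ((h2 δ hδ).mono fun j hj => hj.2.2.2)

/-- Functions with corner values `0` and `1` and energy at most `c`. -/
def Pot (K : Gasket X) (F : Fnl X) (c : ℝ) : Prop := ∀ i, ∃ ψ : X → ℝ,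
  (∀ j, ψ (K.p j) = if j = i then 1 else 0) ∧ (∀ x, |ψ x| ≤ 1) ∧ Bd F ψ c

theorem Pot.correct (hψ : K.Pot F c) (hF : K.Fm F) (hg : Bd F g a) {v : Fin 3 → ℝ} {η : ℝ}
    (hη : 0 < η) (hη1 : η ≤ 1) (hv : ∀ i, |v i - g (K.p i)| ≤ η) :
    ∃ g' : X → ℝ, (∀ i, g' (K.p i) = v i) ∧ (∀ x, |g' x - g x| ≤ 3 * η) ∧
      Bd F g' (a + η * (a + 24 * c)) := by
  choose ψ h1 h2 h3 using hψ
  have hc : 0 ≤ c := (h3 0).1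
  set d : Fin 3 → ℝ := fun i => v i - g (K.p i) with hd
  have h4 : ∀ i, Bd F (d i • ψ i) (η ^ 2 * c) := fun i => (hF.smul (d i) _ _ (h3 i)).mono (by
    have : d i ^ 2 ≤ η ^ 2 := sq_le_sq' (abs_le.1 (hv i)).1 (abs_le.1 (hv i)).2
    gcongr)
  refine ⟨g + (d 0 • ψ 0 + d 1 • ψ 1 + d 2 • ψ 2), fun i => ?_, fun x => ?_, ?_⟩
  · fin_cases i <;> simp [h1, hd]
  · have h5 : ∀ i, |d i * ψ i x| ≤ η := fun i => by
      rw [abs_mul]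
      calc |d i| * |ψ i x| ≤ η * 1 := mul_le_mul (hv i) (h2 i x) (abs_nonneg _) hη.le
        _ = η := mul_one η
    have h6 : (g + (d 0 • ψ 0 + d 1 • ψ 1 + d 2 • ψ 2)) x - g x =
      d 0 * ψ 0 x + d 1 * ψ 1 x + d 2 * ψ 2 x := by simp
    rw [h6]
    refine (abs_add_three _ _ _).trans ?_
    linarith [h5 0, h5 1, h5 2]
  · refine (hF.add _ _ _ _ η hη hg (hF.add_two (hF.add_two (h4 0) (h4 1)) (h4 2))).mono ?_
    have h7 : (1 + 1 / η) * (2 * (2 * (η ^ 2 * c) + 2 * (η ^ 2 * c)) + 2 * (η ^ 2 * c)) =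
        10 * c * (η ^ 2 + η) := by field_simp; ring
    rw [h7]
    have h8 : η ^ 2 ≤ η := by nlinarith
    have h9 : 10 * c * (η ^ 2 + η) ≤ 10 * c * (η + η) := by gcongr
    have h10 : 0 ≤ η * c := by positivity
    nlinarith

theorem bd_gam_lam (h : Bd (K.Lam αs β (Gam U G)) f a)
    (hα : Tendsto α U (𝓝 αs)) (hαs : 0 < αs) (hβ : 0 < β)
    (hG : ∀ᶠ k in (U : Filter ι), K.Fm (G k)) (hψ : ∀ᶠ k in (U : Filter ι), K.Pot (G k) c) :
    Bd (Gam U fun k => K.Lam (α k) β (G k)) f a := by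
  classical
  obtain ⟨A, B, hA, hB, hAB⟩ := h.lam_inv hαs hβ
  refine bd_gam.2 ⟨h.1, fun P ε hε δ hδ => ?_⟩
  have hc : 0 ≤ c := by
    obtain ⟨k, hk⟩ := hψ.exists
    obtain ⟨ψ, -, -, h⟩ := hk 0
    exact h.1
  have hA0 : ∀ i, 0 ≤ A i := fun i => (hA i).1
  have hB0 := hB.1
  let Z : ℝ → ℝ → ℝ := fun η a => a + 5 * η * (a + 2 + 24 * c)
  have hη : ∃ η : ℝ, 0 < η ∧ 16 * η < ε ∧ 5 * η < 1 ∧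
      (αs + η) * (Z η (A 0) + Z η (A 1) + Z η (A 2)) + β * Z η B < a + δ := by
    have e1 : ∀ᶠ η in 𝓝 (0 : ℝ), 16 * η < ε :=
      ContinuousAt.eventually_lt (by fun_prop) (by fun_prop) (by simpa using hε)
    have e2 : ∀ᶠ η in 𝓝 (0 : ℝ), 5 * η < 1 :=
      ContinuousAt.eventually_lt (by fun_prop) (by fun_prop) (by norm_num)
    have e3 : ∀ᶠ η in 𝓝 (0 : ℝ),
        (αs + η) * (Z η (A 0) + Z η (A 1) + Z η (A 2)) + β * Z η B < a + δ :=
      ContinuousAt.eventually_lt (by fun_prop) (by fun_prop) (by simp [Z]; linarith)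
    have e4 : ∀ᶠ η in 𝓝[>] (0 : ℝ), 0 < η := self_mem_nhdsWithin
    obtain ⟨η, h1, h2, h3, h4⟩ := (e4.and (nhdsWithin_le_nhds (e1.and (e2.and e3)))).exists
    exact ⟨η, h1, h2, h3, h4⟩
  obtain ⟨η, h0, h1, h2, h3⟩ := hη
  have hT : ∀ᶠ k in (U : Filter ι), ∀ i, ∃ g : X → ℝ,
      (∀ x ∈ P.preimage (K.T i) (K.T_inj i).injOn ∪ {K.q i, K.p 0, K.p 1, K.p 2},
        |g x - (f ∘ K.T i) x| ≤ η) ∧ Bd (G k) g (A i + η) :=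
    eventually_all.2 fun i => (bd_gam.1 (hA i)).2 _ η h0 η h0
  have hS := (bd_gam.1 hB).2 (P.preimage K.S K.S_inj.injOn ∪ {K.p 0, K.p 1, K.p 2}) η h0 η h0
  filter_upwards [hT, hS, hG, hψ, hα.eventually (ge_mem_nhds (show αs < αs + η by linarith)),
    hα.eventually (lt_mem_nhds hαs)] with k hkT ⟨w, hw, hwb⟩ hF hψ hk hk0
  choose g hg hgb using hkT
  have h4 : ∀ i, ∃ g' : X → ℝ, (∀ j, g' (K.p j) = f (K.T i (K.p j))) ∧
      (∀ x, |g' x - g i x| ≤ 3 * η) ∧ Bd (G k) g' (A i + η + η * (A i + η + 24 * c)) := by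
    intro i
    refine hψ.correct hF (hgb i) h0 (by linarith) fun j => ?_
    rw [abs_sub_comm]
    refine hg i (K.p j) (Finset.mem_union_right _ ?_)
    fin_cases j <;> simp
  choose g' h5 h6 h7 using h4
  have h8 : ∃ w' : X → ℝ, (∀ j, w' (K.p j) = g' j (K.q j)) ∧
      (∀ x, |w' x - w x| ≤ 3 * (5 * η)) ∧ Bd (G k) w' (B + η + 5 * η * (B + η + 24 * c)) := by
    refine hψ.correct hF hwb (by linarith) (by linarith) fun j => ?_
    have e1 := hw (K.p j) (Finset.mem_union_right _ (by fin_cases j <;> simp))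
    have e2 := hg j (K.q j) (Finset.mem_union_right _ (by simp))
    have e3 := h6 j (K.q j)
    simp only [Function.comp, K.S_p] at e1 e2
    rw [abs_le] at *
    constructor <;> linarith [e1.1, e1.2, e2.1, e2.2, e3.1, e3.2]
  obtain ⟨w', h9, h10, h11⟩ := h8
  have hcomp : K.Compat g' w' := ⟨fun i j => by rw [h5, h5, K.T_cross], h9⟩
  refine ⟨K.glue g' w', fun x hx => ?_, ?_⟩
  · rcases K.cover x with ⟨i, y, rfl⟩ | ⟨y, rfl⟩
    · rw [glue_T_apply hcomp]
      have e1 := hg i y (Finset.mem_union_left _ (Finset.mem_preimage.2 hx))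
      have e2 := h6 i y
      simp only [Function.comp] at e1
      rw [abs_le] at *
      constructor <;> linarith [e1.1, e1.2, e2.1, e2.2]
    · have e0 := congrFun (glue_S hcomp) y
      simp only [Function.comp] at e0
      rw [e0]
      have e1 := hw y (Finset.mem_union_left _ (Finset.mem_preimage.2 hx))
      have e2 := h10 y
      simp only [Function.comp] at e1
      rw [abs_le] at *
      constructor <;> linarith [e1.1, e1.2, e2.1, e2.2]
  · have h12 : ∀ i, Bd (G k) (K.glue g' w' ∘ K.T i) (Z η (A i)) := fun i => by
      rw [glue_T hcomp]
      refine (h7 i).mono ?_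
      have := hA0 i
      have e1 : η * η ≤ η * 1 := by gcongr; linarith
      have e2 : 0 ≤ η * A i := by positivity
      have e3 : 0 ≤ η * c := by positivity
      simp only [Z]
      nlinarith
    have h13 : Bd (G k) (K.glue g' w' ∘ K.S) (Z η B) := by
      rw [glue_S hcomp]
      refine h11.mono ?_
      have e1 : η * η ≤ η * 1 := by gcongr; linarith
      simp only [Z]
      nlinarith
    refine (Bd.lam hk0.le hβ.le h12 h13).mono (le_trans ?_ h3.le)
    have := (h12 0).1
    have := (h12 1).1
    have := (h12 2).1
    gcongr

end Gasket
end AG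

namespace AG

open scoped ENNReal

namespace Gasket

variable {X ι : Type*} {K : Gasket X} {U : Ultrafilter ι} {G : ι → Fnl X} {F H : Fnl X}
  {f g : X → ℝ} {a c : ℝ} {α β : ℝ} {n : ℕ}

theorem fnl_le (h : ∀ f a, Bd F f a → Bd H f a) : H ≤ F := fun f => by
  by_cases hF : F f = ∞
  · rw [hF]
    exact le_top
  · have := (h f _ (bd_toReal hF)).2
    rwa [ENNReal.ofReal_toReal hF] at this

theorem Pot.gam (h : ∀ᶠ k in (U : Filter ι), K.Pot (G k) c) : K.Pot (Gam U G) c := by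
  intro i
  have h1 : ∀ k, ∃ ψ : X → ℝ, K.Pot (G k) c → (∀ j, ψ (K.p j) = if j = i then 1 else 0) ∧
      (∀ x, |ψ x| ≤ 1) ∧ Bd (G k) ψ c := fun k => by
    by_cases hk : K.Pot (G k) c
    · exact (hk i).imp fun ψ hψ _ => hψ
    · exact ⟨0, fun h => absurd h hk⟩
  choose ψ hψ using h1
  obtain ⟨χ, hχ⟩ := exists_ulim U ψ 1 (h.mono fun k hk => (hψ k hk).2.1)
  have hχ' := tendsto_pi_nhds.1 hχ
  refine ⟨χ, fun j => tendsto_nhds_unique (hχ' (K.p j))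
    (tendsto_const_nhds.congr' (h.mono fun k hk => ((hψ k hk).1 j).symm)),
    fun x => le_of_tendsto (hχ' x).abs (h.mono fun k hk => (hψ k hk).2.1 x), bd_gam.2 ⟨?_, ?_⟩⟩
  · obtain ⟨k, hk⟩ := h.exists
    exact (hψ k hk).2.2.1
  · intro P ε hε δ hδ
    have h2 : ∀ᶠ k in (U : Filter ι), ∀ x ∈ P, |ψ k x - χ x| ≤ ε := by
      rw [eventually_all_finset]
      intro x _
      filter_upwards [Metric.tendsto_nhds.1 (hχ' x) ε hε] with k hk
      rw [Real.dist_eq] at hk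
      exact hk.le
    filter_upwards [h2, h] with k hk hk'
    exact ⟨ψ k, hk, (hψ k hk').2.2.mono (by linarith)⟩

theorem Pot.of_le (h : K.Pot F c) (hle : H ≤ F) : K.Pot H c := fun i =>
  (h i).imp fun _ hψ => ⟨hψ.1, hψ.2.1, hψ.2.2.of_le (hle _)⟩

theorem pot_Eh (hα : 0 < α) (hβ : 0 < β) (hg : (K.GoodSet α β).Nonempty) :
    K.Pot (K.Eh α β) 8 := fun i => by
  have hF := fm_Eh hα hβ hg
  obtain ⟨ψ, hψ, h0, h1, h2, h3⟩ := exists_potential hα hβ hg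
  have h4 : Bd (K.Eh α β) ψ 8 := (bd_Eh hg).2 ⟨hψ, by rwa [mul_comm]⟩
  obtain ⟨φ, -, hφ1, hφ2⟩ := potential_rot hF hψ h0 h1 h2 h4 i
  refine ⟨clamp 0 1 ∘ φ, fun j => ?_, fun x => ?_, hF.lip _ _ _ (clamp_lip 0 1) hφ2⟩
  · rw [Function.comp, hφ1]
    split_ifs <;> exact clamp_eq (by norm_num)
  · have := clamp_mem zero_le_one (φ x)
    exact abs_le.2 ⟨le_trans (by norm_num) this.1, this.2⟩

theorem pg_Eh : Pg (K.Eh α β) := fun f g => by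
  by_cases hf : K.CC f
  · by_cases hg : K.CC g
    · simp only [Eh, if_pos hf, if_pos hg, if_pos (hf.add hg), if_pos (hf.sub hg)]
      rw [← mul_add, mul_left_comm, mul_left_comm (2 : ℝ≥0∞), ← mul_add]
      exact mul_le_mul_right (pg_En f g) _
    · simp [Eh, hg]
  · simp [Eh, hf]

theorem Pg.lam_iterate (hF : Pg F) (n : ℕ) : Pg ((K.Lam α β)^[n] F) := by
  induction n with
  | zero => exact hF
  | succ n ih =>
    rw [Function.iterate_succ_apply']
    exact ih.lam

theorem Bd.lam_iterate_Eh_sq {ρ : ℝ} (hr : Ratio ρ α β) (hα1 : 1 ≤ α) (hα : α ≤ 5 / 3)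
    (hg : (K.GoodSet α β).Nonempty) (hm : 3 * 2 ^ (n + 1) ≤ K.mv α β) (x y : X)
    (h : Bd ((K.Lam α β)^[n] (K.Eh α β)) f a) :
    (f x - f y) ^ 2 ≤ (4 / (1 - ρ) ^ 2) ^ 2 * (2 * |cLow ρ β| + 1) * a := by
  set c := 2 * |cLow ρ β| + 1 with hc
  have hc0 : 0 < c := by positivity
  set D : Fnl X := (K.Lam α β)^[n] (K.Eh α β) with hD
  have hbd : ∀ {f a}, 0 ≤ a → (Bd (fun f => ENNReal.ofReal c * D f) f (c * a) ↔ Bd D f a) := by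
    intro f a ha
    have hc1 : ENNReal.ofReal c ≠ 0 := by simpa using hc0
    simp only [Bd, ENNReal.ofReal_mul hc0.le]
    rw [ENNReal.mul_le_mul_iff_right hc1 ENNReal.ofReal_ne_top]
    simp [ha, mul_nonneg hc0.le ha]
  have h1 := osc_of_lam_le (F := fun f => ENNReal.ofReal c * D f) hr
    (fun g b hb i j => ?_) ?_ (A := √(c * a)) (Real.sqrt_nonneg _)
    (h.lam_iterate_Eh_CC hr.α_pos hr.β_pos) ?_ x y
  · have h2 : (f x - f y) ^ 2 ≤ (4 / (1 - ρ) ^ 2 * √(c * a)) ^ 2 := by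
      rw [← sq_abs]
      gcongr
    rwa [mul_pow, Real.sq_sqrt (mul_nonneg hc0.le h.1), ← mul_assoc] at h2
  · have hb' : Bd D g (b / c) :=
      (hbd (div_nonneg hb.1 hc0.le)).1 (by rwa [mul_div_cancel₀ _ hc0.ne'])
    refine (hb'.lam_iterate_Eh_corner hr hα1 hα hg i j).trans ?_
    have hmp : 0 < K.mv α β := lt_of_lt_of_le (by positivity) hm
    have h3 : 3 * 2 ^ (n + 1) / K.mv α β ≤ 1 := (div_le_one hmp).2 hm
    have h30 : 0 ≤ 3 * 2 ^ (n + 1) / K.mv α β := by positivity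
    have h4 : cLow ρ β * (1 + 3 * 2 ^ (n + 1) / K.mv α β) ≤ c := by
      have : |cLow ρ β| * (1 + 3 * 2 ^ (n + 1) / K.mv α β) ≤ |cLow ρ β| * 2 := by
        gcongr
        linarith
      have h5 : cLow ρ β * (1 + 3 * 2 ^ (n + 1) / K.mv α β) ≤
        |cLow ρ β| * (1 + 3 * 2 ^ (n + 1) / K.mv α β) := by
        gcongr
        exact le_abs_self _
      linarith
    calc _ ≤ c * (b / c) := mul_le_mul_of_nonneg_right h4 hb'.1
      _ = b := mul_div_cancel₀ _ hc0.ne'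
  · rw [Lam_const_mul]
    intro f
    refine mul_le_mul_right ?_ (ENNReal.ofReal c)
    have := Lam_iterate_Eh_anti (K := K) (α := α) (β := β) n.le_succ
    simp only [Function.iterate_succ_apply'] at this
    exact this f
  · rw [Real.sq_sqrt (mul_nonneg hc0.le h.1)]
    exact (hbd h.1).2 h

/-- A self-similar functional with the properties of the energy of a resistance form. -/
structure Energy (K : Gasket X) (α β C : ℝ) (F : Fnl X) : Prop where
  fm : K.Fm F
  pgB : PgB F
  lam : K.Lam α β F = F
  lim : ∀ {u : ℕ → X → ℝ} {f a}, Tendsto u atTop (𝓝 f) → (∀ᶠ j in atTop, Bd F (u j) a) → Bd F f a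
  sq : ∀ {f a}, Bd F f a → ∀ x y, (f x - f y) ^ 2 ≤ C * a
  pot : K.Pot F 8
  nonneg : 0 ≤ C

theorem gam_shift {F : ℕ → Fnl X} {U : Ultrafilter ℕ} (hF : Antitone F) (hU : (U : Filter ℕ) ≤ atTop) :
    Gam U (fun j => F (j + 1)) = Gam U F := by
  refine le_antisymm (fnl_le fun f a h => h.gam_mono (Eventually.of_forall fun k => hF k.le_succ))
    (fnl_le fun f a h => ?_)
  obtain ⟨h0, h1⟩ := bd_gam.1 h
  refine bd_gam.2 ⟨h0, fun P ε hε δ hδ => ?_⟩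
  obtain ⟨j, g, hg, hb⟩ := (h1 P ε hε δ hδ).exists
  exact hU ((eventually_ge_atTop (j + 1)).mono fun k hk => ⟨g, hg, hb.of_le (hF hk g)⟩)

theorem lam_gam {α : ι → ℝ} {αs : ℝ} (hα : Tendsto α U (𝓝 αs)) (hαs : 0 < αs) (hβ : 0 < β)
    (hG : ∀ᶠ k in (U : Filter ι), K.Fm (G k)) (hψ : ∀ᶠ k in (U : Filter ι), K.Pot (G k) c) :
    K.Lam αs β (Gam U G) = Gam U fun k => K.Lam (α k) β (G k) :=
  le_antisymm (fnl_le fun _ _ h => h.gam_lam hα hαs hβ)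
    (fnl_le fun _ _ h => bd_gam_lam h hα hαs hβ hG hψ)

theorem exists_energy (K : Gasket X) (hβ : 1 < β) :
    ∃ α, 1 < α ∧ α ≤ 5 / 3 ∧ ∃ C F, K.Energy α β C F := by
  obtain ⟨α₀, ρ, h1, h2, hr, h3⟩ := exists_large K hβ
  choose α hα0 hα1 hg hm using h3
  set U : Ultrafilter ℕ := hyperfilter ℕ with hUdef
  have hU : (U : Filter ℕ) ≤ atTop := Nat.hyperfilter_le_atTop
  obtain ⟨αs, hs0, hs1, hs⟩ := exists_ulim_real U α (m := α₀) (M := 5 / 3)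
    (Eventually.of_forall fun k => ⟨hα0 k, hα1 k⟩)
  have hβ0 : 0 < β := by linarith
  have hαs0 : 0 < αs := by linarith
  have hα0' : ∀ k, 0 < α k := fun k => by linarith [hα0 k]
  let G : ℕ → ℕ → Fnl X := fun j k => (K.Lam (α k) β)^[j] (K.Eh (α k) β)
  have hGfm : ∀ j k, K.Fm (G j k) := fun j k =>
    (fm_Eh (hα0' k) hβ0 (hg k)).lam_iterate (hα0' k) hβ0 j
  have hGanti : ∀ k, Antitone fun j => G j k := fun k => Lam_iterate_Eh_anti
  have hGpot : ∀ j k, K.Pot (G j k) 8 := fun j k =>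
    (pot_Eh (hα0' k) hβ0 (hg k)).of_le (hGanti k (Nat.zero_le j))
  let F : ℕ → Fnl X := fun j => Gam U (G j)
  have hFfm : ∀ j, K.Fm (F j) := fun j => fm_gam (Eventually.of_forall (hGfm j))
  have hFpot : ∀ j, K.Pot (F j) 8 := fun j => Pot.gam (Eventually.of_forall (hGpot j))
  have hFpg : ∀ j, PgB (F j) := fun j =>
    pgB_gam (Eventually.of_forall fun k => (pg_Eh.lam_iterate j).pgB)
  have hFanti : Antitone F := fun i j hij =>
    fnl_le fun f a h => h.gam_mono (Eventually.of_forall fun k => hGanti k hij)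
  have hFlam : ∀ j, K.Lam αs β (F j) = F (j + 1) := fun j => by
    change K.Lam αs β (Gam U (G j)) = _
    rw [lam_gam hs hαs0 hβ0 (Eventually.of_forall (hGfm j)) (Eventually.of_forall (hGpot j))]
    change _ = Gam U (G (j + 1))
    congr 1
    funext k
    exact (Function.iterate_succ_apply' _ _ _).symm
  set C := (4 / (1 - ρ) ^ 2) ^ 2 * (2 * |cLow ρ β| + 1) with hC
  have hC0 : 0 ≤ C := by positivity
  have hFsq : ∀ j x y f a, Bd (F j) f a → (f x - f y) ^ 2 ≤ C * a := fun j x y f a h => by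
    refine h.gam_sq_le x y hC0 (hU ?_)
    filter_upwards [eventually_ge_atTop (3 * 2 ^ (j + 1))] with k hk g b hb
    refine hb.lam_iterate_Eh_sq (hr.mono (hα0 k)) (by linarith [hα0 k]) (hα1 k) (hg k) ?_ x y
    exact le_trans (by exact_mod_cast hk) (hm k).le
  refine ⟨αs, by linarith, hs1, C, Gam U F, fm_gam (Eventually.of_forall hFfm),
    pgB_gam (Eventually.of_forall hFpg), ?_, fun hu h => Bd.gam_lim hu h,
    fun h x y => h.gam_sq_le x y hC0 (Eventually.of_forall fun j g b hb => hFsq j x y g b hb),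
    Pot.gam (Eventually.of_forall hFpot), hC0⟩
  rw [lam_gam (α := fun _ => αs) tendsto_const_nhds hαs0 hβ0 (Eventually.of_forall hFfm)
    (Eventually.of_forall hFpot)]
  simp only [hFlam]
  exact gam_shift hFanti hU

end Gasket
end AG

namespace AG

open scoped ENNReal

namespace Gasket

variable {X : Type*} {K : Gasket X} {F : Fnl X} {f g : X → ℝ} {α β C : ℝ}

/-- The functions of finite energy. -/
def Dm (F : Fnl X) : Set (X → ℝ) := {f | F f ≠ ∞}

theorem Bd.dm {a : ℝ} (h : Bd F f a) : f ∈ Dm F := h.ne_top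

namespace Energy

variable (h : K.Energy α β C F)
include h

theorem zero : Bd F 0 0 := by
  obtain ⟨ψ, -, -, hψ⟩ := h.pot 0
  simpa using h.fm.smul 0 _ _ hψ

theorem const (c : ℝ) : Bd F (fun _ => c) 0 := by
  simpa using h.fm.const_add c h.zero

theorem dm_const (c : ℝ) : (fun _ => c) ∈ Dm F := (h.const c).dm

theorem dm_zero : (0 : X → ℝ) ∈ Dm F := h.zero.dm

theorem dm_add (hf : f ∈ Dm F) (hg : g ∈ Dm F) : f + g ∈ Dm F :=
  (h.fm.add_two (bd_toReal hf) (bd_toReal hg)).dm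

theorem dm_smul (c : ℝ) (hf : f ∈ Dm F) : c • f ∈ Dm F := (h.fm.smul c _ _ (bd_toReal hf)).dm

theorem dm_sub (hf : f ∈ Dm F) (hg : g ∈ Dm F) : f - g ∈ Dm F :=
  (h.fm.sub_two (bd_toReal hf) (bd_toReal hg)).dm

theorem dm_lip {φ : ℝ → ℝ} (hφ : ∀ x y, |φ x - φ y| ≤ |x - y|) (hf : f ∈ Dm F) : φ ∘ f ∈ Dm F :=
  (h.fm.lip _ _ φ hφ (bd_toReal hf)).dm

theorem dm_abs (hf : f ∈ Dm F) : (fun x => |f x|) ∈ Dm F :=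
  h.dm_lip (φ := fun t => |t|) abs_abs_sub_abs_le hf

theorem dm_min (hf : f ∈ Dm F) (hg : g ∈ Dm F) : (fun x => min (f x) (g x)) ∈ Dm F := by
  have h1 := h.dm_smul (1 / 2) (h.dm_sub (h.dm_add hf hg) (h.dm_abs (h.dm_sub hf hg)))
  convert h1 using 1
  funext x
  simp only [Pi.smul_apply, Pi.sub_apply, Pi.add_apply, smul_eq_mul]
  rcases le_total (f x) (g x) with hx | hx
  · rw [min_eq_left hx, abs_of_nonpos (by linarith)]
    ring
  · rw [min_eq_right hx, abs_of_nonneg (by linarith)]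
    ring

theorem dm_T (hα : 0 < α) (hβ : 0 < β) (hf : f ∈ Dm F) (i : Fin 3) : f ∘ K.T i ∈ Dm F := by
  have h1 := bd_toReal hf
  rw [← h.lam] at h1
  exact (h1.lam_T hα hβ i).dm

theorem dm_S (hα : 0 < α) (hβ : 0 < β) (hf : f ∈ Dm F) : f ∘ K.S ∈ Dm F := by
  have h1 := bd_toReal hf
  rw [← h.lam] at h1
  exact (h1.lam_S hα hβ).dm

theorem dm_glue (hα : 0 < α) (hβ : 0 < β) {f : Fin 3 → X → ℝ} (hc : K.Compat f g)
    (hf : ∀ i, f i ∈ Dm F) (hg : g ∈ Dm F) : K.glue f g ∈ Dm F := by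
  have h1 : Bd (K.Lam α β F) (K.glue f g) _ := Bd.lam (A := fun i => (F (f i)).toReal)
    (B := (F g).toReal) hα.le hβ.le
    (fun i => by rw [glue_T hc]; exact bd_toReal (hf i)) (by rw [glue_S hc]; exact bd_toReal hg)
  rw [h.lam] at h1
  exact h1.dm

theorem exists_corner (v : Fin 3 → ℝ) : ∃ f ∈ Dm F, ∀ i, f (K.p i) = v i := by
  choose ψ h1 _ h3 using h.pot
  refine ⟨v 0 • ψ 0 + v 1 • ψ 1 + v 2 • ψ 2, h.dm_add (h.dm_add (h.dm_smul _ (h3 0).dm)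
    (h.dm_smul _ (h3 1).dm)) (h.dm_smul _ (h3 2).dm), fun i => ?_⟩
  fin_cases i <;> simp [h1]

omit h in
theorem exists_not_near {x y : X} (hxy : x ≠ y) : ∃ n, ¬ Near K.T K.S n x y := by
  by_contra! hn
  exact hxy (K.near x y hn)

/-- Functions of finite energy concentrated near a corner. -/
theorem exists_bump (hα : 0 < α) (hβ : 0 < β) (j : Fin 3) (n : ℕ) :
    ∃ B ∈ Dm F, (∀ i, B (K.p i) = if i = j then 1 else 0) ∧ B (K.q j) = 0 ∧
      ∀ x, ¬ Near K.T K.S n x (K.p j) → B x = 0 := by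
  obtain ⟨l, hl, y, -, hy⟩ := K.edge_step j _ (K.q_edge j)
  induction n with
  | zero =>
    obtain ⟨ψ, h1, -, h3⟩ := h.pot j
    have hc : K.Compat (fun i => if i = j then ψ else 0) (ψ (K.q j) • ψ) := by
      refine ⟨fun a b => ?_, fun a => ?_⟩
      · by_cases ha : a = j <;> by_cases hb : b = j <;> simp [ha, hb, h1]
      · by_cases ha : a = j <;> simp [ha, h1]
    refine ⟨_, h.dm_glue hα hβ hc (fun i => ?_) (h.dm_smul _ h3.dm), fun i => ?_, ?_,
      fun x hx => absurd trivial hx⟩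
    · split_ifs
      exacts [h3.dm, h.dm_zero]
    · rw [glue_p hc]
      by_cases hi : i = j <;> simp [hi, h1]
    · have e1 := glue_T_apply hc l y
      rw [hy] at e1
      rw [e1]
      simp [hl]
  | succ n ih =>
    obtain ⟨B, hB, h1, h2, h3⟩ := ih
    have hc : K.Compat (fun i => if i = j then B else 0) 0 := by
      refine ⟨fun a b => ?_, fun a => ?_⟩
      · by_cases ha : a = j <;> by_cases hb : b = j <;> simp [ha, hb, h1]
      · by_cases ha : a = j <;> simp [ha, h2]
    refine ⟨_, h.dm_glue hα hβ hc (fun i => ?_) h.dm_zero, fun i => ?_, ?_, fun x hx => ?_⟩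
    · split_ifs
      exacts [hB, h.dm_zero]
    · rw [glue_p hc]
      by_cases hi : i = j <;> simp [hi, h1]
    · rw [← hy, glue_T_apply hc]
      simp [hl]
    · rcases K.cover x with ⟨i, z, rfl⟩ | ⟨z, rfl⟩
      · rw [glue_T_apply hc]
        by_cases hi : i = j
        · subst hi
          rw [if_pos rfl]
          exact h3 z fun hz => hx (Or.inl ⟨i, z, K.p i, hz, rfl, K.T_p i⟩)
        · simp [hi]
      · exact congrFun (glue_S hc) z

theorem exists_bump_ne (hα : 0 < α) (hβ : 0 < β) (j : Fin 3) {x : X} (hx : x ≠ K.p j) :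
    ∃ g ∈ Dm F, g (K.p j) = 0 ∧ g x = 1 := by
  obtain ⟨n, hn⟩ := exists_not_near (K := K) hx
  obtain ⟨B, hB, h1, -, h3⟩ := h.exists_bump hα hβ j n
  exact ⟨_, h.dm_sub (h.dm_const 1) hB, by simp [h1], by simp [h3 x hn]⟩

theorem exists_inner (hα : 0 < α) (hβ : 0 < β) (i : Fin 3) :
    ∃ χ ∈ Dm F, χ (K.q i) = 1 ∧ ∀ j, χ (K.p j) = 0 := by
  have h1 : ∀ j, ∃ B ∈ Dm F, (∀ m, B (K.p m) = if m = j then 1 else 0) ∧ B (K.q i) = 0 :=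
    fun j => by
      obtain ⟨n, hn⟩ := exists_not_near (K.q_ne i j)
      obtain ⟨B, hB, h1, -, h3⟩ := h.exists_bump hα hβ j n
      exact ⟨B, hB, h1, h3 _ hn⟩
  choose B hB h2 h3 using h1
  refine ⟨(fun _ => 1) - (B 0 + B 1 + B 2), h.dm_sub (h.dm_const 1)
    (h.dm_add (h.dm_add (hB 0) (hB 1)) (hB 2)), by simp [h3], fun j => ?_⟩
  fin_cases j <;> simp [h2]

theorem extend_T (hα : 0 < α) (hβ : 0 < β) (j : Fin 3) (hg : g ∈ Dm F) :
    ∃ f ∈ Dm F, f ∘ K.T j = g ∧ ∀ l ≠ j, g (K.p l) = 0 → f ∘ K.T l = 0 := by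
  obtain ⟨ψ, h1, -, h3⟩ := h.pot j
  set u : Fin 3 → X → ℝ := fun i => if i = j then g else g (K.p i) • ψ with hu
  obtain ⟨w, hw, hw'⟩ := h.exists_corner fun i => u i (K.q i)
  have hc : K.Compat u w := by
    refine ⟨fun a b => ?_, hw'⟩
    by_cases ha : a = j <;> by_cases hb : b = j <;> simp [hu, ha, hb, h1]
  refine ⟨_, h.dm_glue hα hβ hc (fun i => ?_) hw, ?_, fun l hl hl' => ?_⟩
  · simp only [hu]
    split_ifs
    exacts [hg, h.dm_smul _ h3.dm]
  · rw [glue_T hc]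
    simp [hu]
  · rw [glue_T hc]
    simp [hu, hl, hl']

theorem extend_S (hα : 0 < α) (hβ : 0 < β) (hg : g ∈ Dm F) :
    ∃ f ∈ Dm F, f ∘ K.S = g ∧ ∀ l, g (K.p l) = 0 → f ∘ K.T l = 0 := by
  choose χ h1 h2 h3 using h.exists_inner hα hβ
  have hc : K.Compat (fun i => g (K.p i) • χ i) g :=
    ⟨fun a b => by simp [h3], fun a => by simp [h2]⟩
  refine ⟨_, h.dm_glue hα hβ hc (fun i => h.dm_smul _ (h1 i)) hg, glue_S hc, fun l hl => ?_⟩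
  rw [glue_T hc]
  simp [hl]

theorem separate_cell (hα : 0 < α) (hβ : 0 < β) (l : Fin 3) (x : X) {y : X}
    (hy : ∀ z, K.T l z ≠ y) : ∃ f ∈ Dm F, f (K.T l x) ≠ f y := by
  rcases K.cover y with ⟨j, z, rfl⟩ | ⟨z, rfl⟩
  · have hjl : l ≠ j := fun e => hy z (by rw [e])
    obtain ⟨g, hg, h1, h2⟩ := h.exists_bump_ne hα hβ l (x := z)
      (fun e => hy (K.p j) (by rw [e, K.T_cross]))
    obtain ⟨f, hf, h3, h4⟩ := h.extend_T hα hβ j hg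
    refine ⟨f, hf, ?_⟩
    have e1 := congrFun h3 z
    have e2 := congrFun (h4 l hjl h1) x
    simp only [Function.comp] at e1 e2
    rw [e1, e2, h2]
    simp
  · obtain ⟨g, hg, h1, h2⟩ := h.exists_bump_ne hα hβ l (x := z)
      (fun e => hy (K.q l) (by rw [e, K.S_p]))
    obtain ⟨f, hf, h3, h4⟩ := h.extend_S hα hβ hg
    refine ⟨f, hf, ?_⟩
    have e1 := congrFun h3 z
    have e2 := congrFun (h4 l h1) x
    simp only [Function.comp] at e1 e2
    rw [e1, e2, h2]
    simp

theorem separate (hα : 0 < α) (hβ : 0 < β) {x y : X} (hxy : x ≠ y) :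
    ∃ f ∈ Dm F, f x ≠ f y := by
  obtain ⟨n, hn⟩ := exists_not_near (K := K) hxy
  clear hxy
  induction n generalizing x y with
  | zero => exact absurd trivial hn
  | succ n ih =>
    rcases K.cover x with ⟨i, x, rfl⟩ | ⟨x, rfl⟩
    · by_cases hy : ∃ y', K.T i y' = y
      · obtain ⟨y, rfl⟩ := hy
        obtain ⟨g, hg, hne⟩ := ih (x := x) (y := y)
          fun e => hn (Or.inl ⟨i, x, y, e, rfl, rfl⟩)
        obtain ⟨f, hf, rfl, -⟩ := h.extend_T hα hβ i hg
        exact ⟨f, hf, hne⟩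
      · exact h.separate_cell hα hβ i x fun z hz => hy ⟨z, hz⟩
    · by_cases hy : ∃ y', K.S y' = y
      · obtain ⟨y, rfl⟩ := hy
        obtain ⟨g, hg, hne⟩ := ih (x := x) (y := y)
          fun e => hn (Or.inr ⟨x, y, e, rfl, rfl⟩)
        obtain ⟨f, hf, rfl, -⟩ := h.extend_S hα hβ hg
        exact ⟨f, hf, hne⟩
      · obtain ⟨l, y, rfl⟩ := (K.cover y).resolve_right hy
        by_cases hx : ∃ z, K.T l z = K.S x
        · obtain ⟨z, hz⟩ := hx
          rw [← hz] at hn ⊢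
          obtain ⟨g, hg, hne⟩ := ih (x := z) (y := y)
            fun e => hn (Or.inl ⟨l, z, y, e, rfl, rfl⟩)
          obtain ⟨f, hf, rfl, -⟩ := h.extend_T hα hβ l hg
          exact ⟨f, hf, hne⟩
        · obtain ⟨f, hf, hne⟩ := h.separate_cell hα hβ l y (y := K.S x) fun z hz => hx ⟨z, hz⟩
          exact ⟨f, hf, hne.symm⟩

theorem exists_delta (hα : 0 < α) (hβ : 0 < β) (V : Finset X) (x : X) (hx : x ∉ V) :
    ∃ f ∈ Dm F, f x = 1 ∧ ∀ y ∈ V, f y = 0 := by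
  classical
  induction V using Finset.induction_on with
  | empty => exact ⟨_, h.dm_const 1, rfl, by simp⟩
  | insert y V _ ih =>
    rw [Finset.mem_insert, not_or] at hx
    obtain ⟨f, hf, h1, h2⟩ := ih hx.2
    obtain ⟨g, hg, hne⟩ := h.separate hα hβ hx.1
    have hne' : g x - g y ≠ 0 := sub_ne_zero.2 hne
    have hg' := h.dm_smul (g x - g y)⁻¹ (h.dm_sub hg (h.dm_const (g y)))
    refine ⟨_, h.dm_min (h.dm_abs hf) (h.dm_abs hg'), ?_, fun z hz => ?_⟩
    · simp [h1, hne']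
    · rcases Finset.mem_insert.1 hz with rfl | hz
      · simp
      · simp only [h2 z hz, abs_zero]
        exact min_eq_left (abs_nonneg _)

theorem exten (hα : 0 < α) (hβ : 0 < β) (V : Finset X) (u : X → ℝ) :
    ∃ f ∈ Dm F, ∀ x ∈ V, f x = u x := by
  classical
  induction V using Finset.induction_on with
  | empty => exact ⟨_, h.dm_zero, by simp⟩
  | insert y V hy ih =>
    obtain ⟨f, hf, h1⟩ := ih
    obtain ⟨g, hg, h2, h3⟩ := h.exists_delta hα hβ V y hy
    refine ⟨_, h.dm_add hf (h.dm_smul (u y - f y) hg), fun x hx => ?_⟩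
    rcases Finset.mem_insert.1 hx with rfl | hx
    · simp [h2]
    · simp [h3 x hx, h1 x hx]

end Energy
end Gasket
end AG

namespace AG

open scoped ENNReal

namespace Gasket

variable {X : Type*} {K : Gasket X} {F : Fnl X} {f g k : X → ℝ} {a α β C : ℝ}

/-- The bilinear form obtained from a functional by polarization. -/
noncomputable def polar (F : Fnl X) (f g : X → ℝ) : ℝ :=
  ((F (f + g)).toReal - (F (f - g)).toReal) / 4

namespace Energy

variable (h : K.Energy α β C F)
include h

theorem toReal_smul (c : ℝ) (hf : f ∈ Dm F) : (F (c • f)).toReal = c ^ 2 * (F f).toReal := by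
  refine le_antisymm (h.fm.smul c _ _ (bd_toReal hf)).toReal_le ?_
  by_cases hc : c = 0
  · simp [hc]
  · have h1 := (h.fm.smul c⁻¹ _ _ (bd_toReal (h.dm_smul c hf))).toReal_le
    rw [smul_smul, inv_mul_cancel₀ hc, one_smul, inv_pow] at h1
    rwa [← le_inv_mul_iff₀ (by positivity)]

theorem toReal_neg (f : X → ℝ) : (F (-f)).toReal = (F f).toReal := by
  have h1 : ∀ f : X → ℝ, F (-f) ≤ F f := fun f =>
    fnl_le (H := fun f => F (-f)) (fun f a hf => h.fm.neg hf) f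
  rw [le_antisymm (h1 f) (by simpa using h1 (-f))]

theorem toReal_sub_comm (f g : X → ℝ) : (F (f - g)).toReal = (F (g - f)).toReal := by
  rw [← h.toReal_neg, neg_sub]

theorem parallelogram (hf : f ∈ Dm F) (hg : g ∈ Dm F) :
    (F (f + g)).toReal + (F (f - g)).toReal = 2 * (F f).toReal + 2 * (F g).toReal := by
  have h1 : ∀ f g : X → ℝ, f ∈ Dm F → g ∈ Dm F →
      (F (f + g)).toReal + (F (f - g)).toReal ≤ 2 * (F f).toReal + 2 * (F g).toReal := by
    intro f g hf hg
    obtain ⟨a, b, ha, hb, hab⟩ := h.pgB _ _ _ _ (bd_toReal hf) (bd_toReal hg)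
    exact (add_le_add ha.toReal_le hb.toReal_le).trans hab
  refine le_antisymm (h1 f g hf hg) ?_
  have h2 := h1 _ _ (h.dm_add hf hg) (h.dm_sub hf hg)
  have e1 : f + g + (f - g) = (2 : ℝ) • f := by module
  have e2 : f + g - (f - g) = (2 : ℝ) • g := by module
  rw [e1, e2, h.toReal_smul 2 hf, h.toReal_smul 2 hg] at h2
  linarith

theorem polar_self (hf : f ∈ Dm F) : polar F f f = (F f).toReal := by
  rw [polar, sub_self, ← two_smul ℝ f, h.toReal_smul 2 hf, le_antisymm h.zero.toReal_le
    ENNReal.toReal_nonneg]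
  ring

theorem polar_comm (f g : X → ℝ) : polar F f g = polar F g f := by
  rw [polar, polar, add_comm, h.toReal_sub_comm]

theorem polar_add (hf : f ∈ Dm F) (hg : g ∈ Dm F) (hk : k ∈ Dm F) :
    polar F (f + g) k = polar F f k + polar F g k := by
  have p1 := h.parallelogram (h.dm_add hf hk) hg
  have p2 := h.parallelogram (h.dm_add hg hk) hf
  have p3 := h.parallelogram (h.dm_sub hf hk) hg
  have p4 := h.parallelogram (h.dm_sub hg hk) hf
  rw [show f + k + g = f + g + k by abel, show f + k - g = -(g - k - f) by abel,
    h.toReal_neg] at p1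
  rw [show g + k + f = f + g + k by abel, show g + k - f = -(f - k - g) by abel,
    h.toReal_neg] at p2
  rw [show f - k + g = f + g - k by abel] at p3
  rw [show g - k + f = f + g - k by abel] at p4
  simp only [polar]
  linarith

theorem abs_polar_le (hf : f ∈ Dm F) (hg : g ∈ Dm F) :
    |polar F f g| ≤ ((F f).toReal + (F g).toReal) / 2 := by
  have h1 := h.parallelogram hf hg
  have h2 : 0 ≤ (F (f + g)).toReal := ENNReal.toReal_nonneg
  have h3 : 0 ≤ (F (f - g)).toReal := ENNReal.toReal_nonneg
  rw [polar, abs_le]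
  constructor <;> linarith

theorem polar_smul (c : ℝ) (hf : f ∈ Dm F) (hg : g ∈ Dm F) :
    polar F (c • f) g = c * polar F f g := by
  let φ : ℝ →+ ℝ := AddMonoidHom.mk' (fun c => polar F (c • f) g) fun a b => by
    rw [add_smul, h.polar_add (h.dm_smul a hf) (h.dm_smul b hf) hg]
  set M := ((F f).toReal + (F g).toReal) / 2 with hM
  have hM0 : 0 ≤ M := by positivity
  have h1 : ∀ a, |a| ≤ 1 → |φ a| ≤ M := fun a ha => by
    refine (h.abs_polar_le (h.dm_smul a hf) hg).trans ?_
    rw [h.toReal_smul a hf, hM]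
    have h2 : a ^ 2 ≤ 1 := (sq_le_one_iff_abs_le_one a).2 ha
    have h3 : a ^ 2 * (F f).toReal ≤ 1 * (F f).toReal := by gcongr
    linarith
  have h2 : Continuous φ := by
    refine continuous_of_continuousAt_zero φ (Metric.continuousAt_iff.2 fun ε hε => ?_)
    obtain ⟨n, hn⟩ := exists_nat_gt (M / ε)
    have hn0 : (0 : ℝ) < n := lt_of_le_of_lt (by positivity) hn
    refine ⟨1 / n, by positivity, fun {a} ha => ?_⟩
    rw [map_zero, Real.dist_eq, sub_zero] at *
    have h3 : φ (n • a) = n • φ a := map_nsmul φ n a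
    have h4 := h1 (n • a) (by
      rw [nsmul_eq_mul, abs_mul, Nat.abs_cast]
      rw [lt_div_iff₀ hn0] at ha
      linarith)
    rw [h3, nsmul_eq_mul, abs_mul, Nat.abs_cast] at h4
    rw [div_lt_iff₀ hε] at hn
    nlinarith
  have h3 := map_real_smul φ h2 c 1
  simp only [smul_eq_mul, mul_one] at h3
  simpa [φ] using h3

theorem toReal_sq (hf : f ∈ Dm F) (x y : X) : (f x - f y) ^ 2 ≤ C * (F f).toReal :=
  h.sq (bd_toReal hf) x y

theorem toReal_eq_zero_iff (hf : f ∈ Dm F) : (F f).toReal = 0 ↔ ∃ a : ℝ, ∀ x, f x = a := by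
  constructor
  · intro h0
    refine ⟨f (K.p 0), fun x => ?_⟩
    have := h.toReal_sq hf x (K.p 0)
    rw [h0, mul_zero] at this
    nlinarith [sq_nonneg (f x - f (K.p 0))]
  · rintro ⟨a, ha⟩
    obtain rfl : f = fun _ => a := funext ha
    exact le_antisymm (h.const a).toReal_le ENNReal.toReal_nonneg

theorem complete {u : ℕ → X → ℝ} (hu : ∀ n, u n ∈ Dm F)
    (hc : ∀ ε > 0, ∃ N, ∀ m ≥ N, ∀ n ≥ N, (F (u m - u n)).toReal < ε) :
    ∃ v ∈ Dm F, Tendsto (fun n => (F (u n - v)).toReal) atTop (𝓝 0) := by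
  set w : ℕ → X → ℝ := fun n x => -u n (K.p 0) + u n x with hw
  have hwD : ∀ n, w n ∈ Dm F := fun n => (h.fm.const_add _ (bd_toReal (hu n))).dm
  have h1 : ∀ m n a, Bd F (u m - u n) a → Bd F (w m - w n) a := fun m n a hb => by
    have := h.fm.const_add (-u m (K.p 0) + u n (K.p 0)) hb
    convert this using 1
    funext x
    simp only [hw, Pi.sub_apply]
    ring
  have h2 : ∀ ε > 0, ∃ N, ∀ m ≥ N, ∀ n ≥ N, Bd F (w m - w n) ε := fun ε hε => by
    obtain ⟨N, hN⟩ := hc ε hε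
    exact ⟨N, fun m hm n hn => h1 m n _ ((bd_toReal (h.dm_sub (hu m) (hu n))).mono
      (hN m hm n hn).le)⟩
  have h3 : ∀ x, CauchySeq fun n => w n x := fun x => by
    refine Metric.cauchySeq_iff.2 fun ε hε => ?_
    have hC := h.nonneg
    obtain ⟨N, hN⟩ := h2 (ε ^ 2 / (C + 1)) (by positivity)
    refine ⟨N, fun m hm n hn => ?_⟩
    have h4 := h.sq (hN m hm n hn) x (K.p 0)
    have h5 : C * (ε ^ 2 / (C + 1)) < ε ^ 2 := by
      rw [mul_div_assoc', div_lt_iff₀ (by linarith)]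
      nlinarith [pow_pos hε 2]
    have h6 : ((w m - w n) x - (w m - w n) (K.p 0)) = w m x - w n x := by simp [hw]
    rw [h6] at h4
    rw [Real.dist_eq]
    exact abs_lt_of_sq_lt_sq (h4.trans_lt h5) hε.le
  choose v hv using fun x => cauchySeq_tendsto_of_complete (h3 x)
  have h4 : ∀ ε > 0, ∃ N, ∀ n ≥ N, Bd F (w n - v) ε := fun ε hε => by
    obtain ⟨N, hN⟩ := h2 ε hε
    refine ⟨N, fun n hn => h.lim (u := fun m => w n - w m)
      (tendsto_pi_nhds.2 fun x => (hv x).const_sub (w n x)) ?_⟩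
    filter_upwards [eventually_ge_atTop N] with m hm
    exact hN n hn m hm
  have h5 : v ∈ Dm F := by
    obtain ⟨N, hN⟩ := h4 1 one_pos
    have := h.dm_sub (hwD N) (hN N le_rfl).dm
    rwa [sub_sub_cancel] at this
  refine ⟨v, h5, Metric.tendsto_atTop.2 fun ε hε => ?_⟩
  obtain ⟨N, hN⟩ := h4 (ε / 2) (half_pos hε)
  refine ⟨N, fun n hn => ?_⟩
  have h6 := h.fm.const_add (u n (K.p 0)) (hN n hn)
  have h7 : (fun x => u n (K.p 0) + (w n - v) x) = u n - v := by
    funext x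
    simp only [hw, Pi.sub_apply]
    ring
  rw [h7] at h6
  rw [Real.dist_eq, sub_zero, abs_of_nonneg ENNReal.toReal_nonneg]
  linarith [h6.toReal_le]

omit h in
theorem unit_clip_lip (x y : ℝ) : |min (max x 0) 1 - min (max y 0) 1| ≤ |x - y| := by
  have := clamp_lip 0 1 x y
  have e : ∀ t : ℝ, clamp 0 1 t = min (max t 0) 1 := fun t => by
    rw [clamp, max_min_distrib_left, max_eq_right (zero_le_one' ℝ), min_comm, max_comm]
  rwa [e, e] at this

theorem toReal_rot (hf : f ∈ Dm F) : (F (f ∘ K.rot)).toReal = (F f).toReal := by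
  refine le_antisymm (h.fm.rot _ _ (bd_toReal hf)).toReal_le ?_
  have h1 := h.fm.rot _ _ (h.fm.rot _ _ (bd_toReal (h.fm.rot _ _ (bd_toReal hf)).dm))
  have h2 : ((f ∘ K.rot) ∘ K.rot) ∘ K.rot = f := funext fun x => congrArg f (K.rot_rot x)
  rw [h2] at h1
  exact h1.toReal_le

theorem toReal_self_similar (hα : 0 < α) (hβ : 0 < β) (hf : f ∈ Dm F) :
    (F f).toReal = α * ((F (f ∘ K.T 0)).toReal + (F (f ∘ K.T 1)).toReal +
      (F (f ∘ K.T 2)).toReal) + β * (F (f ∘ K.S)).toReal := by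
  have h1 : ∀ i, F (f ∘ K.T i) ≠ ∞ := h.dm_T hα hβ hf
  have h2 : F (f ∘ K.S) ≠ ∞ := h.dm_S hα hβ hf
  conv_lhs => rw [← h.lam]
  rw [Lam, Fin.sum_univ_three, ENNReal.toReal_add, ENNReal.toReal_mul, ENNReal.toReal_mul,
    ENNReal.toReal_ofReal hα.le, ENNReal.toReal_ofReal hβ.le, ENNReal.toReal_add,
    ENNReal.toReal_add (h1 0) (h1 1)]
  · exact ENNReal.add_ne_top.2 ⟨h1 0, h1 1⟩
  · exact h1 2
  · exact ENNReal.mul_ne_top ENNReal.ofReal_ne_top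
      (ENNReal.add_ne_top.2 ⟨ENNReal.add_ne_top.2 ⟨h1 0, h1 1⟩, h1 2⟩)
  · exact ENNReal.mul_ne_top ENNReal.ofReal_ne_top h2

/-- The resistance form of an energy. -/
noncomputable def form (hα : 0 < α) (hβ : 0 < β) : ResistanceForm X where
  dom := Dm F
  en := polar F
  dom_const := h.dm_const
  dom_add _ _ := h.dm_add
  dom_smul c _ := h.dm_smul c
  symm := h.polar_comm
  add_left _ _ _ := h.polar_add
  smul_left c _ _ := h.polar_smul c
  nonneg f hf := by
    rw [h.polar_self hf]
    exact ENNReal.toReal_nonneg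
  en_eq_zero_iff f hf := by
    rw [h.polar_self hf]
    exact h.toReal_eq_zero_iff hf
  complete u hu hc := by
    obtain ⟨v, hv, hv'⟩ := h.complete hu fun ε hε => by
      obtain ⟨N, hN⟩ := hc ε hε
      refine ⟨N, fun m hm n hn => ?_⟩
      rw [← h.polar_self (h.dm_sub (hu m) (hu n))]
      exact hN m hm n hn
    refine ⟨v, hv, hv'.congr fun n => ?_⟩
    rw [h.polar_self (h.dm_sub (hu n) hv)]
  exten := h.exten hα hβ
  resist_fin x y := ⟨C, fun f hf => by
    rw [h.polar_self hf]
    exact h.toReal_sq hf x y⟩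
  markov f hf := by
    have h1 := h.fm.lip _ _ _ unit_clip_lip (bd_toReal hf)
    refine ⟨h1.dm, ?_⟩
    rw [h.polar_self hf]
    refine le_of_eq_of_le (h.polar_self h1.dm) h1.toReal_le

end Energy
end Gasket
end AG

namespace AG

/-- Barycentric coordinates with respect to the vertices of the triangle. -/
noncomputable def bc (x : E2) : Fin 3 → ℝ :=
  ![2 * √3 / 3 * x 1, 1 - x 0 - √3 / 3 * x 1, x 0 - √3 / 3 * x 1]

/-- The points of the triangle. -/
def PosB (x : E2) : Prop := ∀ i, 0 ≤ bc x i

theorem sqrt_three_mul : √3 * √3 = 3 := Real.mul_self_sqrt (by norm_num)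

theorem e2_zero (a b : ℝ) : e2 a b 0 = a := rfl

theorem e2_one (a b : ℝ) : e2 a b 1 = b := rfl

theorem bc_sum (x : E2) : bc x 0 + bc x 1 + bc x 2 = 1 := by
  simp [bc]
  ring

theorem bc_sum' (x : E2) (i : Fin 3) : bc x i + bc x (i + 1) + bc x (i + 2) = 1 := by
  rw [← bc_sum x]
  fin_cases i <;> simp <;> ring

theorem coord_zero (x : E2) : x 0 = bc x 0 / 2 + bc x 2 := by
  simp [bc]
  ring

theorem coord_one (x : E2) : x 1 = √3 / 2 * bc x 0 := by
  simp only [bc, Matrix.cons_val_zero]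
  linear_combination -(x 1 / 3) * sqrt_three_mul

theorem bc_ext {x y : E2} (h : ∀ i, bc x i = bc y i) : x = y := by
  ext i
  fin_cases i
  · change x 0 = y 0
    rw [coord_zero, coord_zero, h, h]
  · change x 1 = y 1
    rw [coord_one, coord_one, h]

theorem bc_pt (i j : Fin 3) : bc (pt j) i = if i = j then 1 else 0 := by
  have := sqrt_three_mul
  fin_cases j <;> fin_cases i <;> simp [bc, pt, e2_zero, e2_one] <;> linarith

theorem bc_half (x : E2) (i j : Fin 3) :
    bc ((2⁻¹ : ℝ) • (x + pt j)) i = (bc x i + if i = j then 1 else 0) / 2 := by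
  rw [← bc_pt]
  fin_cases i <;> simp [bc] <;> ring

theorem bc_double (x : E2) (i j : Fin 3) :
    bc ((2 : ℝ) • x - pt j) i = 2 * bc x i - if i = j then 1 else 0 := by
  rw [← bc_pt]
  fin_cases i <;> simp [bc] <;> ring

theorem bc_F4 (lam : ℝ) (x : E2) (i : Fin 3) :
    bc (F4 lam x) i = bc x i / 2 + lam * bc x (i + 1) + (1 / 2 - lam) * bc x (i + 2) := by
  have := sqrt_three_mul
  fin_cases i <;> simp [bc, F4, e2_zero, e2_one]
  · linear_combination (2 / 3 * (1 / 4 - lam) * x 0 + lam / 3) * this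
  · linear_combination (-(1 / 3) * (1 / 4 - lam) * x 0 - lam / 6) * this
  · linear_combination (-(1 / 3) * (1 / 4 - lam) * x 0 - lam / 6) * this

theorem bc_rot3 (x : E2) (i : Fin 3) : bc (rot3 x) (i + 1) = bc x i := by
  have := sqrt_three_mul
  fin_cases i <;> simp [bc, rot3, e2_zero, e2_one]
  · linear_combination (-1 / 12 - x 0 / 6) * this
  · linear_combination (1 / 12 - x 0 / 6) * this
  · linear_combination (x 0 / 3) * this

theorem continuous_bc (i : Fin 3) : Continuous fun x => bc x i := by
  fin_cases i <;> simp [bc] <;> fun_prop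

theorem F4_injective (lam : ℝ) : Function.Injective (F4 lam) := by
  intro x y h
  have e : ∀ i, bc (F4 lam x) i = bc (F4 lam y) i := fun i => by rw [h]
  have e0 := e 0
  have e1 := e 1
  have e2 := e 2
  simp only [bc_F4, zero_add, Fin.reduceAdd] at e0 e1 e2
  have hx := bc_sum x
  have hy := bc_sum y
  have key : (bc x 0 - bc y 0) ^ 2 + (bc x 1 - bc y 1) ^ 2 + (bc x 2 - bc y 2) ^ 2 = 0 := by
    linear_combination 4 * (bc x 0 - bc y 0) * e0 + 4 * (bc x 1 - bc y 1) * e1 +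
      4 * (bc x 2 - bc y 2) * e2 -
      (bc x 0 - bc y 0 + (bc x 1 - bc y 1) + (bc x 2 - bc y 2)) * (hx - hy)
  refine bc_ext fun i => ?_
  fin_cases i <;> simp <;> nlinarith [sq_nonneg (bc x 0 - bc y 0), sq_nonneg (bc x 1 - bc y 1),
    sq_nonneg (bc x 2 - bc y 2)]

theorem half_injective (j : Fin 3) : Function.Injective fun x : E2 => (2⁻¹ : ℝ) • (x + pt j) := by
  intro x y h
  simpa using h

/-- The two points differ by at most `r` in each barycentric coordinate. -/
def Close (r : ℝ) (x y : E2) : Prop := ∀ i, |bc x i - bc y i| ≤ r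

theorem Close.half {r : ℝ} {x y : E2} (h : Close r x y) (j : Fin 3) :
    Close (r / 2) ((2⁻¹ : ℝ) • (x + pt j)) ((2⁻¹ : ℝ) • (y + pt j)) := by
  intro i
  have := abs_le.1 (h i)
  rw [bc_half, bc_half, abs_le]
  constructor <;> linarith

theorem Close.F4 {r lam : ℝ} (hlam : lam ∈ Set.Ioo (0 : ℝ) (1 / 2)) {x y : E2}
    (h : Close r x y) : Close (r / 2) (F4 lam x) (F4 lam y) := by
  intro i
  have h0 := abs_le.1 (h i)
  have h1 := abs_le.1 (h (i + 1))
  have h2 := abs_le.1 (h (i + 2))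
  have hx := bc_sum' x i
  have hy := bc_sum' y i
  rw [bc_F4, bc_F4, abs_le]
  obtain ⟨l0, l1⟩ := hlam
  constructor
  · nlinarith [mul_nonneg l0.le (sub_nonneg.2 h2.2),
      mul_nonneg (sub_nonneg.2 l1.le) (sub_nonneg.2 h1.2)]
  · nlinarith [mul_nonneg l0.le (neg_le_iff_add_nonneg.1 h2.1),
      mul_nonneg (sub_nonneg.2 l1.le) (neg_le_iff_add_nonneg.1 h1.1)]

theorem PosB.le_one {x : E2} (h : PosB x) (i : Fin 3) : bc x i ≤ 1 := by
  have := bc_sum' x i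
  linarith [h (i + 1), h (i + 2)]

theorem PosB.close {x y : E2} (hx : PosB x) (hy : PosB y) : Close 1 x y := by
  intro i
  rw [abs_le]
  constructor <;> linarith [hx i, hy i, hx.le_one i, hy.le_one i]

theorem PosB.eq_pt {x : E2} (h : PosB x) {i : Fin 3} (hi : bc x i = 1) : x = pt i := by
  have h1 := bc_sum' x i
  have h2 := h (i + 1)
  have h3 := h (i + 2)
  have e1 : bc x (i + 1) = 0 := by linarith
  have e2 : bc x (i + 2) = 0 := by linarith
  refine bc_ext fun k => ?_
  rw [bc_pt]
  fin_cases i <;> fin_cases k <;> simp_all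

theorem posB_pt (j : Fin 3) : PosB (pt j) := by
  intro i
  rw [bc_pt]
  split_ifs <;> norm_num

theorem rot3_half (x : E2) (j : Fin 3) :
    rot3 ((2⁻¹ : ℝ) • (x + pt j)) = (2⁻¹ : ℝ) • (rot3 x + pt (j + 1)) := by
  refine bc_ext fun i => ?_
  obtain ⟨k, rfl⟩ : ∃ k, k + 1 = i := ⟨i - 1, by simp⟩
  rw [bc_rot3, bc_half, bc_half, bc_rot3]
  simp

theorem rot3_F4 (lam : ℝ) (x : E2) : rot3 (F4 lam x) = F4 lam (rot3 x) := by
  refine bc_ext fun i => ?_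
  obtain ⟨k, rfl⟩ : ∃ k, k + 1 = i := ⟨i - 1, by simp⟩
  rw [bc_rot3, bc_F4, bc_F4, bc_rot3, bc_rot3, add_right_comm k 1 2, bc_rot3]

theorem rot3_pt (j : Fin 3) : rot3 (pt j) = pt (j + 1) := by
  refine bc_ext fun i => ?_
  obtain ⟨k, rfl⟩ : ∃ k, k + 1 = i := ⟨i - 1, by simp⟩
  rw [bc_rot3, bc_pt, bc_pt]
  simp

theorem rot3_rot3_rot3 (x : E2) : rot3 (rot3 (rot3 x)) = x := by
  refine bc_ext fun i => ?_
  obtain ⟨k, rfl⟩ : ∃ k, k + 1 + 1 + 1 = i := ⟨i, by fin_cases i <;> rfl⟩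
  rw [bc_rot3, bc_rot3, bc_rot3]
  congr 1
  fin_cases k <;> rfl

theorem posB_rot3 {x : E2} (h : PosB x) : PosB (rot3 x) := by
  intro i
  obtain ⟨k, rfl⟩ : ∃ k, k + 1 = i := ⟨i - 1, by simp⟩
  rw [bc_rot3]
  exact h k

theorem Fmap_castSucc (lam : ℝ) (j : Fin 3) (x : E2) :
    Fmap lam j.castSucc x = (2⁻¹ : ℝ) • (x + pt j) := by
  fin_cases j <;> rfl

theorem Fmap_last (lam : ℝ) (x : E2) : Fmap lam 3 x = F4 lam x := rfl

theorem Close.Fmap {r lam : ℝ} (hlam : lam ∈ Set.Ioo (0 : ℝ) (1 / 2)) {x y : E2}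
    (h : Close r x y) (j : Fin 4) : Close (r / 2) (Fmap lam j x) (Fmap lam j y) := by
  induction j using Fin.lastCases with
  | last => exact h.F4 hlam
  | cast j =>
    rw [Fmap_castSucc, Fmap_castSucc]
    exact h.half j

variable {lam : ℝ} {K : Set E2}

theorem _root_.IsAG.map_mem (hK : IsAG lam K) (j : Fin 4) {x : E2} (hx : x ∈ K) : Fmap lam j x ∈ K := by
  rw [hK.2.2]
  exact Set.mem_iUnion.2 ⟨j, x, hx, rfl⟩

theorem _root_.IsAG.cover (hK : IsAG lam K) {x : E2} (hx : x ∈ K) :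
    (∃ j : Fin 3, ∃ y ∈ K, (2⁻¹ : ℝ) • (y + pt j) = x) ∨ ∃ y ∈ K, F4 lam y = x := by
  rw [hK.2.2] at hx
  obtain ⟨j, y, hy, rfl⟩ := Set.mem_iUnion.1 hx
  induction j using Fin.lastCases with
  | last => exact Or.inr ⟨y, hy, rfl⟩
  | cast j => exact Or.inl ⟨j, y, hy, (Fmap_castSucc lam j y).symm⟩

theorem _root_.IsAG.posB (hK : IsAG lam K) (hlam : lam ∈ Set.Ioo (0 : ℝ) (1 / 2)) {x : E2}
    (hx : x ∈ K) : PosB x := by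
  obtain ⟨z, hz, hmin⟩ := hK.2.1.exists_isMinOn hK.1
    (f := fun x => min (bc x 0) (min (bc x 1) (bc x 2)))
    ((continuous_bc 0).min ((continuous_bc 1).min (continuous_bc 2))).continuousOn
  obtain ⟨m, hm⟩ : ∃ m, m = min (bc z 0) (min (bc z 1) (bc z 2)) := ⟨_, rfl⟩
  have hb : ∀ y ∈ K, ∀ i, m ≤ bc y i := by
    intro y hy i
    have : m ≤ min (bc y 0) (min (bc y 1) (bc y 2)) := hm.trans_le (hmin hy)
    simp only [le_min_iff] at this
    fin_cases i
    exacts [this.1, this.2.1, this.2.2]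
  obtain ⟨i, hi⟩ : ∃ i, bc z i = m := by
    rcases min_choice (bc z 0) (min (bc z 1) (bc z 2)) with h | h
    · exact ⟨0, by rw [hm, h]⟩
    · rcases min_choice (bc z 1) (bc z 2) with h' | h'
      · exact ⟨1, by rw [hm, h, h']⟩
      · exact ⟨2, by rw [hm, h, h']⟩
  suffices 0 ≤ m from fun i => this.trans (hb x hx i)
  by_contra! hneg
  rcases hK.cover hz with ⟨j, y, hy, rfl⟩ | ⟨y, hy, rfl⟩
  · have := hb y hy i
    rw [bc_half] at hi
    split_ifs at hi <;> linarith
  · have h0 := sub_nonneg.2 (hb y hy i)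
    have h1 := sub_nonneg.2 (hb y hy (i + 1))
    have h2 := sub_nonneg.2 (hb y hy (i + 2))
    have hs := bc_sum' y i
    obtain ⟨l0, l1⟩ := hlam
    rw [bc_F4] at hi
    have p1 := mul_nonneg l0.le h1
    have p2 := mul_nonneg (sub_nonneg.2 l1.le) h2
    have z1 : lam * (bc y (i + 1) - m) = 0 := by linarith
    have z2 : (1 / 2 - lam) * (bc y (i + 2) - m) = 0 := by linarith
    have y1 := (mul_eq_zero.1 z1).resolve_left l0.ne'
    have y2 := (mul_eq_zero.1 z2).resolve_left (sub_pos.2 l1).ne'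
    linarith

/-- A subset of the triangle contained in the union of its images lies in the attractor. -/
theorem _root_.IsAG.subset_of_covered (hK : IsAG lam K) (hlam : lam ∈ Set.Ioo (0 : ℝ) (1 / 2))
    {Z : Set E2} (hZ : ∀ z ∈ Z, PosB z) (hc : ∀ z ∈ Z, ∃ j, ∃ w ∈ Z, Fmap lam j w = z) :
    Z ⊆ K := by
  have key : ∀ n : ℕ, ∀ z ∈ Z, ∃ k ∈ K, Close ((1 / 2) ^ n) z k := by
    intro n
    induction n with
    | zero =>
      intro z hz
      obtain ⟨k, hk⟩ := hK.1
      exact ⟨k, hk, by simpa using (hZ z hz).close (hK.posB hlam hk)⟩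
    | succ n ih =>
      intro z hz
      obtain ⟨j, w, hw, rfl⟩ := hc z hz
      obtain ⟨k, hk, hwk⟩ := ih w hw
      refine ⟨_, hK.map_mem j hk, ?_⟩
      have := hwk.Fmap hlam j
      rwa [pow_succ, mul_one_div]
  intro z hz
  obtain ⟨k, hk, hmin⟩ := hK.2.1.exists_isMinOn hK.1 (f := fun k => ∑ i, |bc z i - bc k i|)
    (continuous_finsetSum _ fun i _ =>
      (continuous_const.sub (continuous_bc i)).abs).continuousOn
  have hle : ∀ n : ℕ, ∑ i, |bc z i - bc k i| ≤ 3 * (1 / 2) ^ n := by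
    intro n
    obtain ⟨k', hk', h⟩ := key n z hz
    refine (hmin hk').trans ?_
    refine (Finset.sum_le_sum fun i _ => h i).trans ?_
    simp
  have hlim : Tendsto (fun n : ℕ => 3 * (1 / 2 : ℝ) ^ n) atTop (𝓝 (3 * 0)) :=
    (tendsto_pow_atTop_nhds_zero_of_lt_one (by norm_num) (by norm_num)).const_mul 3
  have h0 : ∑ i, |bc z i - bc k i| ≤ 0 := by
    simpa using ge_of_tendsto' hlim hle
  have : z = k := bc_ext fun i => by
    have h1 : |bc z i - bc k i| ≤ ∑ i, |bc z i - bc k i| :=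
      Finset.single_le_sum (f := fun i => |bc z i - bc k i|) (fun i _ => abs_nonneg _)
        (Finset.mem_univ i)
    exact sub_eq_zero.1 (abs_nonpos_iff.1 (h1.trans h0))
  exact this ▸ hk

theorem half_pt (j : Fin 3) : (2⁻¹ : ℝ) • (pt j + pt j) = pt j := by
  rw [← two_smul ℝ, smul_smul]
  norm_num

theorem _root_.IsAG.pt_mem (hK : IsAG lam K) (hlam : lam ∈ Set.Ioo (0 : ℝ) (1 / 2)) (j : Fin 3) :
    pt j ∈ K := by
  refine hK.subset_of_covered hlam (Z := Set.range pt) ?_ ?_ ⟨j, rfl⟩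
  · rintro _ ⟨j, rfl⟩
    exact posB_pt j
  · rintro _ ⟨j, rfl⟩
    exact ⟨j.castSucc, pt j, ⟨j, rfl⟩, by rw [Fmap_castSucc, half_pt]⟩

theorem _root_.IsAG.rot3_mem (hK : IsAG lam K) (hlam : lam ∈ Set.Ioo (0 : ℝ) (1 / 2)) {x : E2}
    (hx : x ∈ K) : rot3 x ∈ K := by
  refine hK.subset_of_covered hlam (Z := rot3 '' K) ?_ ?_ ⟨x, hx, rfl⟩
  · rintro _ ⟨x, hx, rfl⟩
    exact posB_rot3 (hK.posB hlam hx)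
  · rintro _ ⟨x, hx, rfl⟩
    rcases hK.cover hx with ⟨j, y, hy, rfl⟩ | ⟨y, hy, rfl⟩
    · exact ⟨(j + 1).castSucc, rot3 y, ⟨y, hy, rfl⟩, by rw [Fmap_castSucc, rot3_half]⟩
    · exact ⟨3, rot3 y, ⟨y, hy, rfl⟩, by rw [Fmap_last, rot3_F4]⟩

theorem half_double (x : E2) (j : Fin 3) : (2⁻¹ : ℝ) • ((2 : ℝ) • x - pt j + pt j) = x := by
  rw [sub_add_cancel, smul_smul]
  norm_num

theorem edge_step {x : E2} (hx : PosB x) {i : Fin 3} (hi : bc x i = 0) :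
    ∃ l, l ≠ i ∧ PosB ((2 : ℝ) • x - pt l) ∧ bc ((2 : ℝ) • x - pt l) i = 0 := by
  have hs := bc_sum' x i
  obtain ⟨l, hl, h⟩ : ∃ l, l ≠ i ∧ 1 / 2 ≤ bc x l := by
    rcases le_total (1 / 2) (bc x (i + 1)) with h | h
    · exact ⟨i + 1, by simp, h⟩
    · exact ⟨i + 2, by fin_cases i <;> decide, by linarith⟩
  refine ⟨l, hl, fun k => ?_, ?_⟩
  · rw [bc_double]
    have := hx k
    split_ifs with hk
    · subst hk
      linarith
    · linarith
  · rw [bc_double, if_neg hl.symm, hi]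
    norm_num

theorem _root_.IsAG.edge_mem (hK : IsAG lam K) (hlam : lam ∈ Set.Ioo (0 : ℝ) (1 / 2)) {x : E2}
    (hx : PosB x) {i : Fin 3} (hi : bc x i = 0) : x ∈ K := by
  refine hK.subset_of_covered hlam (Z := {x | PosB x ∧ bc x i = 0}) (fun z hz => hz.1) ?_ ⟨hx, hi⟩
  rintro z ⟨hz, hzi⟩
  obtain ⟨l, -, h1, h2⟩ := edge_step hz hzi
  exact ⟨l.castSucc, _, ⟨h1, h2⟩, by rw [Fmap_castSucc, half_double]⟩

theorem _root_.IsAG.half_mem (hK : IsAG lam K) (j : Fin 3) {x : E2} (hx : x ∈ K) :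
    (2⁻¹ : ℝ) • (x + pt j) ∈ K := by
  rw [← Fmap_castSucc lam]
  exact hK.map_mem _ hx

theorem _root_.IsAG.F4_mem (hK : IsAG lam K) {x : E2} (hx : x ∈ K) : F4 lam x ∈ K :=
  hK.map_mem 3 hx

/-- The contact point of the inner cell with the `i`th corner cell, pulled back to the whole. -/
noncomputable def qt (lam : ℝ) (i : Fin 3) : E2 := (2 : ℝ) • F4 lam (pt i) - pt i

theorem bc_qt (lam : ℝ) (i : Fin 3) :
    bc (qt lam i) i = 0 ∧ bc (qt lam i) (i + 1) = 1 - 2 * lam ∧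
      bc (qt lam i) (i + 2) = 2 * lam := by
  simp only [qt, bc_double, bc_F4, bc_pt]
  fin_cases i <;> simp <;> ring_nf

theorem posB_qt (hlam : lam ∈ Set.Ioo (0 : ℝ) (1 / 2)) (i : Fin 3) : PosB (qt lam i) := by
  obtain ⟨h0, h1, h2⟩ := bc_qt lam i
  have := hlam.1
  have := hlam.2
  intro k
  obtain rfl | rfl | rfl := Gasket.eq_cases k i
  all_goals linarith

theorem qt_ne (hlam : lam ∈ Set.Ioo (0 : ℝ) (1 / 2)) (i j : Fin 3) : qt lam i ≠ pt j := by
  obtain ⟨h0, h1, h2⟩ := bc_qt lam i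
  have := hlam.1
  have := hlam.2
  intro h
  rw [h, bc_pt] at h0 h1 h2
  split_ifs at h0 h1 h2 <;> linarith

theorem half_sep {i j : Fin 3} {x y : E2} (hx : PosB x) (hy : PosB y) (hij : i ≠ j)
    (h : (2⁻¹ : ℝ) • (x + pt i) = (2⁻¹ : ℝ) • (y + pt j)) : x = pt j ∧ y = pt i := by
  have e : ∀ k, (bc x k + if k = i then 1 else 0) / 2 = (bc y k + if k = j then 1 else 0) / 2 :=
    fun k => by rw [← bc_half, ← bc_half, h]
  have ei := e i
  have ej := e j
  simp only [if_pos, if_neg hij, if_neg hij.symm] at ei ej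
  exact ⟨hx.eq_pt (by linarith [hx.le_one j, hy j]), hy.eq_pt (by linarith [hy.le_one i, hx i])⟩

theorem F4_sep (hlam : lam ∈ Set.Ioo (0 : ℝ) (1 / 2)) {i : Fin 3} {x y : E2} (hx : PosB x)
    (hy : PosB y) (h : F4 lam x = (2⁻¹ : ℝ) • (y + pt i)) : x = pt i ∧ y = qt lam i := by
  have e : bc (F4 lam x) i = (bc y i + 1) / 2 := by
    rw [h, bc_half, if_pos rfl]
  have hyi := hy i
  have hs := bc_sum' x i
  obtain ⟨l0, l1⟩ := hlam
  rw [bc_F4] at e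
  have e1 := mul_nonneg (sub_nonneg.2 l1.le) (hx (i + 1))
  have e2 := mul_nonneg l0.le (hx (i + 2))
  have hz1 : (1 / 2 - lam) * bc x (i + 1) = 0 := by linarith
  have hz2 : lam * bc x (i + 2) = 0 := by linarith
  have y1 := (mul_eq_zero.1 hz1).resolve_left (sub_pos.2 l1).ne'
  have y2 := (mul_eq_zero.1 hz2).resolve_left l0.ne'
  have hxp : x = pt i := hx.eq_pt (by linarith)
  refine ⟨hxp, ?_⟩
  rw [qt, ← hxp, h, hxp, smul_smul]
  norm_num

end AG

namespace AG

variable {lam : ℝ} {K : Set E2}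

/-- The affine function on the triangle with given values at the vertices. -/
noncomputable def affB (x : Fin 3 → ℝ) (z : E2) : ℝ := ∑ i, x i * bc z i

theorem affB_pt (x : Fin 3 → ℝ) (i : Fin 3) : affB x (pt i) = x i := by
  simp [affB, bc_pt]

theorem affB_half (x : Fin 3 → ℝ) (z : E2) (i : Fin 3) :
    affB x ((2⁻¹ : ℝ) • (z + pt i)) = affB (fun j => (x i + x j) / 2) z := by
  have hz := bc_sum z
  simp only [affB, bc_half, Fin.sum_univ_three]
  fin_cases i <;> simp
  · linear_combination (-x 0 / 2) * hz
  · linear_combination (-x 1 / 2) * hz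
  · linear_combination (-x 2 / 2) * hz

theorem affB_mem (x : Fin 3 → ℝ) {m M : ℝ} (h : ∀ i, m ≤ x i ∧ x i ≤ M) {z : E2} (hz : PosB z) :
    m ≤ affB x z ∧ affB x z ≤ M := by
  have hs := bc_sum z
  have hl : ∀ i, 0 ≤ (x i - m) * bc z i := fun i => mul_nonneg (sub_nonneg.2 (h i).1) (hz i)
  have hu : ∀ i, 0 ≤ (M - x i) * bc z i := fun i => mul_nonneg (sub_nonneg.2 (h i).2) (hz i)
  rw [affB, Fin.sum_univ_three]
  constructor
  · linear_combination (hl 0) + (hl 1) + (hl 2) - m * hs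
  · linear_combination (hu 0) + (hu 1) + (hu 2) + M * hs

theorem affB_close (x : Fin 3 → ℝ) {r : ℝ} {z w : E2} (h : Close r z w) :
    |affB x z - affB x w| ≤ (∑ i, |x i|) * r := by
  rw [affB, affB, ← Finset.sum_sub_distrib, Finset.sum_mul]
  refine (Finset.abs_sum_le_sum_abs _ _).trans (Finset.sum_le_sum fun i _ => ?_)
  rw [← mul_sub, abs_mul]
  exact mul_le_mul_of_nonneg_left (h i) (abs_nonneg _)

/-- The corner maps of the attractor. -/
noncomputable def cornerMap (hK : IsAG lam K) (j : Fin 3) (x : K) : K :=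
  ⟨(2⁻¹ : ℝ) • (↑x + pt j), hK.half_mem j x.2⟩

/-- The inner map of the attractor. -/
noncomputable def innerMap (hK : IsAG lam K) (x : K) : K := ⟨F4 lam x, hK.F4_mem x.2⟩

theorem near_close (hK : IsAG lam K) (hlam : lam ∈ Set.Ioo (0 : ℝ) (1 / 2)) {n : ℕ} {x y : K}
    (h : Near (cornerMap hK) (innerMap hK) n x y) : Close ((1 / 2) ^ n) (x : E2) y := by
  induction n generalizing x y with
  | zero => simpa using (hK.posB hlam x.2).close (hK.posB hlam y.2)
  | succ n ih =>
    rw [pow_succ, mul_one_div]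
    rcases h with ⟨i, x', y', h, rfl, rfl⟩ | ⟨x', y', h, rfl, rfl⟩
    · exact (ih h).half i
    · exact (ih h).F4 hlam

/-- The attractor `AG_λ` carries the combinatorial structure of a gasket. -/
noncomputable def gasket (hK : IsAG lam K) (hlam : lam ∈ Set.Ioo (0 : ℝ) (1 / 2)) : Gasket K where
  T := cornerMap hK
  S := innerMap hK
  p i := ⟨pt i, hK.pt_mem hlam i⟩
  q i := ⟨qt lam i, hK.edge_mem hlam (posB_qt hlam i) (bc_qt lam i).1⟩
  rot x := ⟨rot3 x, hK.rot3_mem hlam x.2⟩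
  Edge i := {x | bc x i = 0}
  cover x := by
    rcases hK.cover x.2 with ⟨j, y, hy, h⟩ | ⟨y, hy, h⟩
    · exact Or.inl ⟨j, ⟨y, hy⟩, Subtype.ext h⟩
    · exact Or.inr ⟨⟨y, hy⟩, Subtype.ext h⟩
  T_inj i x y h := Subtype.ext (half_injective i (congrArg Subtype.val h))
  S_inj x y h := Subtype.ext (F4_injective lam (congrArg Subtype.val h))
  T_p i := Subtype.ext (half_pt i)
  T_cross i j := Subtype.ext (congrArg ((2⁻¹ : ℝ) • ·) (add_comm _ _))
  T_sep i j x y hij h := by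
    have := half_sep (hK.posB hlam x.2) (hK.posB hlam y.2) hij (congrArg Subtype.val h)
    exact ⟨Subtype.ext this.1, Subtype.ext this.2⟩
  S_p i := Subtype.ext (half_double _ i).symm
  S_sep i x y h := by
    have := F4_sep hlam (hK.posB hlam x.2) (hK.posB hlam y.2) (congrArg Subtype.val h)
    exact ⟨Subtype.ext this.1, Subtype.ext this.2⟩
  rot_p i := Subtype.ext (rot3_pt i)
  rot_T i x := Subtype.ext (rot3_half x i)
  rot_S x := Subtype.ext (rot3_F4 lam x)
  rot_rot x := Subtype.ext (rot3_rot3_rot3 x)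
  q_edge i := (bc_qt lam i).1
  edge_step i x hx := by
    obtain ⟨l, hl, h1, h2⟩ := edge_step (hK.posB hlam x.2) hx
    exact ⟨l, hl, ⟨_, hK.edge_mem hlam h1 h2⟩, h2, Subtype.ext (half_double _ l)⟩
  q_ne i j h := qt_ne hlam i j (congrArg Subtype.val h)
  near x y h := by
    refine Subtype.ext (bc_ext fun i => ?_)
    have hlim := tendsto_pow_atTop_nhds_zero_of_lt_one (r := (1 / 2 : ℝ)) (by norm_num)
      (by norm_num)
    exact sub_eq_zero.1 (abs_nonpos_iff.1 (ge_of_tendsto' hlim fun n =>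
      near_close hK hlam (h n) i))
  aff x z := affB x z
  aff_p x i := affB_pt x i
  aff_T x i := funext fun z => affB_half x z i
  aff_mem x m M h z := affB_mem x h (hK.posB hlam z.2)
  aff_osc x ε hε := by
    have hlim : Tendsto (fun n : ℕ => (∑ i, |x i|) * (1 / 2 : ℝ) ^ n) atTop (𝓝 _) :=
      (tendsto_pow_atTop_nhds_zero_of_lt_one (by norm_num) (by norm_num)).const_mul _
    rw [mul_zero] at hlim
    obtain ⟨n, hn⟩ := (hlim.eventually_le_const hε).exists
    exact ⟨n, fun z w h => (affB_close x (near_close hK hlam h)).trans hn⟩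

end AG

/-- **existence, Theorem 3.6.** For every `λ ∈ (0,1/2)` and
`s ∈ (0,1)` there exists `r ∈ [3/5, 1)` with `𝓔(λ,s,r) ≠ ∅`: there is a
`G`-symmetric self-similar resistance form on `AG_λ` with renormalization
factors `(r, r, r, s)`. -/
theorem stmt11 (lam s : ℝ) (hlam : lam ∈ Set.Ioo (0:ℝ) (1/2)) (hs : s ∈ Set.Ioo (0:ℝ) 1)
    (K : Set E2) (hK : IsAG lam K) :
    ∃ r ∈ Set.Ico (3/5 : ℝ) 1, ∃ RF : ResistanceForm ↥K, MemE lam s r K RF := by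
  have hβ : 1 < s⁻¹ := (one_lt_inv₀ hs.1).2 hs.2
  have hβ0 : 0 < s⁻¹ := zero_lt_one.trans hβ
  obtain ⟨α, h1, h2, C, F, h⟩ := AG.Gasket.exists_energy (AG.gasket hK hlam) hβ
  have hα : 0 < α := zero_lt_one.trans h1
  refine ⟨α⁻¹, ⟨?_, inv_lt_one_of_one_lt₀ h1⟩, h.form hα hβ0,
    ⟨Fin.snoc (α := fun _ => K → K) (AG.cornerMap hK) (AG.innerMap hK), fun i x => ?_,
      fun f hf => ⟨fun i => ?_, ?_⟩⟩,
    (AG.gasket hK hlam).rot, fun x => rfl, fun f hf => ?_⟩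
  · rw [le_inv_comm₀ (by norm_num) hα]
    norm_num
    exact h2
  · induction i using Fin.lastCases with
    | last => rw [Fin.snoc_last]; rfl
    | cast j => rw [Fin.snoc_castSucc, AG.Fmap_castSucc]; rfl
  · induction i using Fin.lastCases with
    | last => rw [Fin.snoc_last]; exact h.dm_S hα hβ0 hf
    | cast j => rw [Fin.snoc_castSucc]; exact h.dm_T hα hβ0 hf j
  · change AG.Gasket.polar F f f = α⁻¹⁻¹ *
      (AG.Gasket.polar F (f ∘ (AG.gasket hK hlam).T 0) (f ∘ (AG.gasket hK hlam).T 0) +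
        AG.Gasket.polar F (f ∘ (AG.gasket hK hlam).T 1) (f ∘ (AG.gasket hK hlam).T 1) +
        AG.Gasket.polar F (f ∘ (AG.gasket hK hlam).T 2) (f ∘ (AG.gasket hK hlam).T 2)) +
      s⁻¹ * AG.Gasket.polar F (f ∘ (AG.gasket hK hlam).S) (f ∘ (AG.gasket hK hlam).S)
    rw [inv_inv, h.polar_self hf, h.polar_self (h.dm_T hα hβ0 hf 0),
      h.polar_self (h.dm_T hα hβ0 hf 1), h.polar_self (h.dm_T hα hβ0 hf 2),
      h.polar_self (h.dm_S hα hβ0 hf)]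
    exact h.toReal_self_similar hα hβ0 hf
  · have hr : f ∘ (AG.gasket hK hlam).rot ∈ AG.Gasket.Dm F :=
      (h.fm.rot _ _ (AG.Gasket.bd_toReal hf)).dm
    refine ⟨hr, ?_⟩
    exact (h.polar_self hr).trans ((h.toReal_rot hf).trans (h.polar_self hf).symm)
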